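/- arXiv:1507.01258 — 3 statements merged into one kernel-verified Lean document; each statement's English description precedes it below -/
import Mathlib

section
/- Let W = e^{−Q} ∈ F(C²) with Q even, let α ∈ (1, ∞], and suppose the function T(t) = tQ'(t)/Q(t) satisfies lim_{x→∞} T(x) = α. Then for every x ∈ (−1,1) \ {0}, lim_{n→∞} σ_n*(x) = μ'_α(x). -/
open MeasureTheory ProbabilityTheory Filter Set Topology
open scoped ENNReal NNReal Classical

noncomputable section

/-- The class `F(C²)` of Levin–Lubinsky: conditions on `Q` (with derivative `Q'` and
second derivative `Q''` away from the origin) so that `W = e^{-Q} ∈ F(C²)`. -/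
structure IsFC2 (Q Q' Q'' : ℝ → ℝ) : Prop where
  nonneg : ∀ x, 0 ≤ Q x
  hasDeriv : ∀ x, HasDerivAt Q (Q' x) x
  contDeriv : Continuous Q'
  zeroAtZero : Q 0 = 0
  monoDeriv : Monotone Q'
  hasDeriv2 : ∀ x ≠ 0, HasDerivAt Q' (Q'' x) x
  tendstoTop : Tendsto Q atTop atTop
  tendstoBot : Tendsto Q atBot atTop
  quasiIncr : ∃ C > 0, ∀ x y : ℝ, 0 < x → x < y →
      x * Q' x / Q x ≤ C * (y * Q' y / Q y)
  quasiIncrNeg : ∃ C > 0, ∀ x y : ℝ, y < x → x < 0 →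
      x * Q' x / Q x ≤ C * (y * Q' y / Q y)
  lambdaBound : ∃ Λ > 1, ∀ t : ℝ, t ≠ 0 → Λ ≤ t * Q' t / Q t
  derivRatio : ∃ C > 0, ∀ x : ℝ, x ≠ 0 → Q'' x / |Q' x| ≤ C * (|Q' x| / Q x)

/-- The Mhaskar–Rakhmanov–Saff numbers `a n > 0` for an even external field `Q`,
defined by `(2/π) ∫₀¹ aₙ t Q'(aₙ t)/√(1-t²) dt = n`. -/
def IsMRSeven (Q' : ℝ → ℝ) (a : ℕ → ℝ) : Prop :=
  ∀ n : ℕ, 1 ≤ n → 0 < a n ∧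
    (2 / Real.pi) * ∫ t in (0:ℝ)..1, a n * t * Q' (a n * t) / Real.sqrt (1 - t ^ 2)
      = (n : ℝ)

/-- Density of the Ullman distribution `μ_α` on `[-1,1]` for `0 < α < ∞`;
for `α = ∞` it is the arcsine density `1/(π√(1-x²))`. -/
def ullmanDensity (α : ℝ≥0∞) (x : ℝ) : ℝ :=
  if α = ⊤ then 1 / (Real.pi * Real.sqrt (1 - x ^ 2))
  else (α.toReal / Real.pi) *
    ∫ t in (|x|)..1, t ^ (α.toReal - 1) / Real.sqrt (t ^ 2 - x ^ 2)

/-- The Ullman distribution `μ_α` (arcsine distribution for `α = ∞`) as a measure on `ℝ`. -/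
def ullmanMeasure (α : ℝ≥0∞) : Measure ℝ :=
  (volume.restrict (Icc (-1:ℝ) 1)).withDensity fun x => ENNReal.ofReal (ullmanDensity α x)

/-- The Ullman distribution `μ_α` as a measure on `ℂ` (supported on `[-1,1] ⊆ ℝ ⊆ ℂ`). -/
def ullmanMeasureC (α : ℝ≥0∞) : Measure ℂ :=
  (ullmanMeasure α).map Complex.ofReal

/-- The equilibrium density `σₙ` for an even external field `Q` with MRS numbers `aₙ`:
`σₙ(x) = (√(aₙ²-x²)/π²) ∫_{-aₙ}^{aₙ} (Q'(s)-Q'(x))/(s-x) · ds/√(aₙ²-s²)`. -/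
def eqDensityEven (Q' : ℝ → ℝ) (a : ℕ → ℝ) (n : ℕ) (x : ℝ) : ℝ :=
  Real.sqrt ((a n) ^ 2 - x ^ 2) / Real.pi ^ 2 *
    ∫ s in (-(a n))..(a n), ((Q' s - Q' x) / (s - x)) / Real.sqrt ((a n) ^ 2 - s ^ 2)

/-- The normalized equilibrium density `σₙ*(s) = (aₙ/n) σₙ(aₙ s)` in the even case. -/
def eqDensityEvenStar (Q' : ℝ → ℝ) (a : ℕ → ℝ) (n : ℕ) (s : ℝ) : ℝ :=
  (a n / n) * eqDensityEven Q' a n (a n * s)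


/-- Inverse hyperbolic tangent. -/
def atnh (y : ℝ) : ℝ := (Real.log (1 + y) - Real.log (1 - y)) / 2

lemma atnh_zero : atnh 0 = 0 := by simp [atnh]

lemma hasDerivAt_atnh {u : ℝ → ℝ} {u' t : ℝ} (hu : HasDerivAt u u' t) (h0 : 0 ≤ u t)
    (h1 : u t < 1) : HasDerivAt (fun t => atnh (u t)) (u' / (1 - (u t) ^ 2)) t := by
  have h2 : 1 + u t ≠ 0 := by linarith
  have h3 : 1 - u t ≠ 0 := by linarith
  have := (((hu.const_add 1).log h2).sub ((hu.const_sub 1).log h3)).div_const 2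
  refine this.congr_deriv ?_
  have h4 : 1 - (u t) ^ 2 ≠ 0 := by
    have : 1 - (u t)^2 = (1 + u t) * (1 - u t) := by ring
    rw [this]; exact mul_ne_zero h2 h3
  field_simp
  ring

lemma contOn_atnh {u : ℝ → ℝ} {s : Set ℝ} (hu : ContinuousOn u s) (h0 : ∀ t ∈ s, 0 ≤ u t)
    (h1 : ∀ t ∈ s, u t < 1) : ContinuousOn (fun t => atnh (u t)) s := by
  unfold atnh
  refine ContinuousOn.div_const (ContinuousOn.sub ?_ ?_) 2
  · refine (continuousOn_const.add hu).log (fun t ht => ?_)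
    have := h0 t ht
    have h : 1 + u t ≠ 0 := by linarith
    exact h
  · refine (continuousOn_const.sub hu).log (fun t ht => ?_)
    have := h1 t ht
    have h : 1 - u t ≠ 0 := by linarith
    exact h

lemma ftcl {F f : ℝ → ℝ} {a b : ℝ} (hab : a ≤ b) (hF : ContinuousOn F (Icc a b))
    (hd : ∀ x ∈ Ioo a b, HasDerivAt F (f x) x) (h0 : ∀ x ∈ Ioo a b, 0 ≤ f x) :
    ∫⁻ x in Ioo a b, ENNReal.ofReal (f x) = ENNReal.ofReal (F b - F a) := by
  have hi := intervalIntegral.integrableOn_deriv_of_nonneg hF hd h0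
  have h1 := intervalIntegral.integral_eq_sub_of_hasDerivAt_of_le hab hF hd
    ((intervalIntegrable_iff_integrableOn_Ioc_of_le hab).2 hi)
  rw [← h1, intervalIntegral.integral_of_le hab, integral_Ioc_eq_integral_Ioo,
    ofReal_integral_eq_lintegral_ofReal]
  · exact hi.mono_set Ioo_subset_Ioc_self
  · exact (ae_restrict_iff' measurableSet_Ioo).2 (ae_of_all _ h0)

lemma kerJ1 {x s : ℝ} (hx0 : 0 < x) (hxs : x < s) (hs1 : s < 1) :
    ∫⁻ t in Ioo s 1, ENNReal.ofReal (√(1 - x ^ 2) / ((t ^ 2 - x ^ 2) * √(1 - t ^ 2)))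
      = ENNReal.ofReal (x⁻¹ * atnh (x * √(1 - s ^ 2) / (s * √(1 - x ^ 2)))) := by
  have hxx : 0 < 1 - x ^ 2 := by nlinarith
  have hX : 0 < √(1 - x ^ 2) := Real.sqrt_pos.2 hxx
  have hXX : √(1 - x ^ 2) ^ 2 = 1 - x ^ 2 := Real.sq_sqrt hxx.le
  have hlt : ∀ t, s ≤ t → t ≤ 1 → x * √(1 - t ^ 2) / (t * √(1 - x ^ 2)) < 1 := by
    intro t hst ht
    have ht0 : 0 < t := by linarith
    rw [div_lt_one (by positivity)]
    have : √(1 - t ^ 2) ≤ √(1 - x ^ 2) := Real.sqrt_le_sqrt (by nlinarith)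
    have : x * √(1 - t ^ 2) ≤ x * √(1 - x ^ 2) := by gcongr
    nlinarith
  have := ftcl (F := fun t => - (x⁻¹ * atnh (x * √(1 - t ^ 2) / (t * √(1 - x ^ 2)))))
    (f := fun t => √(1 - x ^ 2) / ((t ^ 2 - x ^ 2) * √(1 - t ^ 2))) (a := s) (b := 1) hs1.le
    ?_ ?_ ?_
  · rw [this]
    simp [atnh_zero]
  · refine (ContinuousOn.mul continuousOn_const (contOn_atnh ?_ ?_ ?_)).neg
    · refine ContinuousOn.div (by fun_prop) (by fun_prop) ?_
      intro t ht
      have : 0 < t := by linarith [ht.1]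
      positivity
    · intro t ht
      have : 0 < t := by linarith [ht.1]
      positivity
    · intro t ht
      exact hlt t ht.1 ht.2
  · intro t ht
    have ht0 : 0 < t := by linarith [ht.1]
    have htt : 0 < 1 - t ^ 2 := by nlinarith [ht.2]
    have hA : 0 < √(1 - t ^ 2) := Real.sqrt_pos.2 htt
    have hAA : √(1 - t ^ 2) ^ 2 = 1 - t ^ 2 := Real.sq_sqrt htt.le
    have hd1 : HasDerivAt (fun t : ℝ => √(1 - t ^ 2)) (-(2 * t) / (2 * √(1 - t ^ 2))) t := by
      have := ((hasDerivAt_pow 2 t).const_sub 1).sqrt htt.ne'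
      simpa using this
    have hd2 := (hd1.const_mul x).div ((hasDerivAt_id t).mul_const (√(1 - x ^ 2)))
      (by simp; exact ⟨ht0.ne', hX.ne'⟩)
    have hd3 := ((hasDerivAt_atnh hd2 (by simp; positivity)
      (by simpa using hlt t ht.1.le ht.2.le)).const_mul x⁻¹).neg
    refine hd3.congr_deriv ?_
    simp only [id, Pi.div_apply]
    have h5 : t ^ 2 - x ^ 2 ≠ 0 := by nlinarith [ht.1]
    have h6 : 1 - (x * √(1 - t ^ 2) / (t * √(1 - x ^ 2))) ^ 2
        = (t ^ 2 - x ^ 2) / (t ^ 2 * (1 - x ^ 2)) := by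
      rw [div_pow, mul_pow, mul_pow, hXX, hAA]
      field_simp
      ring
    rw [h6]
    field_simp
    rw [hAA, hXX]
    ring
  · intro t ht
    have ht0 : 0 < t := by linarith [ht.1]
    have h5 : 0 < t ^ 2 - x ^ 2 := by nlinarith [ht.1]
    positivity

lemma kerJ2 {x s : ℝ} (hs0 : 0 < s) (hxs : s < x) (hx1 : x < 1) :
    ∫⁻ t in Ioo 0 s, ENNReal.ofReal (√(1 - x ^ 2) / ((x ^ 2 - t ^ 2) * √(1 - t ^ 2)))
      = ENNReal.ofReal (x⁻¹ * atnh (s * √(1 - x ^ 2) / (x * √(1 - s ^ 2)))) := by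
  have hx0 : 0 < x := by linarith
  have hxx : 0 < 1 - x ^ 2 := by nlinarith
  have hX : 0 < √(1 - x ^ 2) := Real.sqrt_pos.2 hxx
  have hXX : √(1 - x ^ 2) ^ 2 = 1 - x ^ 2 := Real.sq_sqrt hxx.le
  have hlt : ∀ t, 0 ≤ t → t ≤ s → t * √(1 - x ^ 2) / (x * √(1 - t ^ 2)) < 1 := by
    intro t h0 hts
    have htt : 0 < 1 - t ^ 2 := by nlinarith
    have hA : 0 < √(1 - t ^ 2) := Real.sqrt_pos.2 htt
    rw [div_lt_one (by positivity)]
    have : √(1 - x ^ 2) ≤ √(1 - t ^ 2) := Real.sqrt_le_sqrt (by nlinarith)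
    have : t * √(1 - x ^ 2) ≤ t * √(1 - t ^ 2) := by gcongr
    nlinarith
  have := ftcl (F := fun t => (x⁻¹ * atnh (t * √(1 - x ^ 2) / (x * √(1 - t ^ 2)))))
    (f := fun t => √(1 - x ^ 2) / ((x ^ 2 - t ^ 2) * √(1 - t ^ 2))) (a := 0) (b := s) hs0.le
    ?_ ?_ ?_
  · rw [this]
    simp [atnh_zero]
  · refine (ContinuousOn.mul continuousOn_const (contOn_atnh ?_ ?_ ?_))
    · refine ContinuousOn.div (by fun_prop) (by fun_prop) ?_
      intro t ht
      have htt : 0 < 1 - t ^ 2 := by nlinarith [ht.1, ht.2]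
      have hA : 0 < √(1 - t ^ 2) := Real.sqrt_pos.2 htt
      positivity
    · intro t ht
      have : 0 ≤ t := by linarith [ht.1]
      positivity
    · intro t ht
      exact hlt t ht.1 ht.2
  · intro t ht
    have ht0 : 0 < t := by linarith [ht.1]
    have htt : 0 < 1 - t ^ 2 := by nlinarith [ht.2]
    have hA : 0 < √(1 - t ^ 2) := Real.sqrt_pos.2 htt
    have hAA : √(1 - t ^ 2) ^ 2 = 1 - t ^ 2 := Real.sq_sqrt htt.le
    have hd1 : HasDerivAt (fun t : ℝ => √(1 - t ^ 2)) (-(2 * t) / (2 * √(1 - t ^ 2))) t := by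
      have := ((hasDerivAt_pow 2 t).const_sub 1).sqrt htt.ne'
      simpa using this
    have hd2 := ((hasDerivAt_id t).mul_const (√(1 - x ^ 2))).div (hd1.const_mul x)
      (by positivity)
    have hd3 := ((hasDerivAt_atnh hd2 (by simp; positivity)
      (by simpa using hlt t ht.1.le ht.2.le)).const_mul x⁻¹)
    refine hd3.congr_deriv ?_
    simp only [id, Pi.div_apply]
    have h5 : x ^ 2 - t ^ 2 ≠ 0 := by nlinarith [ht.2]
    have h6 : 1 - (t * √(1 - x ^ 2) / (x * √(1 - t ^ 2))) ^ 2
        = (x ^ 2 - t ^ 2) / (x ^ 2 * (1 - t ^ 2)) := by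
      rw [div_pow, mul_pow, mul_pow, hXX, hAA]
      field_simp
      ring
    rw [h6]
    field_simp
    rw [hAA]
    ring
  · intro t ht
    have ht0 : 0 < t := by linarith [ht.1]
    have h5 : 0 < x ^ 2 - t ^ 2 := by nlinarith [ht.2]
    positivity

/-- for `p < q`: integral over `v ∈ (q,1)`. -/
lemma kerK {p q : ℝ} (hp0 : 0 < p) (hpq : p < q) (hq1 : q < 1) :
    ∫⁻ v in Ioo q 1, ENNReal.ofReal (1 / (v * √(v ^ 2 - p ^ 2) * √(v ^ 2 - q ^ 2)))
      = ENNReal.ofReal ((p * q)⁻¹ * atnh (p * √(1 - q ^ 2) / (q * √(1 - p ^ 2)))) := by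
  have hq0 : 0 < q := by linarith
  have hlt : ∀ t, q ≤ t → p * √(t ^ 2 - q ^ 2) / (q * √(t ^ 2 - p ^ 2)) < 1 := by
    intro t hqt
    have h1 : 0 < t ^ 2 - p ^ 2 := by nlinarith
    have hA : 0 < √(t ^ 2 - p ^ 2) := Real.sqrt_pos.2 h1
    rw [div_lt_one (by positivity)]
    have : √(t ^ 2 - q ^ 2) ≤ √(t ^ 2 - p ^ 2) := Real.sqrt_le_sqrt (by nlinarith)
    have : p * √(t ^ 2 - q ^ 2) ≤ p * √(t ^ 2 - p ^ 2) := by gcongr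
    nlinarith
  have := ftcl (F := fun t => ((p * q)⁻¹ * atnh (p * √(t ^ 2 - q ^ 2) / (q * √(t ^ 2 - p ^ 2)))))
    (f := fun v => 1 / (v * √(v ^ 2 - p ^ 2) * √(v ^ 2 - q ^ 2))) (a := q) (b := 1) hq1.le
    ?_ ?_ ?_
  · rw [this]
    simp [atnh_zero]
  · refine (ContinuousOn.mul continuousOn_const (contOn_atnh ?_ ?_ ?_))
    · refine ContinuousOn.div (by fun_prop) (by fun_prop) ?_
      intro t ht
      have h1 : 0 < t ^ 2 - p ^ 2 := by nlinarith [ht.1]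
      have hA : 0 < √(t ^ 2 - p ^ 2) := Real.sqrt_pos.2 h1
      positivity
    · intro t ht
      positivity
    · intro t ht
      exact hlt t ht.1
  · intro t ht
    have ht0 : 0 < t := by linarith [ht.1]
    have h1 : 0 < t ^ 2 - p ^ 2 := by nlinarith [ht.1]
    have h2 : 0 < t ^ 2 - q ^ 2 := by nlinarith [ht.1]
    have hA : 0 < √(t ^ 2 - p ^ 2) := Real.sqrt_pos.2 h1
    have hB : 0 < √(t ^ 2 - q ^ 2) := Real.sqrt_pos.2 h2
    have hAA : √(t ^ 2 - p ^ 2) ^ 2 = t ^ 2 - p ^ 2 := Real.sq_sqrt h1.le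
    have hBB : √(t ^ 2 - q ^ 2) ^ 2 = t ^ 2 - q ^ 2 := Real.sq_sqrt h2.le
    have hd1 : HasDerivAt (fun t : ℝ => √(t ^ 2 - p ^ 2)) ((2 * t) / (2 * √(t ^ 2 - p ^ 2))) t := by
      have := ((hasDerivAt_pow 2 t).sub_const (p ^ 2)).sqrt h1.ne'
      simpa using this
    have hd1' : HasDerivAt (fun t : ℝ => √(t ^ 2 - q ^ 2)) ((2 * t) / (2 * √(t ^ 2 - q ^ 2))) t := by
      have := ((hasDerivAt_pow 2 t).sub_const (q ^ 2)).sqrt h2.ne'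
      simpa using this
    have hd2 := (hd1'.const_mul p).div (hd1.const_mul q) (by positivity)
    have hd3 := ((hasDerivAt_atnh hd2 (by simp; positivity)
      (by simpa using hlt t ht.1.le)).const_mul (p * q)⁻¹)
    refine hd3.congr_deriv ?_
    simp only [Pi.div_apply]
    have h5 : q ^ 2 - p ^ 2 ≠ 0 := by nlinarith [ht.2]
    have h6 : 1 - (p * √(t ^ 2 - q ^ 2) / (q * √(t ^ 2 - p ^ 2))) ^ 2
        = t ^ 2 * (q ^ 2 - p ^ 2) / (q ^ 2 * (t ^ 2 - p ^ 2)) := by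
      rw [div_pow, mul_pow, mul_pow, hBB, hAA]
      field_simp
      ring
    rw [h6]
    field_simp
    rw [hAA, hBB]
    ring
  · intro t ht
    have ht0 : 0 < t := by linarith [ht.1]
    positivity

lemma omega_int : IntervalIntegrable (fun t : ℝ => 1 / √(1 - t ^ 2)) volume (-1) 1 := by
  rw [intervalIntegrable_iff_integrableOn_Ioc_of_le (by norm_num)]
  refine intervalIntegral.integrableOn_deriv_of_nonneg (g := Real.arcsin)
    Real.continuous_arcsin.continuousOn ?_ ?_
  · intro x hx
    exact Real.hasDerivAt_arcsin hx.1.ne' hx.2.ne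
  · intro x _
    positivity

lemma omega_int01 : IntervalIntegrable (fun t : ℝ => 1 / √(1 - t ^ 2)) volume 0 1 :=
  omega_int.mono_set (by rw [uIcc_of_le (by norm_num), uIcc_of_le (by norm_num)]
                         exact Icc_subset_Icc (by norm_num) le_rfl)

lemma omega_integral : ∫ t in (0:ℝ)..1, 1 / √(1 - t ^ 2) = Real.pi / 2 := by
  rw [intervalIntegral.integral_eq_sub_of_hasDerivAt_of_le zero_le_one
    Real.continuous_arcsin.continuousOn ?_ omega_int01]
  · simp
  · intro x hx
    exact Real.hasDerivAt_arcsin (by linarith [hx.1]) hx.2.ne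

lemma cont_omega_int {f : ℝ → ℝ} (hf : ContinuousOn f (Icc 0 1)) :
    IntervalIntegrable (fun t : ℝ => f t / √(1 - t ^ 2)) volume 0 1 := by
  have := omega_int01.continuousOn_mul (g := f) (by rwa [uIcc_of_le zero_le_one])
  simpa [div_eq_mul_inv] using this

lemma red {a b : ℝ} {f g : ℝ → ℝ≥0∞} (hsub : Ioo a b ⊆ Ioo 0 1)
    (h1 : ∀ s ∈ Ioo a b, f s = g s) (h2 : ∀ s ∈ Ioo (0:ℝ) 1, s ∉ Ioo a b → f s = 0) :
    ∫⁻ s in Ioo (0:ℝ) 1, f s = ∫⁻ s in Ioo a b, g s := by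
  rw [← lintegral_indicator measurableSet_Ioo, ← lintegral_indicator measurableSet_Ioo]
  congr 1
  ext s
  by_cases hs : s ∈ Ioo a b
  · rw [indicator_of_mem (hsub hs), indicator_of_mem hs, h1 s hs]
  · rw [indicator_of_notMem hs]
    by_cases hs1 : s ∈ Ioo (0:ℝ) 1
    · rw [indicator_of_mem hs1, h2 s hs1 hs]
    · rw [indicator_of_notMem hs1]

lemma pow_ftc {α a b : ℝ} (hα : 1 < α) (ha : 0 ≤ a) (hab : a ≤ b) :
    ∫⁻ s in Ioo a b, ENNReal.ofReal (α * s ^ (α - 1)) = ENNReal.ofReal (b ^ α - a ^ α) := by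
  refine ftcl (F := fun s => s ^ α) hab ?_ ?_ ?_
  · exact (Real.continuous_rpow_const (by linarith)).continuousOn
  · intro s hs
    exact Real.hasDerivAt_rpow_const (Or.inr hα.le)
  · intro s hs
    have : 0 < s := lt_of_le_of_lt ha hs.1
    positivity

lemma beta_scale {α v : ℝ} (hα : 1 < α) (hv : 0 < v) :
    ∫⁻ s in Ioo 0 v, ENNReal.ofReal (s ^ α / √(v ^ 2 - s ^ 2))
      = ENNReal.ofReal (v ^ α * ∫ t in (0:ℝ)..1, t ^ α / √(1 - t ^ 2)) := by
  have hg : IntervalIntegrable (fun t : ℝ => t ^ α / √(1 - t ^ 2)) volume 0 1 :=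
    cont_omega_int (Real.continuous_rpow_const (by linarith)).continuousOn
  have h1 := hg.comp_mul_left (c := v⁻¹)
  simp only [zero_div, one_div, inv_inv] at h1
  have h2 := (h1.const_mul (v ^ (α - 1)))
  have h3 := intervalIntegral.integral_comp_mul_left (a := 0) (b := v)
    (fun t : ℝ => t ^ α / √(1 - t ^ 2)) (c := v⁻¹) (by positivity)
  have h4 : ∀ s ∈ Ioo 0 v, s ^ α / √(v ^ 2 - s ^ 2) =
      v ^ (α - 1) * ((v⁻¹ * s) ^ α / √(1 - (v⁻¹ * s) ^ 2)) := by
    intro s hs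
    have e1 : v ^ 2 - s ^ 2 = v ^ 2 * (1 - (v⁻¹ * s) ^ 2) := by
      field_simp
    have e0 : 0 < v ^ 2 - s ^ 2 := by nlinarith [hs.1, hs.2]
    have e2 : 0 < 1 - (v⁻¹ * s) ^ 2 := by
      rw [e1] at e0
      exact (pos_iff_pos_of_mul_pos e0).1 (by positivity)
    rw [e1, Real.sqrt_mul (by positivity), Real.sqrt_sq hv.le,
      Real.mul_rpow (by positivity) hs.1.le, Real.inv_rpow hv.le, Real.rpow_sub hv, Real.rpow_one]
    have : 0 < √(1 - (v⁻¹ * s) ^ 2) := Real.sqrt_pos.2 e2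
    have : 0 < v ^ α := by positivity
    field_simp
  rw [setLIntegral_congr_fun measurableSet_Ioo (fun s hs => by rw [h4 s hs]),
    ← ofReal_integral_eq_lintegral_ofReal, ← integral_Ioc_eq_integral_Ioo,
    ← intervalIntegral.integral_of_le hv.le, intervalIntegral.integral_const_mul, h3]
  · congr 1
    rw [mul_zero, inv_mul_cancel₀ hv.ne', inv_inv, smul_eq_mul, ← mul_assoc]
    congr 1
    rw [Real.rpow_sub hv, Real.rpow_one]
    field_simp
  · exact ((intervalIntegrable_iff_integrableOn_Ioc_of_le hv.le).1 h2).mono_set Ioo_subset_Ioc_self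
  · refine (ae_restrict_iff' measurableSet_Ioo).2 (ae_of_all _ ?_)
    intro s hs
    have := hs.1
    simp only [Pi.zero_apply]
    positivity

lemma lhs_lint {α x : ℝ} (hα : 1 < α) (hx0 : 0 < x) (hx1 : x < 1) :
    ∫⁻ t in Ioo (0:ℝ) 1, ENNReal.ofReal
        (√(1 - x ^ 2) * ((t ^ α - x ^ α) / (t ^ 2 - x ^ 2) / √(1 - t ^ 2)))
    = ∫⁻ t in Ioo (0:ℝ) 1, ∫⁻ s in Ioo (0:ℝ) 1, ENNReal.ofReal (α * s ^ (α - 1)) *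
        (if (x < s ∧ s < t) ∨ (t < s ∧ s < x) then
          ENNReal.ofReal (√(1 - x ^ 2) / (|t ^ 2 - x ^ 2| * √(1 - t ^ 2))) else 0) := by
  refine setLIntegral_congr_fun measurableSet_Ioo (fun t ht => ?_)
  rcases lt_trichotomy t x with h | h | h
  · rw [red (a := t) (b := x)
      (g := fun s => ENNReal.ofReal (α * s ^ (α - 1)) *
          ENNReal.ofReal (√(1 - x ^ 2) / (|t ^ 2 - x ^ 2| * √(1 - t ^ 2))))
      (Ioo_subset_Ioo ht.1.le hx1.le)]
    · rw [lintegral_mul_const _ (by fun_prop), pow_ftc hα ht.1.le h.le, ← ENNReal.ofReal_mul]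
      · congr 1
        rw [abs_of_neg (by nlinarith [ht.1])]
        have : t ^ 2 - x ^ 2 ≠ 0 := by nlinarith [ht.1]
        have : -(t ^ 2 - x ^ 2) ≠ 0 := by nlinarith [ht.1]
        have : √(1 - t ^ 2) ≠ 0 := (Real.sqrt_pos.2 (by nlinarith [ht.1, ht.2])).ne'
        field_simp
        ring
      · have := Real.rpow_le_rpow ht.1.le h.le (by linarith : 0 ≤ α)
        linarith
    · intro s hs
      rw [if_pos (Or.inr ⟨hs.1, hs.2⟩)]
    · intro s hs hs'
      rw [if_neg, mul_zero]
      rintro (h1 | h1)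
      · linarith [h1.1, h1.2]
      · exact hs' h1
  · subst h
    simp
  · rw [red (a := x) (b := t)
      (g := fun s => ENNReal.ofReal (α * s ^ (α - 1)) *
          ENNReal.ofReal (√(1 - x ^ 2) / (|t ^ 2 - x ^ 2| * √(1 - t ^ 2))))
      (Ioo_subset_Ioo hx0.le ht.2.le)]
    · rw [lintegral_mul_const _ (by fun_prop), pow_ftc hα hx0.le h.le, ← ENNReal.ofReal_mul]
      · congr 1
        rw [abs_of_pos (by nlinarith [ht.1])]
        have : t ^ 2 - x ^ 2 ≠ 0 := by nlinarith [ht.1]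
        have : √(1 - t ^ 2) ≠ 0 := (Real.sqrt_pos.2 (by nlinarith [ht.1, ht.2])).ne'
        field_simp
      · have := Real.rpow_le_rpow hx0.le h.le (by linarith : 0 ≤ α)
        linarith
    · intro s hs
      rw [if_pos (Or.inl ⟨hs.1, hs.2⟩)]
    · intro s hs hs'
      rw [if_neg, mul_zero]
      rintro (h1 | h1)
      · exact hs' h1
      · linarith [h1.1, h1.2]

lemma rhs_lint {α x : ℝ} (hα : 1 < α) (hx0 : 0 < x) :
    ∫⁻ v in Ioo x 1, ENNReal.ofReal
        ((∫ t in (0:ℝ)..1, t ^ α / √(1 - t ^ 2)) * (α * (v ^ (α - 1) / √(v ^ 2 - x ^ 2))))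
    = ∫⁻ v in Ioo (0:ℝ) 1, ∫⁻ s in Ioo (0:ℝ) 1, ENNReal.ofReal (α * s ^ (α - 1)) *
        (if x < v ∧ s < v then
          ENNReal.ofReal (s * (1 / (v * √(v ^ 2 - s ^ 2) * √(v ^ 2 - x ^ 2)))) else 0) := by
  symm
  refine red (Ioo_subset_Ioo hx0.le le_rfl) ?_ ?_
  · intro v hv
    have hv0 : 0 < v := hx0.trans hv.1
    have hX : 0 < √(v ^ 2 - x ^ 2) := Real.sqrt_pos.2 (by nlinarith [hv.1])
    have hc : 0 ≤ α / (v * √(v ^ 2 - x ^ 2)) := by positivity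
    rw [red (a := 0) (b := v)
      (g := fun s => ENNReal.ofReal (α / (v * √(v ^ 2 - x ^ 2))) *
          ENNReal.ofReal (s ^ α / √(v ^ 2 - s ^ 2)))
      (Ioo_subset_Ioo le_rfl hv.2.le)]
    · rw [lintegral_const_mul _ (by fun_prop), beta_scale hα hv0, ← ENNReal.ofReal_mul hc]
      congr 1
      rw [Real.rpow_sub hv0, Real.rpow_one]
      field_simp
    · intro s hs
      have hs0 := hs.1
      have : 0 < √(v ^ 2 - s ^ 2) := Real.sqrt_pos.2 (by nlinarith [hs.1, hs.2])
      rw [if_pos ⟨hv.1, hs.2⟩, ← ENNReal.ofReal_mul hc, ← ENNReal.ofReal_mul (by positivity)]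
      congr 1
      rw [Real.rpow_sub hs0, Real.rpow_one]
      field_simp
    · intro s hs hs'
      rw [if_neg, mul_zero]
      rintro ⟨_, h1⟩
      exact hs' ⟨hs.1, h1⟩
  · intro v hv hv'
    rw [lintegral_congr (g := fun _ => 0)]
    · simp
    · intro s
      rw [if_neg, mul_zero]
      rintro ⟨h1, _⟩
      exact hv' ⟨h1, hv.2⟩

lemma lint_identity {α x : ℝ} (hα : 1 < α) (hx0 : 0 < x) (hx1 : x < 1) :
    ∫⁻ t in Ioo (0:ℝ) 1, ENNReal.ofReal
        (√(1 - x ^ 2) * ((t ^ α - x ^ α) / (t ^ 2 - x ^ 2) / √(1 - t ^ 2)))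
    = ∫⁻ v in Ioo x 1, ENNReal.ofReal
        ((∫ t in (0:ℝ)..1, t ^ α / √(1 - t ^ 2)) * (α * (v ^ (α - 1) / √(v ^ 2 - x ^ 2)))) := by
  rw [lhs_lint hα hx0 hx1, rhs_lint hα hx0]
  refine (lintegral_lintegral_swap ?_).trans (Eq.trans ?_ (lintegral_lintegral_swap ?_).symm)
  rotate_left 1
  · refine lintegral_congr_ae ?_
    have hne : ∀ᵐ s : ℝ ∂(volume.restrict (Ioo (0:ℝ) 1)), s ≠ x :=
      ae_restrict_of_ae (by simp [ae_iff])
    filter_upwards [hne, ae_restrict_mem measurableSet_Ioo] with s hsx hs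
    have hs0 := hs.1
    rw [lintegral_const_mul, lintegral_const_mul]
    · congr 1
      rcases lt_or_gt_of_ne hsx with h | h
      · rw [red (a := 0) (b := s) (g := fun t =>
          ENNReal.ofReal (√(1 - x ^ 2) / ((x ^ 2 - t ^ 2) * √(1 - t ^ 2))))
          (Ioo_subset_Ioo le_rfl hs.2.le), kerJ2 hs.1 h hx1,
          red (a := x) (b := 1) (g := fun v => ENNReal.ofReal s *
            ENNReal.ofReal (1 / (v * √(v ^ 2 - s ^ 2) * √(v ^ 2 - x ^ 2))))
          (Ioo_subset_Ioo hx0.le le_rfl), lintegral_const_mul _ (by fun_prop), kerK hs.1 h hx1,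
          ← ENNReal.ofReal_mul hs.1.le]
        · congr 1
          field_simp
        · intro v hv
          rw [if_pos ⟨hv.1, h.trans hv.1⟩, ENNReal.ofReal_mul hs.1.le]
        · intro v hv hv'
          rw [if_neg]
          rintro ⟨h1, _⟩
          exact hv' ⟨h1, hv.2⟩
        · intro t ht
          rw [if_pos (Or.inr ⟨ht.2, h⟩), abs_of_neg (by nlinarith [ht.1, ht.2])]
          simp
        · intro t ht ht'
          rw [if_neg]
          rintro (h1 | h1)
          · linarith [h1.1]
          · exact ht' ⟨ht.1, h1.1⟩
      · rw [red (a := s) (b := 1) (g := fun t =>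
          ENNReal.ofReal (√(1 - x ^ 2) / ((t ^ 2 - x ^ 2) * √(1 - t ^ 2))))
          (Ioo_subset_Ioo hs.1.le le_rfl), kerJ1 hx0 h hs.2,
          red (a := s) (b := 1) (g := fun v => ENNReal.ofReal s *
            ENNReal.ofReal (1 / (v * √(v ^ 2 - x ^ 2) * √(v ^ 2 - s ^ 2))))
          (Ioo_subset_Ioo hs.1.le le_rfl), lintegral_const_mul _ (by fun_prop), kerK hx0 h hs.2,
          ← ENNReal.ofReal_mul hs.1.le]
        · congr 1
          field_simp
        · intro v hv
          rw [if_pos ⟨h.trans hv.1, hv.1⟩, ENNReal.ofReal_mul hs.1.le, mul_right_comm]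
        · intro v hv hv'
          rw [if_neg]
          rintro ⟨_, h1⟩
          exact hv' ⟨h1, hv.2⟩
        · intro t ht
          rw [if_pos (Or.inl ⟨h, ht.1⟩), abs_of_pos (by nlinarith [ht.1, ht.2])]
        · intro t ht ht'
          rw [if_neg]
          rintro (h1 | h1)
          · exact ht' ⟨h1.2, ht.2⟩
          · linarith [h1.2]
    · refine Measurable.ite ?_ (by fun_prop) measurable_const
      exact (measurableSet_lt measurable_const measurable_id).inter
        (measurableSet_lt measurable_const measurable_id)
    · refine Measurable.ite ?_ (by fun_prop) measurable_const
      refine MeasurableSet.union ?_ ?_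
      · exact (MeasurableSet.const _).inter (measurableSet_lt measurable_const measurable_id)
      · exact (measurableSet_lt measurable_id measurable_const).inter (MeasurableSet.const _)
  · refine Measurable.aemeasurable ?_
    refine Measurable.mul (by fun_prop) ?_
    refine Measurable.ite ?_ (by fun_prop) measurable_const
    exact (measurableSet_lt measurable_const measurable_fst).inter
        (measurableSet_lt measurable_snd measurable_fst)
  · refine Measurable.aemeasurable ?_
    refine Measurable.mul (by fun_prop) ?_
    refine Measurable.ite ?_ (by fun_prop) measurable_const
    refine MeasurableSet.union ?_ ?_
    · exact (measurableSet_lt measurable_const measurable_snd).inter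
        (measurableSet_lt measurable_snd measurable_fst)
    · exact (measurableSet_lt measurable_fst measurable_snd).inter
        (measurableSet_lt measurable_snd measurable_const)

lemma pow_identity {α x : ℝ} (hα : 1 < α) (hx0 : 0 < x) (hx1 : x < 1) :
    √(1 - x ^ 2) * ∫ t in (0:ℝ)..1, (t ^ α - x ^ α) / (t ^ 2 - x ^ 2) / √(1 - t ^ 2)
    = (∫ t in (0:ℝ)..1, t ^ α / √(1 - t ^ 2)) *
        (α * ∫ v in x..1, v ^ (α - 1) / √(v ^ 2 - x ^ 2)) := by
  have hb : 0 ≤ ∫ t in (0:ℝ)..1, t ^ α / √(1 - t ^ 2) := by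
    refine intervalIntegral.integral_nonneg zero_le_one (fun t ht => ?_)
    have := ht.1
    positivity
  rw [← intervalIntegral.integral_const_mul, ← intervalIntegral.integral_const_mul,
    ← intervalIntegral.integral_const_mul, intervalIntegral.integral_of_le zero_le_one,
    intervalIntegral.integral_of_le hx1.le, integral_Ioc_eq_integral_Ioo,
    integral_Ioc_eq_integral_Ioo, integral_eq_lintegral_of_nonneg_ae,
    integral_eq_lintegral_of_nonneg_ae, lint_identity hα hx0 hx1]
  · refine (ae_restrict_iff' measurableSet_Ioo).2 (ae_of_all _ ?_)
    intro s hs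
    have := hx0.trans hs.1
    simp only [Pi.zero_apply]
    positivity
  · exact Measurable.aestronglyMeasurable (by fun_prop)
  · refine (ae_restrict_iff' measurableSet_Ioo).2 (ae_of_all _ ?_)
    intro s hs
    have hs0 := hs.1
    simp only [Pi.zero_apply]
    refine mul_nonneg (by positivity) (div_nonneg ?_ (by positivity))
    rcases le_total s x with h | h
    · refine div_nonneg_of_nonpos ?_ (by nlinarith)
      have := Real.rpow_le_rpow hs0.le h (by linarith : 0 ≤ α)
      linarith
    · refine div_nonneg ?_ (by nlinarith)
      have := Real.rpow_le_rpow hx0.le h (by linarith : 0 ≤ α)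
      linarith
  · exact Measurable.aestronglyMeasurable (by fun_prop)

lemma ae_ne (x : ℝ) : ∀ᵐ t : ℝ, t ≠ x := by simp [ae_iff]

lemma quot_int {f : ℝ → ℝ} {x : ℝ} (hx0 : 0 < x) (hx1 : x < 1) (hf : ContinuousOn f (Icc 0 1))
    (hd : DifferentiableAt ℝ f x) :
    IntervalIntegrable (fun t => (f t - f x) / (t ^ 2 - x ^ 2) / √(1 - t ^ 2)) volume 0 1 := by
  have h1 : ContinuousOn (dslope f x) (Icc 0 1) :=
    (continuousOn_dslope (Icc_mem_nhds hx0 hx1)).2 ⟨hf, hd⟩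
  have h2 : ContinuousOn (fun t => dslope f x t / (t + x)) (Icc 0 1) := by
    refine h1.div (by fun_prop) ?_
    intro t ht
    linarith [ht.1]
  refine (cont_omega_int h2).congr_ae ?_
  refine ae_restrict_of_ae ?_
  filter_upwards [ae_ne x] with t ht
  rw [dslope_of_ne f ht, slope_def_field]
  have : t ^ 2 - x ^ 2 = (t - x) * (t + x) := by ring
  rw [this, div_div (f t - f x)]

lemma split_id {b : ℝ → ℝ} {x : ℝ} (hx0 : 0 < x) (hx1 : x < 1) (hb : ContinuousOn b (Icc 0 1))
    (hd : DifferentiableAt ℝ b x) :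
    (1 - x ^ 2) * ∫ t in (0:ℝ)..1, (b t - b x) / (t ^ 2 - x ^ 2) / √(1 - t ^ 2)
    = (∫ t in (0:ℝ)..1, b t / √(1 - t ^ 2)) +
      ∫ t in (0:ℝ)..1, (b t * (1 - t ^ 2) - b x * (1 - x ^ 2)) / (t ^ 2 - x ^ 2) / √(1 - t ^ 2) := by
  have hc := quot_int (f := fun t => b t * (1 - t ^ 2)) hx0 hx1
    (hb.mul (by fun_prop)) (hd.mul (by fun_prop))
  rw [← intervalIntegral.integral_add (cont_omega_int hb) hc,
    ← intervalIntegral.integral_const_mul]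
  refine intervalIntegral.integral_congr_ae ?_
  filter_upwards [ae_ne x, ae_ne 1] with t htx ht1 ht
  rw [uIoc_of_le zero_le_one] at ht
  have h1 : t ^ 2 - x ^ 2 ≠ 0 := by
    have : t ^ 2 - x ^ 2 = (t - x) * (t + x) := by ring
    rw [this]
    exact mul_ne_zero (sub_ne_zero.2 htx) (by linarith [ht.1])
  have h2 : t < 1 := lt_of_le_of_ne ht.2 ht1
  have h3 : √(1 - t ^ 2) ≠ 0 := (Real.sqrt_pos.2 (by nlinarith [ht.1])).ne'
  field_simp
  ring

lemma dct {c : ℕ → ℝ → ℝ} {c0 : ℝ → ℝ} {x δ M L : ℝ} (hx0 : 0 < x) (hx1 : x < 1) (hδ : 0 < δ)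
    (hL0 : 0 ≤ L) (hM0 : 0 ≤ M)
    (hcm : ∀ n, Measurable (c n)) (hM : ∀ n, 1 ≤ n → ∀ t ∈ Icc (0:ℝ) 1, |c n t| ≤ M)
    (hL : ∀ n, 1 ≤ n → ∀ t ∈ Icc (0:ℝ) 1, |t - x| ≤ δ → |c n t - c n x| ≤ L * |t - x|)
    (hlim : ∀ t ∈ Ioo (0:ℝ) 1, Tendsto (fun n => c n t) atTop (𝓝 (c0 t))) :
    Tendsto (fun n => ∫ t in (0:ℝ)..1, (c n t - c n x) / (t ^ 2 - x ^ 2) / √(1 - t ^ 2)) atTop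
      (𝓝 (∫ t in (0:ℝ)..1, (c0 t - c0 x) / (t ^ 2 - x ^ 2) / √(1 - t ^ 2))) := by
  refine intervalIntegral.tendsto_integral_filter_of_dominated_convergence
    (fun t => (L / x + 2 * M / (δ * x)) * (1 / √(1 - t ^ 2))) ?_ ?_ (omega_int01.const_mul _) ?_
  · refine Eventually.of_forall (fun n => Measurable.aestronglyMeasurable ?_)
    have := hcm n
    fun_prop
  · filter_upwards [eventually_ge_atTop 1] with n hn
    filter_upwards [ae_ne x] with t htx ht
    rw [uIoc_of_le zero_le_one] at ht
    have ht' : t ∈ Icc (0:ℝ) 1 := ⟨ht.1.le, ht.2⟩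
    rw [Real.norm_eq_abs, abs_div, abs_of_nonneg (Real.sqrt_nonneg _), div_eq_mul_one_div]
    refine mul_le_mul_of_nonneg_right ?_ (by positivity)
    have e1 : |t ^ 2 - x ^ 2| = |t - x| * (t + x) := by
      have : t ^ 2 - x ^ 2 = (t - x) * (t + x) := by ring
      rw [this, abs_mul, abs_of_pos (by linarith [ht.1] : 0 < t + x)]
    have e2 : 0 < |t - x| := abs_pos.2 (sub_ne_zero.2 htx)
    rw [abs_div, e1]
    have e3 : |t - x| * x ≤ |t - x| * (t + x) := by
      have := ht.1
      gcongr
      linarith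
    have e4 : 0 ≤ L / x := by positivity
    have e5 : 0 ≤ 2 * M / (δ * x) := by positivity
    rcases le_total (|t - x|) δ with h | h
    · have := hL n hn t ht' h
      calc |c n t - c n x| / (|t - x| * (t + x)) ≤ (L * |t - x|) / (|t - x| * x) := by gcongr
        _ = L / x := by field_simp
        _ ≤ _ := by linarith
    · have h1 := hM n hn t ht'
      have h2 := hM n hn x ⟨hx0.le, hx1.le⟩
      have h3 : |c n t - c n x| ≤ 2 * M := by
        have := abs_sub (c n t) (c n x)
        linarith
      calc |c n t - c n x| / (|t - x| * (t + x)) ≤ (2 * M) / (|t - x| * x) := by gcongr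
        _ ≤ 2 * M / (δ * x) := by gcongr
        _ ≤ _ := by linarith
  · filter_upwards [ae_ne 1] with t ht1 ht
    rw [uIoc_of_le zero_le_one] at ht
    exact (((hlim t ⟨ht.1, lt_of_le_of_ne ht.2 ht1⟩).sub (hlim x ⟨hx0, hx1⟩)).div_const _).div_const _

lemma pairing {g : ℝ → ℝ} {x : ℝ} (hx0 : 0 < x) (hx1 : x < 1) (hodd : ∀ t, g (-t) = - g t)
    (hg : Continuous g) (hd : DifferentiableAt ℝ g x) :
    ∫ t in (-1:ℝ)..1, (g t - g x) / (t - x) / √(1 - t ^ 2)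
    = 2 * ∫ t in (0:ℝ)..1, (t * g t - x * g x) / (t ^ 2 - x ^ 2) / √(1 - t ^ 2) := by
  have h1 : ContinuousOn (dslope g x) (Icc (-1) 1) :=
    (continuousOn_dslope (Icc_mem_nhds (by linarith) hx1)).2 ⟨hg.continuousOn, hd⟩
  have hF : IntervalIntegrable (fun t => (g t - g x) / (t - x) / √(1 - t ^ 2)) volume (-1) 1 := by
    have h2 := omega_int.continuousOn_mul (g := dslope g x) (by rwa [uIcc_of_le (by norm_num)])
    refine h2.congr_ae (ae_restrict_of_ae ?_)
    filter_upwards [ae_ne x] with t ht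
    rw [dslope_of_ne g ht, slope_def_field, mul_one_div]
  have hF1 : IntervalIntegrable (fun t => (g t - g x) / (t - x) / √(1 - t ^ 2)) volume (-1) 0 :=
    hF.mono_set (by rw [uIcc_of_le (by norm_num), uIcc_of_le (by norm_num)]
                    exact Icc_subset_Icc le_rfl (by norm_num))
  have hF2 : IntervalIntegrable (fun t => (g t - g x) / (t - x) / √(1 - t ^ 2)) volume 0 1 :=
    hF.mono_set (by rw [uIcc_of_le (by norm_num), uIcc_of_le (by norm_num)]
                    exact Icc_subset_Icc (by norm_num) le_rfl)
  have hF3 : IntervalIntegrable (fun t => (g (-t) - g x) / (-t - x) / √(1 - (-t) ^ 2))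
      volume 0 1 := by
    have := (IntervalIntegrable.iff_comp_neg (f := fun t => (g t - g x) / (t - x) / √(1 - t ^ 2))
      (a := -1) (b := 0)).1 hF1
    simpa using this.symm
  have h3 := intervalIntegral.integral_comp_neg (a := 0) (b := 1)
    (fun t => (g t - g x) / (t - x) / √(1 - t ^ 2))
  rw [neg_zero] at h3
  rw [← intervalIntegral.integral_add_adjacent_intervals hF1 hF2, ← h3,
    ← intervalIntegral.integral_add hF3 hF2, ← intervalIntegral.integral_const_mul]
  refine intervalIntegral.integral_congr_ae ?_
  filter_upwards [ae_ne x] with t htx ht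
  rw [uIoc_of_le zero_le_one] at ht
  rw [hodd, neg_sq]
  have a1 : t - x ≠ 0 := sub_ne_zero.2 htx
  have a2 : t + x ≠ 0 := by linarith [ht.1]
  have a3 : -t - x ≠ 0 := by linarith [ht.1]
  have h1 : t ^ 2 - x ^ 2 ≠ 0 := by
    have : t ^ 2 - x ^ 2 = (t - x) * (t + x) := by ring
    rw [this]
    exact mul_ne_zero a1 a2
  rw [← add_div, ← mul_div_assoc]
  congr 1
  have : t ^ 2 - x ^ 2 = (t - x) * (t + x) := by ring
  rw [this]
  have : -t - x = -(t + x) := by ring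
  rw [this]
  field_simp
  ring

lemma star_scale {Q' : ℝ → ℝ} {a : ℕ → ℝ} {n : ℕ} {x : ℝ} (ha : 0 < a n) :
    eqDensityEvenStar Q' a n x = √(1 - x ^ 2) / Real.pi ^ 2 *
      ∫ t in (-1:ℝ)..1, (a n * Q' (a n * t) / n - a n * Q' (a n * x) / n) / (t - x) / √(1 - t ^ 2) := by
  unfold eqDensityEvenStar eqDensityEven
  have h := intervalIntegral.integral_comp_mul_left (a := -1) (b := 1)
    (fun s => ((Q' s - Q' (a n * x)) / (s - a n * x)) / √((a n) ^ 2 - s ^ 2)) ha.ne'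
  rw [mul_neg, mul_one, smul_eq_mul, eq_inv_mul_iff_mul_eq₀ ha.ne'] at h
  rw [← h]
  have e : ∀ t : ℝ, √((a n) ^ 2 - (a n * t) ^ 2) = a n * √(1 - t ^ 2) := by
    intro t
    have : (a n) ^ 2 - (a n * t) ^ 2 = (a n) ^ 2 * (1 - t ^ 2) := by ring
    rw [this, Real.sqrt_mul (by positivity), Real.sqrt_sq ha.le]
  simp_rw [e]
  have : ∀ t : ℝ, (a n * Q' (a n * t) / n - a n * Q' (a n * x) / n) / (t - x) / √(1 - t ^ 2)
      = (a n) ^ 3 / n * ((Q' (a n * t) - Q' (a n * x)) / (a n * t - a n * x) / (a n * √(1 - t ^ 2))) := by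
    intro t
    rw [← mul_sub (a n) t x]
    by_cases h1 : t - x = 0
    · simp [h1]
    by_cases h2 : √(1 - t ^ 2) = 0
    · simp [h2]
    by_cases h3 : (n : ℝ) = 0
    · simp [h3]
    field_simp
  simp_rw [this]
  rw [intervalIntegral.integral_const_mul]
  ring

lemma eqStar_neg {Q' : ℝ → ℝ} {a : ℕ → ℝ} {n : ℕ} {x : ℝ} (hodd : ∀ t, Q' (-t) = - Q' t) :
    eqDensityEvenStar Q' a n (-x) = eqDensityEvenStar Q' a n x := by
  unfold eqDensityEvenStar eqDensityEven
  have h := intervalIntegral.integral_comp_neg (a := -(a n)) (b := a n)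
    (fun s => ((Q' s - Q' (a n * -x)) / (s - a n * -x)) / √((a n) ^ 2 - s ^ 2))
  rw [neg_neg] at h
  rw [← h]
  have e : a n * -x = -(a n * x) := by ring
  simp only [e, hodd, neg_sq]
  congr 2
  refine intervalIntegral.integral_congr (fun s _ => ?_)
  congr 1
  have : -s - -(a n * x) = -(s - a n * x) := by ring
  rw [this, ← neg_div_neg_eq]
  congr 1 <;> ring

lemma ullman_neg {α : ℝ≥0∞} {x : ℝ} : ullmanDensity α (-x) = ullmanDensity α x := by
  unfold ullmanDensity
  simp

section facts

variable {Q Q' Q'' : ℝ → ℝ}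

lemma IsFC2.odd (h : IsFC2 Q Q' Q'') (he : ∀ x, Q (-x) = Q x) (t : ℝ) : Q' (-t) = - Q' t := by
  have h1 := (h.hasDeriv (-t)).scomp t (hasDerivAt_neg t)
  have h2 : Q ∘ Neg.neg = Q := by
    ext s
    exact he s
  have h3 : HasDerivAt Q ((-1 : ℝ) • Q' (-t)) t := by
    rw [← h2]
    exact h1
  have := h3.unique (h.hasDeriv t)
  simp at this
  linarith

lemma IsFC2.Qpos (h : IsFC2 Q Q' Q'') {t : ℝ} (ht : t ≠ 0) : 0 < Q t := by
  refine lt_of_le_of_ne (h.nonneg t) (fun h0 => ?_)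
  obtain ⟨Λ, hΛ, h1⟩ := h.lambdaBound
  have := h1 t ht
  rw [← h0, div_zero] at this
  linarith

lemma IsFC2.Tpos (h : IsFC2 Q Q' Q'') {t : ℝ} (ht : t ≠ 0) : 0 < t * Q' t / Q t := by
  obtain ⟨Λ, hΛ, h1⟩ := h.lambdaBound
  have := h1 t ht
  linarith

lemma IsFC2.Q'pos (h : IsFC2 Q Q' Q'') {t : ℝ} (ht : 0 < t) : 0 < Q' t := by
  have h1 := h.Tpos ht.ne'
  have h2 := h.Qpos ht.ne'
  rw [div_pos_iff_of_pos_right h2] at h1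
  exact (pos_iff_pos_of_mul_pos h1).1 ht

lemma IsFC2.Q'nonneg (h : IsFC2 Q Q' Q'') {t : ℝ} (ht : 0 ≤ t) : 0 ≤ Q' t := by
  rcases ht.eq_or_lt with rfl | ht
  · have h1 : Tendsto Q' (𝓝[>] 0) (𝓝 (Q' 0)) := h.contDeriv.continuousAt.mono_left nhdsWithin_le_nhds
    refine ge_of_tendsto h1 ?_
    filter_upwards [self_mem_nhdsWithin] with t ht
    exact (h.Q'pos ht).le
  · exact (h.Q'pos ht).le

lemma IsFC2.conv (h : IsFC2 Q Q' Q'') {u w : ℝ} (huw : u < w) :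
    (w - u) * Q' u ≤ Q w - Q u := by
  obtain ⟨c, hc, he⟩ := exists_hasDerivAt_eq_slope Q Q' huw
    (fun x _ => (h.hasDeriv x).continuousAt.continuousWithinAt) (fun x _ => h.hasDeriv x)
  have h1 := h.monoDeriv hc.1.le
  have h2 : 0 < w - u := by linarith
  rw [he, le_div_iff₀ h2] at h1
  linarith

lemma IsFC2.tq (h : IsFC2 Q Q' Q'') : ∃ C > 0, ∀ u w : ℝ, 0 < u → u < w →
    u * Q' u / Q u * (u * Q' u) ≤ C * (w * Q' w) * (u / (w - u)) := by
  obtain ⟨C, hC, h1⟩ := h.quasiIncr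
  refine ⟨C, hC, fun u w hu huw => ?_⟩
  have hw : 0 < w := hu.trans huw
  have h2 := h1 u w hu huw
  have h3 := h.conv huw
  have h4 := h.Qpos hu.ne'
  have h5 := h.Qpos hw.ne'
  have h6 := h.Q'pos hu
  have h7 := h.Q'pos hw
  have h8 : 0 < w - u := by linarith
  have h9 : u * Q' u ≤ u / (w - u) * Q w := by
    rw [div_mul_eq_mul_div, le_div_iff₀ h8]
    nlinarith
  calc u * Q' u / Q u * (u * Q' u) ≤ (C * (w * Q' w / Q w)) * (u / (w - u) * Q w) := by gcongr
    _ = _ := by field_simp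

lemma IsFC2.Q''nonneg (h : IsFC2 Q Q' Q'') {t : ℝ} (ht : 0 < t) : 0 ≤ Q'' t := by
  rw [← (h.hasDeriv2 t ht.ne').deriv]
  exact h.monoDeriv.deriv_nonneg

lemma IsFC2.Q''le (h : IsFC2 Q Q' Q'') : ∃ C > 0, ∀ u : ℝ, 0 < u →
    u * Q'' u ≤ C * (u * Q' u / Q u * Q' u) := by
  obtain ⟨C, hC, h1⟩ := h.derivRatio
  refine ⟨C, hC, fun u hu => ?_⟩
  have h2 := h1 u hu.ne'
  have h6 := h.Q'pos hu
  rw [abs_of_pos h6, div_le_iff₀ h6] at h2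
  calc u * Q'' u ≤ u * (C * (Q' u / Q u) * Q' u) := by gcongr
    _ = _ := by ring

lemma reg_var (h : IsFC2 Q Q' Q'') {α t : ℝ} (hα : 0 < α)
    (hT : Tendsto (fun x : ℝ => x * Q' x / Q x) atTop (𝓝 α)) (ht0 : 0 < t) (ht1 : t < 1) :
    Tendsto (fun u : ℝ => (u * t * Q' (u * t)) / (u * Q' u)) atTop (𝓝 (t ^ α)) := by
  have hut : Tendsto (fun u : ℝ => u * t) atTop atTop := tendsto_id.atTop_mul_const ht0
  set f : ℝ → ℝ := fun u => Real.log (Q u) - α * Real.log u with hf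
  have hfd : ∀ u, 0 < u → HasDerivAt f ((u * Q' u / Q u - α) / u) u := by
    intro u hu
    have hQ := h.Qpos hu.ne'
    refine (((h.hasDeriv u).log hQ.ne').sub ((Real.hasDerivAt_log hu.ne').const_mul α)).congr_deriv ?_
    field_simp
  have h1 : Tendsto (fun u => f (u * t) - f u) atTop (𝓝 0) := by
    rw [Metric.tendsto_atTop]
    intro ε hε
    have hε' : 0 < ε * t := by positivity
    obtain ⟨N, hN⟩ := (Metric.tendsto_atTop.1 hT) (ε * t) hε'
    refine ⟨max N 1 / t, fun u hu => ?_⟩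
    have hu1 : max N 1 ≤ u * t := by rwa [ge_iff_le, div_le_iff₀ ht0] at hu
    have hutpos : 0 < u * t := lt_of_lt_of_le (by positivity) hu1
    have hu0 : 0 < u := (pos_iff_pos_of_mul_pos hutpos).2 ht0
    have hlt : u * t < u := by nlinarith
    obtain ⟨c, hc, he⟩ := exists_hasDerivAt_eq_slope f (fun u => (u * Q' u / Q u - α) / u) hlt
      (fun y hy => (hfd y (lt_of_lt_of_le hutpos hy.1)).continuousAt.continuousWithinAt)
      (fun y hy => hfd y (hutpos.trans hy.1))
    have hc0 : 0 < c := hutpos.trans hc.1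
    have h2 := hN c ((le_max_left _ _).trans (hu1.trans hc.1.le))
    rw [Real.dist_eq] at h2
    have h3 : 0 < u - u * t := by linarith
    rw [eq_div_iff h3.ne'] at he
    rw [Real.dist_eq, sub_zero, abs_sub_comm, ← he, abs_mul, abs_div, abs_of_pos hc0, abs_of_pos h3]
    rw [div_mul_eq_mul_div, div_lt_iff₀ hc0]
    calc |c * Q' c / Q c - α| * (u - u * t) < ε * t * (u - u * t) := by gcongr
      _ ≤ ε * t * u := by gcongr; linarith
      _ = ε * (u * t) := by ring
      _ ≤ ε * c := by gcongr; exact hc.1.le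
  have h2 := (Real.continuous_exp.tendsto 0).comp h1
  have h3 := ((hT.comp hut).div hT hα.ne').mul (h2.mul_const (t ^ α))
  rw [div_self hα.ne', Real.exp_zero, one_mul, one_mul] at h3
  refine h3.congr' ?_
  filter_upwards [eventually_gt_atTop 0] with u hu
  have hut0 : 0 < u * t := by positivity
  have q1 := h.Qpos hu.ne'
  have q2 := h.Qpos hut0.ne'
  have q3 := h.Q'pos hu
  have e : Real.exp (f (u * t) - f u) * t ^ α = Q (u * t) / Q u := by
    rw [Real.rpow_def_of_pos ht0, ← Real.exp_add, hf]
    dsimp only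
    rw [Real.log_mul hu.ne' ht0.ne']
    have : Real.log (Q (u * t)) - α * (Real.log u + Real.log t) -
      (Real.log (Q u) - α * Real.log u) + Real.log t * α
      = Real.log (Q (u * t)) - Real.log (Q u) := by ring
    rw [this, Real.exp_sub, Real.exp_log q1, Real.exp_log q2]
  simp only [Function.comp_apply, Pi.div_apply]
  rw [e]
  field_simp

/-- The normalized function `b_n`. -/
def bfun (Q' : ℝ → ℝ) (a : ℕ → ℝ) (n : ℕ) (t : ℝ) : ℝ := a n * t * Q' (a n * t) / n

variable {a : ℕ → ℝ}

lemma b_cont (h : IsFC2 Q Q' Q'') (n : ℕ) : Continuous (bfun Q' a n) := by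
  have := h.contDeriv
  unfold bfun
  fun_prop

lemma b_mono (h : IsFC2 Q Q' Q'') {n : ℕ} (ha : 0 < a n) {s t : ℝ} (hs : 0 ≤ s) (hst : s ≤ t) :
    bfun Q' a n s ≤ bfun Q' a n t := by
  unfold bfun
  have h1 : a n * s ≤ a n * t := by gcongr
  have h2 := h.monoDeriv h1
  have h3 := h.Q'nonneg (t := a n * s) (by positivity)
  have : 0 ≤ t := hs.trans hst
  gcongr

lemma b_nonneg (h : IsFC2 Q Q' Q'') {n : ℕ} (ha : 0 < a n) {t : ℝ} (ht : 0 ≤ t) :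
    0 ≤ bfun Q' a n t := by
  have := h.Q'nonneg (t := a n * t) (by positivity)
  unfold bfun
  positivity

lemma b_int (hm : IsMRSeven Q' a) {n : ℕ} (hn : 1 ≤ n) :
    ∫ t in (0:ℝ)..1, bfun Q' a n t / √(1 - t ^ 2) = Real.pi / 2 := by
  have h1 := (hm n hn).2
  have hn0 : (n : ℝ) ≠ 0 := by positivity
  unfold bfun
  have : ∀ t : ℝ, a n * t * Q' (a n * t) / n / √(1 - t ^ 2)
      = (n : ℝ)⁻¹ * (a n * t * Q' (a n * t) / √(1 - t ^ 2)) := by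
    intro t
    ring
  simp_rw [this]
  rw [intervalIntegral.integral_const_mul]
  have hpi := Real.pi_ne_zero
  rw [div_mul_eq_mul_div, div_eq_iff hpi] at h1
  field_simp
  linarith

lemma b_bd (h : IsFC2 Q Q' Q'') (hm : IsMRSeven Q' a) {n : ℕ} (hn : 1 ≤ n) {t : ℝ}
    (ht : t ∈ Icc (0:ℝ) 1) : bfun Q' a n t * (1 - t) ≤ Real.pi / 2 := by
  have ha := (hm n hn).1
  have hi := cont_omega_int (b_cont (a := a) h n).continuousOn
  have hi2 : IntervalIntegrable (fun s => bfun Q' a n s / √(1 - s ^ 2)) volume t 1 :=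
    hi.mono_set (by rw [uIcc_of_le ht.2, uIcc_of_le zero_le_one]
                    exact Icc_subset_Icc ht.1 le_rfl)
  have h1 : ∫ s in t..1, bfun Q' a n t ≤ ∫ s in t..1, bfun Q' a n s / √(1 - s ^ 2) := by
    refine intervalIntegral.integral_mono_on_of_le_Ioo ht.2 (by simp) hi2 ?_
    intro s hs
    have hs0 : 0 < s := lt_of_le_of_lt ht.1 hs.1
    have e1 : 0 < √(1 - s ^ 2) := Real.sqrt_pos.2 (by nlinarith [hs.2])
    have e2 : √(1 - s ^ 2) ≤ 1 := Real.sqrt_le_one.2 (by nlinarith)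
    rw [le_div_iff₀ e1]
    have e3 := b_mono h ha ht.1 hs.1.le
    have e4 := b_nonneg h ha ht.1
    nlinarith
  have h2 : ∫ s in t..1, bfun Q' a n s / √(1 - s ^ 2) ≤ ∫ s in (0:ℝ)..1, bfun Q' a n s / √(1 - s ^ 2) := by
    refine intervalIntegral.integral_mono_interval ht.1 ht.2 le_rfl ?_ hi
    refine (ae_restrict_iff' measurableSet_Ioc).2 (ae_of_all _ ?_)
    intro s hs
    have := b_nonneg h ha hs.1.le
    simp only [Pi.zero_apply]
    positivity
  rw [b_int hm hn] at h2
  rw [intervalIntegral.integral_const, smul_eq_mul] at h1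
  linarith

lemma b_one (h : IsFC2 Q Q' Q'') (hm : IsMRSeven Q' a) {n : ℕ} (hn : 1 ≤ n) :
    1 ≤ bfun Q' a n 1 := by
  have ha := (hm n hn).1
  have hi := cont_omega_int (b_cont (a := a) h n).continuousOn
  have h1 : ∫ s in (0:ℝ)..1, bfun Q' a n s / √(1 - s ^ 2) ≤
      ∫ s in (0:ℝ)..1, bfun Q' a n 1 * (1 / √(1 - s ^ 2)) := by
    refine intervalIntegral.integral_mono_on zero_le_one hi (omega_int01.const_mul _) ?_
    intro s hs
    rw [mul_one_div]
    have := b_mono h ha hs.1 hs.2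
    gcongr
  rw [b_int hm hn, intervalIntegral.integral_const_mul, omega_integral] at h1
  have := Real.pi_pos
  nlinarith

lemma a_top (h : IsFC2 Q Q' Q'') (hm : IsMRSeven Q' a) : Tendsto a atTop atTop := by
  rw [tendsto_atTop]
  intro M
  obtain ⟨N, hN⟩ := exists_nat_gt (M * Q' M)
  filter_upwards [eventually_ge_atTop (max N 1)] with n hn
  have hn1 : 1 ≤ n := (le_max_right _ _).trans hn
  have hnN : N ≤ n := (le_max_left _ _).trans hn
  by_contra! hlt
  have ha := (hm n hn1).1
  have h1 := b_one h hm hn1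
  unfold bfun at h1
  rw [mul_one, le_div_iff₀ (by positivity), one_mul] at h1
  have h2 := h.monoDeriv hlt.le
  have h3 := h.Q'pos ha
  have h4 : a n * Q' (a n) ≤ M * Q' M := by
    have : 0 ≤ M := ha.le.trans hlt.le
    gcongr
  have h5 : (N : ℝ) ≤ n := by exact_mod_cast hnN
  linarith

lemma b_T (h : IsFC2 Q Q' Q'') (hm : IsMRSeven Q' a) : ∃ C > 0, ∀ n, 1 ≤ n → ∀ t y : ℝ, 0 < t →
    t < y → y < 1 → a n * t * Q' (a n * t) / Q (a n * t) * bfun Q' a n t ≤ C / ((y - t) * (1 - y)) := by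
  obtain ⟨C, hC, h1⟩ := h.tq
  refine ⟨C * Real.pi, mul_pos hC Real.pi_pos, fun n hn t y ht hty hy => ?_⟩
  have ha := (hm n hn).1
  have h2 := h1 (a n * t) (a n * y) (by positivity) (by gcongr)
  have h3 := b_bd h hm hn (t := y) ⟨by linarith, hy.le⟩
  have h4 : 0 < y - t := by linarith
  have h5 : 0 < 1 - y := by linarith
  have hn0 : (0:ℝ) < n := by positivity
  have e1 : a n * t / (a n * y - a n * t) = t / (y - t) := by
    rw [← mul_sub]
    field_simp
  rw [e1] at h2
  have hb0 := b_nonneg h ha (t := y) (by linarith)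
  rw [← le_div_iff₀ h5] at h3
  have h6 : t / (y - t) ≤ 1 / (y - t) := by
    gcongr
    linarith
  calc a n * t * Q' (a n * t) / Q (a n * t) * bfun Q' a n t
      = (a n * t * Q' (a n * t) / Q (a n * t) * (a n * t * Q' (a n * t))) / n := by
        unfold bfun; ring
    _ ≤ (C * (a n * y * Q' (a n * y)) * (t / (y - t))) / n := by gcongr
    _ = C * bfun Q' a n y * (t / (y - t)) := by unfold bfun; ring
    _ ≤ C * (Real.pi / 2 / (1 - y)) * (1 / (y - t)) := by gcongr
    _ = C * Real.pi / ((y - t) * (1 - y)) / 2 := by field_simp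
    _ ≤ C * Real.pi / ((y - t) * (1 - y)) := by
      have := Real.pi_pos
      exact half_le_self (by positivity)

lemma b_hasDeriv (h : IsFC2 Q Q' Q'') {n : ℕ} {t : ℝ} (ha : 0 < a n) (ht : 0 < t) :
    HasDerivAt (bfun Q' a n) ((a n * Q' (a n * t) + a n * t * (Q'' (a n * t) * a n)) / n) t := by
  have h1 : HasDerivAt (fun t => a n * t) (a n) t := by
    simpa using (hasDerivAt_id t).const_mul (a n)
  have h2 : HasDerivAt (fun t => Q' (a n * t)) (Q'' (a n * t) * a n) t :=
    (h.hasDeriv2 (a n * t) (by positivity)).comp t h1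
  exact (h1.mul h2).div_const _

lemma b_lip (h : IsFC2 Q Q' Q'') (hm : IsMRSeven Q' a) {x : ℝ} (hx0 : 0 < x) (hx1 : x < 1) :
    ∃ δ > 0, ∃ L ≥ 0, ∀ n, 1 ≤ n → ∀ t, |t - x| ≤ δ →
      |bfun Q' a n t - bfun Q' a n x| ≤ L * |t - x| := by
  obtain ⟨C, hC, hbT⟩ := b_T h hm
  obtain ⟨D, hD, hQ''⟩ := h.Q''le
  set δ := min x (1 - x) / 3 with hδ
  have hδ0 : 0 < δ := by
    have : 0 < min x (1 - x) := lt_min hx0 (by linarith)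
    positivity
  have hδ1 : 3 * δ ≤ x := by
    have := min_le_left x (1 - x)
    rw [hδ]; linarith
  have hδ2 : 3 * δ ≤ 1 - x := by
    have := min_le_right x (1 - x)
    rw [hδ]; linarith
  have hpi := Real.pi_pos
  refine ⟨δ, hδ0, (Real.pi / 2 / δ + D * (C / (δ * δ))) / δ, by positivity, fun n hn t ht => ?_⟩
  have ha := (hm n hn).1
  have hn0 : (0:ℝ) < n := by positivity
  have hpos : ∀ s ∈ Icc (x - δ) (x + δ), 0 < s := fun s hs => by linarith [hs.1]
  have hxm : x ∈ Icc (x - δ) (x + δ) := ⟨by linarith, by linarith⟩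
  have htm : t ∈ Icc (x - δ) (x + δ) := by
    have := abs_le.1 ht
    exact ⟨by linarith, by linarith⟩
  refine Convex.norm_image_sub_le_of_norm_hasDerivWithin_le
    (fun s hs => (b_hasDeriv h ha (hpos s hs)).hasDerivWithinAt) ?_ (convex_Icc _ _) hxm htm
  intro s hs
  have hs0 := hpos s hs
  have hu : 0 < a n * s := by positivity
  have q1 := h.Q''nonneg hu
  have q2 := h.Q'pos hu
  rw [Real.norm_eq_abs, abs_of_nonneg (by positivity), le_div_iff₀ hδ0]
  have q3 := hQ'' (a n * s) hu
  have q4 := hbT n hn s (x + 2 * δ) hs0 (by linarith [hs.2]) (by linarith)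
  have q5 := b_bd h hm hn (t := s) ⟨hs0.le, by linarith [hs.2]⟩
  have q6 : bfun Q' a n s ≤ Real.pi / 2 / δ := by
    rw [le_div_iff₀ hδ0]
    have := b_nonneg h ha hs0.le
    have : δ ≤ 1 - s := by linarith [hs.2]
    nlinarith
  have q7 : C / ((x + 2 * δ - s) * (1 - (x + 2 * δ))) ≤ C / (δ * δ) := by
    have r1 : δ ≤ x + 2 * δ - s := by linarith [hs.2]
    have r2 : δ ≤ 1 - (x + 2 * δ) := by linarith
    have r3 : 0 ≤ x + 2 * δ - s := by linarith
    gcongr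
  have q8 := q4.trans q7
  have hsδ : δ ≤ s := by linarith [hs.1]
  have hd0 : 0 ≤ (a n * Q' (a n * s) + a n * s * (Q'' (a n * s) * a n)) / n := by positivity
  calc (a n * Q' (a n * s) + a n * s * (Q'' (a n * s) * a n)) / n * δ
      ≤ (a n * Q' (a n * s) + a n * s * (Q'' (a n * s) * a n)) / n * s := by gcongr
    _ = bfun Q' a n s + (a n * s) * (a n * s * Q'' (a n * s)) / n := by unfold bfun; ring
    _ ≤ bfun Q' a n s + (a n * s) * (D * (a n * s * Q' (a n * s) / Q (a n * s) * Q' (a n * s))) / n := by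
        gcongr
    _ = bfun Q' a n s + D * (a n * s * Q' (a n * s) / Q (a n * s) * bfun Q' a n s) := by
        unfold bfun; ring
    _ ≤ _ := by gcongr

/-- Reduction of the convergence of the densities to the pointwise convergence of `b_n`. -/
lemma star_tendsto (h : IsFC2 Q Q' Q'') (he : ∀ x, Q (-x) = Q x) (hm : IsMRSeven Q' a) {x : ℝ}
    (hx0 : 0 < x) (hx1 : x < 1) {b0 : ℝ → ℝ}
    (hb0 : ∀ t ∈ Ioo (0:ℝ) 1, Tendsto (fun n => bfun Q' a n t) atTop (𝓝 (b0 t))) :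
    Tendsto (fun n => eqDensityEvenStar Q' a n x) atTop
      (𝓝 (√(1 - x ^ 2) / Real.pi ^ 2 * (2 * ((Real.pi / 2 + ∫ t in (0:ℝ)..1,
        (b0 t * (1 - t ^ 2) - b0 x * (1 - x ^ 2)) / (t ^ 2 - x ^ 2) / √(1 - t ^ 2)) /
          (1 - x ^ 2))))) := by
  obtain ⟨δ, hδ, L, hL, hlip⟩ := b_lip h hm hx0 hx1
  have hxx : 0 < 1 - x ^ 2 := by nlinarith
  have hpi := Real.pi_pos
  have hbb : ∀ n, 1 ≤ n → ∀ t ∈ Icc (0:ℝ) 1, bfun Q' a n t * (1 - t ^ 2) ≤ Real.pi := by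
    intro n hn t ht
    have h1 := b_bd h hm hn ht
    have h2 := b_nonneg h (hm n hn).1 ht.1
    have h3 : 0 ≤ bfun Q' a n t * (1 - t) := mul_nonneg h2 (by linarith [ht.2])
    have : bfun Q' a n t * (1 - t ^ 2) = (bfun Q' a n t * (1 - t)) * (1 + t) := by ring
    rw [this]
    nlinarith [ht.1, ht.2]
  have key := dct (c := fun n t => bfun Q' a n t * (1 - t ^ 2)) (c0 := fun t => b0 t * (1 - t ^ 2))
    (x := x) (δ := δ) (M := Real.pi) (L := L + 2 * (Real.pi / (1 - x ^ 2))) hx0 hx1 hδ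
    (by positivity) hpi.le ?_ ?_ ?_ ?_
  · have := (((key.const_add (Real.pi / 2)).div_const (1 - x ^ 2)).const_mul 2).const_mul
      (√(1 - x ^ 2) / Real.pi ^ 2)
    refine this.congr' ?_
    filter_upwards [eventually_ge_atTop 1] with n hn
    have ha := (hm n hn).1
    have hdx : DifferentiableAt ℝ (fun t => a n * Q' (a n * t) / n) x := by
      have h1 : HasDerivAt (fun t => a n * t) (a n) x := by
        simpa using (hasDerivAt_id x).const_mul (a n)
      have h2 : HasDerivAt (fun t => Q' (a n * t)) (Q'' (a n * x) * a n) x :=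
        (h.hasDeriv2 (a n * x) (by positivity)).comp x h1
      exact ((h2.const_mul (a n)).div_const n).differentiableAt
    have hcont : Continuous (fun t => a n * Q' (a n * t) / n) := by
      have := h.contDeriv
      fun_prop
    have e1 := pairing (g := fun t => a n * Q' (a n * t) / n) hx0 hx1 (by
      intro t
      rw [mul_neg, h.odd he]
      ring) hcont hdx
    have e2 := split_id (b := bfun Q' a n) hx0 hx1 (b_cont h n).continuousOn
      (b_hasDeriv h ha hx0).differentiableAt
    rw [b_int hm hn] at e2
    rw [star_scale ha, e1, ← e2, mul_div_cancel_left₀ _ hxx.ne']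
    congr 2
    refine intervalIntegral.integral_congr (fun t _ => ?_)
    dsimp only [bfun]
    ring
  · intro n
    have := (b_cont (a := a) h n).measurable
    fun_prop
  · intro n hn t ht
    rw [abs_of_nonneg (mul_nonneg (b_nonneg h (hm n hn).1 ht.1) (by nlinarith [ht.1, ht.2]))]
    exact hbb n hn t ht
  · intro n hn t ht htx
    have e : bfun Q' a n t * (1 - t ^ 2) - bfun Q' a n x * (1 - x ^ 2)
      = (bfun Q' a n t - bfun Q' a n x) * (1 - t ^ 2) + bfun Q' a n x * (-(t - x) * (t + x)) := by
      ring
    have h1 := hlip n hn t htx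
    have h2 := hbb n hn x ⟨hx0.le, hx1.le⟩
    have h3 := b_nonneg h (hm n hn).1 hx0.le
    rw [← le_div_iff₀ hxx] at h2
    have ht0 := ht.1
    have ht1 := ht.2
    rw [e]
    refine (abs_add_le _ _).trans ?_
    rw [abs_mul, abs_mul, abs_mul, abs_neg, abs_of_nonneg (by nlinarith : 0 ≤ 1 - t ^ 2),
      abs_of_nonneg h3, abs_of_nonneg (by linarith : 0 ≤ t + x), add_mul]
    refine add_le_add ?_ ?_
    · refine le_trans ?_ h1
      exact mul_le_of_le_one_right (abs_nonneg _) (by nlinarith)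
    · have : bfun Q' a n x * (t + x) ≤ 2 * (Real.pi / (1 - x ^ 2)) := by nlinarith
      have h4 := abs_nonneg (t - x)
      nlinarith
  · intro t ht
    exact (hb0 t ht).mul_const _

lemma b_lim_top (h : IsFC2 Q Q' Q'') (hm : IsMRSeven Q' a)
    (hT : Tendsto (fun x : ℝ => x * Q' x / Q x) atTop atTop) :
    ∀ t ∈ Ioo (0:ℝ) 1, Tendsto (fun n => bfun Q' a n t) atTop (𝓝 0) := by
  intro t ht
  obtain ⟨C, hC, hbT⟩ := b_T h hm
  have ht0 := ht.1
  have h1 : Tendsto (fun n => a n * t) atTop atTop := (a_top h hm).atTop_mul_const ht.1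
  have h2 := hT.comp h1
  set y := (t + 1) / 2 with hy
  have h3 : Tendsto (fun n => C / ((y - t) * (1 - y)) /
      (a n * t * Q' (a n * t) / Q (a n * t))) atTop (𝓝 0) := tendsto_const_nhds.div_atTop h2
  refine squeeze_zero' ?_ ?_ h3
  · filter_upwards [eventually_ge_atTop 1] with n hn
    exact b_nonneg h (hm n hn).1 ht.1.le
  · filter_upwards [eventually_ge_atTop 1] with n hn
    have ha := (hm n hn).1
    have := h.Tpos (t := a n * t) (by positivity)
    rw [le_div_iff₀ this, mul_comm]
    exact hbT n hn t y ht.1 (by rw [hy]; linarith [ht.2]) (by rw [hy]; linarith [ht.2])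

lemma beta_pos {α : ℝ} (hα : 1 < α) : 0 < ∫ t in (0:ℝ)..1, t ^ α / √(1 - t ^ 2) := by
  refine intervalIntegral.intervalIntegral_pos_of_pos_on
    (cont_omega_int (Real.continuous_rpow_const (by linarith)).continuousOn) ?_ zero_lt_one
  intro t ht
  have := ht.1
  have : 0 < √(1 - t ^ 2) := Real.sqrt_pos.2 (by nlinarith [ht.1, ht.2])
  positivity

lemma b_lim_fin (h : IsFC2 Q Q' Q'') (hm : IsMRSeven Q' a) {α : ℝ} (hα : 1 < α)
    (hT : Tendsto (fun x : ℝ => x * Q' x / Q x) atTop (𝓝 α)) :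
    ∀ t ∈ Ioo (0:ℝ) 1, Tendsto (fun n => bfun Q' a n t) atTop
      (𝓝 (Real.pi / 2 / (∫ t in (0:ℝ)..1, t ^ α / √(1 - t ^ 2)) * t ^ α)) := by
  have hr : ∀ t ∈ Ioo (0:ℝ) 1, Tendsto (fun n => bfun Q' a n t / bfun Q' a n 1) atTop
      (𝓝 (t ^ α)) := by
    intro t ht
    refine ((reg_var h (by linarith) hT ht.1 ht.2).comp (a_top h hm)).congr' ?_
    filter_upwards [eventually_ge_atTop 1] with n hn
    have hn0 : (0:ℝ) < n := by positivity
    simp only [Function.comp_apply, bfun, mul_one]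
    rw [div_div_div_cancel_right₀ hn0.ne']
  have hβ := beta_pos hα
  have hint : Tendsto (fun n => ∫ t in (0:ℝ)..1, bfun Q' a n t / bfun Q' a n 1 / √(1 - t ^ 2)) atTop
      (𝓝 (∫ t in (0:ℝ)..1, t ^ α / √(1 - t ^ 2))) := by
    refine intervalIntegral.tendsto_integral_filter_of_dominated_convergence
      (fun t => 1 / √(1 - t ^ 2)) ?_ ?_ omega_int01 ?_
    · refine Eventually.of_forall (fun n => Measurable.aestronglyMeasurable ?_)
      have := (b_cont (a := a) h n).measurable
      fun_prop
    · filter_upwards [eventually_ge_atTop 1] with n hn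
      refine ae_of_all _ (fun t ht => ?_)
      rw [uIoc_of_le zero_le_one] at ht
      have ha := (hm n hn).1
      have h1 := b_one h hm hn
      have h2 := b_mono h ha ht.1.le ht.2
      have h3 := b_nonneg h ha ht.1.le
      rw [Real.norm_eq_abs, abs_of_nonneg (by positivity)]
      gcongr
      exact (div_le_one (by linarith)).2 h2
    · filter_upwards [ae_ne 1] with t ht1 ht
      rw [uIoc_of_le zero_le_one] at ht
      exact (hr t ⟨ht.1, lt_of_le_of_ne ht.2 ht1⟩).div_const _
  have h1 : Tendsto (fun n => bfun Q' a n 1) atTop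
      (𝓝 (Real.pi / 2 / (∫ t in (0:ℝ)..1, t ^ α / √(1 - t ^ 2)))) := by
    refine (tendsto_const_nhds.div hint hβ.ne').congr' ?_
    filter_upwards [eventually_ge_atTop 1] with n hn
    have h1 := b_one h hm hn
    have e : ∀ t : ℝ, bfun Q' a n t / bfun Q' a n 1 / √(1 - t ^ 2)
        = (bfun Q' a n 1)⁻¹ * (bfun Q' a n t / √(1 - t ^ 2)) := by
      intro t
      ring
    rw [Pi.div_apply, intervalIntegral.integral_congr (fun t _ => e t)]
    have hpi := Real.pi_pos
    have : bfun Q' a n 1 ≠ 0 := by linarith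
    rw [intervalIntegral.integral_const_mul, b_int hm hn]
    field_simp
  intro t ht
  refine (h1.mul (hr t ht)).congr' ?_
  filter_upwards [eventually_ge_atTop 1] with n hn
  have h1 := b_one h hm hn
  have : bfun Q' a n 1 ≠ 0 := by linarith
  field_simp

lemma main_pos (h : IsFC2 Q Q' Q'') (he : ∀ x, Q (-x) = Q x) {α : ℝ≥0∞} (hα : 1 < α)
    (hT : Tendsto (fun x : ℝ => ENNReal.ofReal (x * Q' x / Q x)) atTop (𝓝 α))
    (hm : IsMRSeven Q' a) {x : ℝ} (hx0 : 0 < x) (hx1 : x < 1) :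
    Tendsto (fun n => eqDensityEvenStar Q' a n x) atTop (𝓝 (ullmanDensity α x)) := by
  have hxx : 0 < 1 - x ^ 2 := by nlinarith
  have hX : 0 < √(1 - x ^ 2) := Real.sqrt_pos.2 hxx
  have hXX : √(1 - x ^ 2) ^ 2 = 1 - x ^ 2 := Real.sq_sqrt hxx.le
  have hpi := Real.pi_pos
  by_cases htop : α = ⊤
  · subst htop
    rw [ENNReal.tendsto_ofReal_nhds_top] at hT
    have := star_tendsto h he hm hx0 hx1 (b_lim_top h hm hT)
    convert this using 2
    simp only [ullmanDensity, if_true, zero_mul, sub_zero, zero_div,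
      intervalIntegral.integral_zero, add_zero]
    rw [← hXX]
    simp only [Real.sqrt_sq hX.le]
    field_simp
  · have hα1 : 1 < α.toReal := by
      rw [← ENNReal.toReal_one]
      exact (ENNReal.toReal_lt_toReal ENNReal.one_ne_top htop).2 hα
    have hT' : Tendsto (fun x : ℝ => x * Q' x / Q x) atTop (𝓝 α.toReal) := by
      refine ((ENNReal.tendsto_toReal htop).comp hT).congr' ?_
      filter_upwards [eventually_gt_atTop 0] with u hu
      simp only [Function.comp_apply]
      exact ENNReal.toReal_ofReal (h.Tpos hu.ne').le
    have := star_tendsto h he hm hx0 hx1 (b_lim_fin h hm hα1 hT')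
    convert this using 2
    have hβ := beta_pos hα1
    set β := ∫ t in (0:ℝ)..1, t ^ α.toReal / √(1 - t ^ 2) with hβd
    have e1 := split_id (b := fun t => Real.pi / 2 / β * t ^ α.toReal) hx0 hx1
      ((Real.continuous_rpow_const (by linarith)).continuousOn.const_mul _)
      ((Real.hasDerivAt_rpow_const (Or.inr hα1.le)).differentiableAt.const_mul _)
    have e2 : ∫ t in (0:ℝ)..1, Real.pi / 2 / β * t ^ α.toReal / √(1 - t ^ 2) = Real.pi / 2 := by
      simp_rw [mul_div_assoc]
      rw [intervalIntegral.integral_const_mul, ← hβd]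
      field_simp
    have e3 : ∀ t : ℝ, (Real.pi / 2 / β * t ^ α.toReal - Real.pi / 2 / β * x ^ α.toReal)
        / (t ^ 2 - x ^ 2) / √(1 - t ^ 2) = Real.pi / 2 / β *
        ((t ^ α.toReal - x ^ α.toReal) / (t ^ 2 - x ^ 2) / √(1 - t ^ 2)) := by
      intro t
      ring
    rw [e2] at e1
    rw [← e1, mul_div_cancel_left₀ _ hxx.ne']
    simp_rw [e3]
    rw [intervalIntegral.integral_const_mul]
    have e4 := pow_identity hα1 hx0 hx1
    rw [← hβd] at e4
    rw [ullmanDensity, if_neg htop, abs_of_pos hx0]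
    have e5 : ∀ I : ℝ, √(1 - x ^ 2) / Real.pi ^ 2 * (2 * (Real.pi / 2 / β * I))
      = 1 / (Real.pi * β) * (√(1 - x ^ 2) * I) := by
      intro I
      field_simp
    rw [e5, e4]
    field_simp

end facts

/-- Lemma 3.2: for `W = e^{-Q} ∈ F(C²)` with `Q` even and `T → α ∈ (1,∞]`,
the normalized equilibrium densities satisfy `lim σₙ*(x) = μ'_α(x)` for every
`x ∈ (-1,1) \ {0}`. -/
theorem statement_6
    (Q Q' Q'' W : ℝ → ℝ) (hW : ∀ x, W x = Real.exp (-Q x))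
    (hFC2 : IsFC2 Q Q' Q'')
    (hQeven : ∀ x, Q (-x) = Q x)
    (α : ℝ≥0∞) (hα : 1 < α)
    (hT : Tendsto (fun x : ℝ => ENNReal.ofReal (x * Q' x / Q x)) atTop (𝓝 α))
    (an : ℕ → ℝ) (han : IsMRSeven Q' an) :
    ∀ x : ℝ, x ∈ Set.Ioo (-1:ℝ) 1 → x ≠ 0 →
      Tendsto (fun n : ℕ => eqDensityEvenStar Q' an n x) atTop
        (𝓝 (ullmanDensity α x)) := by
  intro x hx hx0
  rcases lt_or_gt_of_ne hx0 with h | h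
  · have := main_pos hFC2 hQeven hα hT han (x := -x) (by linarith) (by linarith [hx.1])
    rw [ullman_neg] at this
    simpa only [eqStar_neg (hFC2.odd hQeven)] using this
  · exact main_pos hFC2 hQeven hα hT han h hx.2
end
end

section
/- Let W = e^{−Q} ∈ F(C²) with Q even, and suppose the function T(t) = tQ'(t)/Q(t) satisfies lim_{x→∞} T(x) = ∞. Then lim_{n→∞} γ_n^{1/n} a_n = 2, where γ_n is the (positive) leading coefficient of the n-th orthonormal polynomial p_n associated with the weight W², and a_n is the Mhaskar–Rakhmanov–Saff number. -/
open MeasureTheory ProbabilityTheory Filter Set Topology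
open scoped ENNReal NNReal Classical

noncomputable section

/-- `p` is the sequence of orthonormal polynomials for the weight `W²`:
`p j` has degree `j`, positive leading coefficient, and
`∫ pⱼ pₖ W² = δⱼₖ`. -/
def OrthonormalPolys (W : ℝ → ℝ) (p : ℕ → Polynomial ℝ) : Prop :=
  (∀ j, (p j).natDegree = j) ∧ (∀ j, 0 < (p j).leadingCoeff) ∧
    ∀ j k, (∫ x : ℝ, (p j).eval x * (p k).eval x * (W x) ^ 2) =
      if j = k then 1 else 0

theorem aux_exists_antideriv (r : Polynomial ℝ) : ∃ S : Polynomial ℝ, Polynomial.derivative S = r := by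
  induction r using Polynomial.induction_on' with
  | add p q hp hq =>
    obtain ⟨S, rfl⟩ := hp
    obtain ⟨S', rfl⟩ := hq
    exact ⟨S + S', by simp⟩
  | monomial n c =>
    refine ⟨Polynomial.monomial (n + 1) (c / (n + 1)), ?_⟩
    rw [Polynomial.derivative_monomial]
    simp only [Nat.add_sub_cancel]
    congr 1
    push_cast
    field_simp

theorem aux_cheb_lower (r : Polynomial ℝ) (n : ℕ) (hn : r.natDegree = n) (hr : 0 < r.leadingCoeff) :
    r.leadingCoeff ≤ (n + 1) * 2 ^ n * ∫ x in (-1:ℝ)..1, |r.eval x| := by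
  obtain ⟨S, hS⟩ := aux_exists_antideriv r
  set M := ∫ x in (-1:ℝ)..1, |r.eval x| with hM
  have hcont : Continuous fun x => |r.eval x| := r.continuous.abs
  have hM0 : 0 ≤ M := intervalIntegral.integral_nonneg (by norm_num) (fun x _ => abs_nonneg _)
  have hbd : ∀ x ∈ Set.Icc (-1:ℝ) 1, |S.eval x - S.eval (-1)| ≤ M := by
    intro x hx
    have h1 : ∫ y in (-1:ℝ)..x, r.eval y = S.eval x - S.eval (-1) := by
      apply intervalIntegral.integral_eq_sub_of_hasDerivAt
      · intro y _
        rw [← hS]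
        exact S.hasDerivAt y
      · exact r.continuous.intervalIntegrable _ _
    rw [← h1]
    refine (intervalIntegral.abs_integral_le_integral_abs hx.1).trans ?_
    rw [hM]
    exact intervalIntegral.integral_mono_interval le_rfl hx.1 hx.2
      (Filter.Eventually.of_forall fun x => abs_nonneg _) (hcont.intervalIntegrable _ _)
  have hSdeg : S.degree ≤ ((n + 1 : ℕ) : WithBot ℕ) := by
    have : S.natDegree ≤ n + 1 := by
      have := Polynomial.natDegree_derivative S
      rw [hS, hn] at this
      omega
    exact Polynomial.degree_le_of_natDegree_le this
  have hcoef : S.coeff (n + 1) * (n + 1) = r.leadingCoeff := by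
    have := Polynomial.coeff_derivative S n
    rw [hS] at this
    rw [Polynomial.leadingCoeff, hn, this]
  have key : ∀ M' > M, S.coeff (n + 1) ≤ M' * 2 ^ n := by
    intro M' hM'
    have hM'0 : 0 < M' := lt_of_le_of_lt hM0 hM'
    have := Polynomial.Chebyshev.coeff_le_of_forall_abs_le_one (n := n + 1)
      (P := Polynomial.C M'⁻¹ * (S - Polynomial.C (S.eval (-1)))) ?_ ?_
    · rw [Polynomial.coeff_C_mul, Polynomial.coeff_sub, Polynomial.coeff_C_succ, sub_zero] at this
      rw [inv_mul_le_iff₀ hM'0] at this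
      simpa using this
    · refine (Polynomial.degree_mul_le _ _).trans ?_
      refine (add_le_add Polynomial.degree_C_le (Polynomial.degree_sub_le _ _)).trans ?_
      rw [zero_add]
      refine max_le hSdeg (Polynomial.degree_C_le.trans ?_)
      exact_mod_cast Nat.zero_le _
    · intro x hx
      simp only [Polynomial.eval_mul, Polynomial.eval_C, Polynomial.eval_sub]
      rw [abs_mul, abs_of_pos (inv_pos.2 hM'0), inv_mul_le_iff₀ hM'0, mul_one]
      exact (hbd x hx).trans hM'.le
  have key2 : S.coeff (n + 1) ≤ M * 2 ^ n := by
    have h2 : (0:ℝ) < 2 ^ n := by positivity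
    rw [← div_le_iff₀ h2]
    refine le_of_forall_gt_imp_ge_of_dense ?_
    intro M' hM'
    rw [div_le_iff₀ h2]
    exact key M' hM'
  rw [← hcoef]
  have h3 : (0:ℝ) ≤ n + 1 := by positivity
  nlinarith [mul_le_mul_of_nonneg_right key2 h3]

theorem aux_sq (r : Polynomial ℝ) :
    (∫ x in (-1:ℝ)..1, |r.eval x|) ^ 2 ≤ 2 * ∫ x in (-1:ℝ)..1, (r.eval x) ^ 2 := by
  set m := ∫ x in (-1:ℝ)..1, |r.eval x| with hm
  have h0 : 0 ≤ ∫ x in (-1:ℝ)..1, (|r.eval x| - m / 2) ^ 2 :=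
    intervalIntegral.integral_nonneg (by norm_num) (fun x _ => sq_nonneg _)
  have hc : Continuous fun x => r.eval x := r.continuous
  have h1 : ∫ x in (-1:ℝ)..1, (|r.eval x| - m / 2) ^ 2
      = (∫ x in (-1:ℝ)..1, (r.eval x) ^ 2) - m * m + m ^ 2 / 4 * 2 := by
    have : ∀ x, (|r.eval x| - m / 2) ^ 2 = (r.eval x) ^ 2 - m * |r.eval x| + m ^ 2 / 4 := by
      intro x
      rw [sub_sq, sq_abs]; ring
    simp_rw [this]
    rw [intervalIntegral.integral_add, intervalIntegral.integral_sub,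
      intervalIntegral.integral_const_mul, intervalIntegral.integral_const]
    · rw [← hm]; simp; ring
    all_goals exact Continuous.intervalIntegrable (by fun_prop) _ _
  nlinarith

theorem aux_upper (p : Polynomial ℝ) (n : ℕ) (hn : p.natDegree = n) (hp : 0 < p.leadingCoeff)
    (a : ℝ) (ha : 0 < a) :
    p.leadingCoeff ^ 2 * a ^ (2 * n + 1) ≤
      2 * ((n + 1) * 2 ^ n) ^ 2 * ∫ x in (-a)..a, (p.eval x) ^ 2 := by
  set r := p.comp (Polynomial.C a * Polynomial.X) with hr
  have hX : (Polynomial.C a * Polynomial.X : Polynomial ℝ).natDegree = 1 :=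
    Polynomial.natDegree_C_mul_X a ha.ne'
  have hrn : r.natDegree = n := by
    rw [hr, Polynomial.natDegree_comp, hX, hn, mul_one]
  have hrl : r.leadingCoeff = p.leadingCoeff * a ^ n := by
    rw [hr, Polynomial.leadingCoeff_comp (by rw [hX]; norm_num), hn]
    simp
  have h1 := aux_cheb_lower r n hrn (by rw [hrl]; positivity)
  have h2 := aux_sq r
  have h3 : ∫ x in (-a)..a, (p.eval x) ^ 2 = a * ∫ x in (-1:ℝ)..1, (r.eval x) ^ 2 := by
    have := intervalIntegral.integral_comp_mul_left (a := -1) (b := 1) (fun x => (p.eval x) ^ 2) ha.ne'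
    simp only [hr, Polynomial.eval_comp, Polynomial.eval_mul, Polynomial.eval_C, Polynomial.eval_X]
    rw [this]
    simp
    field_simp
  rw [h3]
  have h4 : r.leadingCoeff ^ 2 ≤ ((n + 1) * 2 ^ n * ∫ x in (-1:ℝ)..1, |r.eval x|) ^ 2 := by
    apply pow_le_pow_left₀ _ h1
    rw [hrl]; positivity
  have h5 : r.leadingCoeff ^ 2 ≤ ((n + 1) * 2 ^ n) ^ 2 * (2 * ∫ x in (-1:ℝ)..1, (r.eval x) ^ 2) := by
    refine h4.trans ?_
    rw [mul_pow]
    gcongr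
  rw [hrl] at h5
  calc p.leadingCoeff ^ 2 * a ^ (2 * n + 1) = (p.leadingCoeff * a ^ n) ^ 2 * a := by ring
    _ ≤ _ := mul_le_mul_of_nonneg_right h5 ha.le
    _ = _ := by ring

theorem aux_int_mul {W : ℝ → ℝ} (hWm : Continuous W) {f g : ℝ → ℝ} (hf : Continuous f) (hg : Continuous g)
    (h1 : Integrable (fun x => f x * f x * W x ^ 2)) (h2 : Integrable (fun x => g x * g x * W x ^ 2)) :
    Integrable (fun x => f x * g x * W x ^ 2) := by
  refine (h1.add h2).mono' (by fun_prop) (Eventually.of_forall fun x => ?_)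
  have : ‖f x * g x * W x ^ 2‖ = |f x| * |g x| * W x ^ 2 := by
    rw [Real.norm_eq_abs, abs_mul, abs_mul, abs_of_nonneg (sq_nonneg (W x))]
  rw [this]
  simp only [Pi.add_apply]
  have h3 : |f x| * |g x| ≤ f x * f x + g x * g x := by
    rw [← abs_mul_abs_self (f x), ← abs_mul_abs_self (g x)]
    nlinarith [sq_nonneg (|f x| - |g x|), abs_nonneg (f x), abs_nonneg (g x)]
  nlinarith [mul_le_mul_of_nonneg_right h3 (sq_nonneg (W x))]

theorem aux_pint {W : ℝ → ℝ} {p : ℕ → Polynomial ℝ} (hp : OrthonormalPolys W p) (j : ℕ) :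
    Integrable (fun x => (p j).eval x * (p j).eval x * W x ^ 2) := by
  by_contra h
  have := hp.2.2 j j
  rw [integral_undef h] at this
  simp at this

theorem aux_span {W : ℝ → ℝ} (hWm : Continuous W) {p : ℕ → Polynomial ℝ} (hp : OrthonormalPolys W p)
    (n : ℕ) (q : Polynomial ℝ) (hq : q.degree < n) :
    Integrable (fun x => q.eval x * q.eval x * W x ^ 2) ∧
      ∫ x, q.eval x * (p n).eval x * W x ^ 2 = 0 := by
  let S : Polynomial.Sequence ℝ := ⟨p, fun i => by
    have h1 := hp.1 i
    have h2 : p i ≠ 0 := by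
      intro h
      have := hp.2.1 i
      rw [h] at this
      simp at this
    rw [Polynomial.degree_eq_natDegree h2, h1]⟩
  have hspan := S.span_degreeLT (m := n) (fun i _ => (hp.2.1 i).ne'.isUnit)
  have hmem : q ∈ Submodule.span ℝ (S '' Set.Iio n) := by
    rw [hspan, Polynomial.mem_degreeLT]; exact hq
  induction hmem using Submodule.span_induction with
  | mem x hx =>
    obtain ⟨i, hi, rfl⟩ := hx
    refine ⟨aux_pint hp i, ?_⟩
    have := hp.2.2 i n
    rw [if_neg (ne_of_lt hi)] at this
    exact this
  | zero => simp
  | add x y hx hy ihx ihy =>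
    rw [hspan, Polynomial.mem_degreeLT] at hx hy
    have ihx := ihx hx
    have ihy := ihy hy
    have hxy := aux_int_mul hWm x.continuous y.continuous ihx.1 ihy.1
    have hxn := aux_int_mul hWm x.continuous (p n).continuous ihx.1 (aux_pint hp n)
    have hyn := aux_int_mul hWm y.continuous (p n).continuous ihy.1 (aux_pint hp n)
    constructor
    · refine ((ihx.1.add ihy.1).add (hxy.const_mul 2)).congr (Eventually.of_forall fun t => ?_)
      simp; ring
    · rw [← add_zero (0:ℝ)]
      nth_rewrite 1 [← ihx.2]
      rw [← ihy.2, ← integral_add hxn hyn]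
      congr 1
      ext t
      simp; ring
  | smul c x hx ih =>
    rw [hspan, Polynomial.mem_degreeLT] at hx
    have ih := ih hx
    constructor
    · refine (ih.1.const_mul (c ^ 2)).congr (Eventually.of_forall fun t => ?_)
      simp; ring
    · have : ∀ t, (c • x).eval t * (p n).eval t * W t ^ 2 = c * (x.eval t * (p n).eval t * W t ^ 2) := by
        intro t; simp; ring
      simp_rw [this]
      rw [integral_const_mul, ih.2, mul_zero]

theorem aux_extremal {W : ℝ → ℝ} (hWm : Continuous W) {p : ℕ → Polynomial ℝ} (hp : OrthonormalPolys W p)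
    (n : ℕ) (R : Polynomial ℝ) (hR : R.natDegree = n) (hR0 : 0 < R.leadingCoeff) :
    R.leadingCoeff ^ 2 ≤ (p n).leadingCoeff ^ 2 * ∫ x, R.eval x * R.eval x * W x ^ 2 := by
  set κ := R.leadingCoeff
  set γ := (p n).leadingCoeff with hγ
  have hγ0 : 0 < γ := hp.2.1 n
  set c := κ / γ with hc
  have hc0 : 0 < c := div_pos hR0 hγ0
  set q := R - Polynomial.C c * p n with hq
  have hRne : R ≠ 0 := by
    rintro h
    simp [κ, h] at hR0
  have hpne : p n ≠ 0 := by
    rintro h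
    simp [γ, h] at hγ0
  have hqdeg : q.degree < n := by
    have : q.degree < R.degree := by
      apply Polynomial.degree_sub_lt_left
      · rw [Polynomial.degree_C_mul hc0.ne', Polynomial.degree_eq_natDegree hRne,
          Polynomial.degree_eq_natDegree hpne, hR, hp.1 n]
      · exact hRne
      · rw [Polynomial.leadingCoeff_mul, Polynomial.leadingCoeff_C, ← hγ, hc]
        field_simp
        rfl
    rwa [Polynomial.degree_eq_natDegree hRne, hR] at this
  obtain ⟨h1, h2⟩ := aux_span hWm hp n q hqdeg
  have h3 := aux_pint hp n
  have h4 := hp.2.2 n n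
  rw [if_pos rfl] at h4
  have h5 := aux_int_mul hWm q.continuous (p n).continuous h1 h3
  have h6 : ∫ x, R.eval x * R.eval x * W x ^ 2 =
      (∫ x, q.eval x * q.eval x * W x ^ 2) + 2 * c * 0 + c ^ 2 * 1 := by
    rw [← h4, ← h2, ← integral_const_mul, ← integral_const_mul, ← integral_add h1 (h5.const_mul _),
      ← integral_add (f := fun x => q.eval x * q.eval x * W x ^ 2 +
          2 * c * (q.eval x * (p n).eval x * W x ^ 2)) (h1.add (h5.const_mul _)) (h3.const_mul _)]
    congr 1
    ext t
    have : R.eval t = q.eval t + c * (p n).eval t := by simp [hq]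
    rw [this]; ring
  have h7 : 0 ≤ ∫ x, q.eval x * q.eval x * W x ^ 2 :=
    integral_nonneg fun x => mul_nonneg (mul_self_nonneg _) (sq_nonneg _)
  rw [h6]
  have h8 : κ = γ * c := by rw [hc]; field_simp
  rw [h8, mul_pow]
  apply mul_le_mul_of_nonneg_left _ (sq_nonneg γ)
  linarith

theorem aux_T_bound (n : ℕ) (y : ℝ) (hy : 1 ≤ |y|) :
    ((Polynomial.Chebyshev.T ℝ n).eval y) ^ 2 ≤ Real.exp (4 * n * |y|) := by
  have h1 : ((Polynomial.Chebyshev.T ℝ n).eval y) ^ 2 = ((Polynomial.Chebyshev.T ℝ n).eval |y|) ^ 2 := by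
    rcases abs_choice y with h | h
    · rw [h]
    · rw [h, Polynomial.Chebyshev.T_eval_neg, mul_pow]
      have : ((((n : ℤ).negOnePow : ℤˣ) : ℤ) : ℝ) ^ 2 = 1 := by
        rcases Int.units_eq_one_or ((n : ℤ).negOnePow) with h | h <;> simp [h]
      rw [this, one_mul]
  rw [h1]
  set z := |y|
  have h2 : z = Real.cosh (Real.arcosh z) := (Real.cosh_arcosh hy).symm
  set t := Real.arcosh z
  have ht : 0 ≤ t := Real.arcosh_nonneg hy
  rw [h2, Polynomial.Chebyshev.T_real_cosh]
  have h3 : Real.cosh ((n:ℤ) * t) ≤ Real.exp (n * t) := by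
    rw [Real.cosh_eq]
    have : Real.exp (-((n:ℤ) * t)) ≤ Real.exp (n * t) := by
      apply Real.exp_le_exp.2
      have : (0:ℝ) ≤ n * t := by positivity
      push_cast
      linarith
    push_cast at this ⊢
    linarith
  have h4 : t ≤ 2 * Real.cosh t := by
    rw [Real.cosh_eq]
    have := Real.add_one_le_exp t
    have := Real.exp_pos (-t)
    linarith
  calc Real.cosh ((n:ℤ) * t) ^ 2 ≤ Real.exp (n * t) ^ 2 :=
        pow_le_pow_left₀ (Real.cosh_pos _).le h3 2
    _ = Real.exp (2 * (n * t)) := by rw [← Real.exp_nat_mul]; norm_num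
    _ ≤ _ := by
      apply Real.exp_le_exp.2
      have := mul_le_mul_of_nonneg_left h4 (Nat.cast_nonneg (α := ℝ) n)
      linarith

theorem aux_exp_abs (b : ℝ) (hb : 0 < b) :
    Integrable (fun x : ℝ => Real.exp (-2 / b * |x|)) ∧ ∫ x : ℝ, Real.exp (-2 / b * |x|) = b := by
  have h0 : -2 / b < 0 := div_neg_of_neg_of_pos (by norm_num) hb
  have h := integral_comp_abs (f := fun x => Real.exp (-2 / b * x))
  rw [integral_exp_mul_Ioi h0] at h
  have h2 : ∫ x : ℝ, Real.exp (-2 / b * |x|) = b := by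
    rw [h]; simp; field_simp
  refine ⟨?_, h2⟩
  by_contra hne
  rw [integral_undef hne] at h2
  linarith

theorem aux_lower {W Q : ℝ → ℝ} (hWm : Continuous W) (hW : ∀ x, W x = Real.exp (-Q x))
    (hQ0 : ∀ x, 0 ≤ Q x)
    {p : ℕ → Polynomial ℝ} (hp : OrthonormalPolys W p)
    (n : ℕ) (hn : 1 ≤ n) (b : ℝ) (hb : 0 < b) (hQ : ∀ x, b ≤ |x| → 3 * n * (|x| / b) ≤ Q x) :
    (2 ^ (n - 1) * b⁻¹ ^ n) ^ 2 ≤ (p n).leadingCoeff ^ 2 * (Real.exp 2 * b) := by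
  set R := (Polynomial.Chebyshev.T ℝ n).comp (Polynomial.C b⁻¹ * Polynomial.X) with hR
  have hb' : 0 < b⁻¹ := inv_pos.2 hb
  have hX : (Polynomial.C b⁻¹ * Polynomial.X : Polynomial ℝ).natDegree = 1 :=
    Polynomial.natDegree_C_mul_X b⁻¹ hb'.ne'
  have hRn : R.natDegree = n := by
    rw [hR, Polynomial.natDegree_comp, hX, Polynomial.Chebyshev.natDegree_T]; simp
  have hRl : R.leadingCoeff = 2 ^ (n - 1) * b⁻¹ ^ n := by
    rw [hR, Polynomial.leadingCoeff_comp (by rw [hX]; norm_num), Polynomial.Chebyshev.natDegree_T,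
      Polynomial.Chebyshev.leadingCoeff_T]
    simp
  have h1 := aux_extremal hWm hp n R hRn (by rw [hRl]; positivity)
  rw [hRl] at h1
  refine h1.trans (mul_le_mul_of_nonneg_left ?_ (sq_nonneg _))
  obtain ⟨hi, hv⟩ := aux_exp_abs b hb
  rw [← hv, ← integral_const_mul]
  apply integral_mono_of_nonneg (Eventually.of_forall fun x => mul_nonneg (mul_self_nonneg _) (sq_nonneg _))
    (hi.const_mul _) (Eventually.of_forall fun x => ?_)
  have hn1 : (1:ℝ) ≤ n := by exact_mod_cast hn
  have hRe : R.eval x = (Polynomial.Chebyshev.T ℝ n).eval (x / b) := by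
    simp [hR, Polynomial.eval_comp, div_eq_inv_mul]
  simp only []
  rw [hRe, ← sq, hW, ← Real.exp_nat_mul, ← Real.exp_add]
  have hab : |x / b| = |x| / b := by rw [abs_div, abs_of_pos hb]
  have e1 : -2 / b * |x| = -2 * (|x| / b) := by ring
  rw [e1]
  rcases le_total (|x|) b with h | h
  · have h2 : |x / b| ≤ 1 := by rw [hab, div_le_one hb]; exact h
    have h3 := Polynomial.Chebyshev.abs_eval_T_real_le_one n h2
    have h4 : ((Polynomial.Chebyshev.T ℝ n).eval (x / b)) ^ 2 ≤ 1 := by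
      rw [← sq_abs]; exact pow_le_one₀ (abs_nonneg _) h3
    have h5 : Real.exp ((2:ℕ) * -Q x) ≤ 1 := by
      rw [Real.exp_le_one_iff]
      push_cast
      linarith [hQ0 x]
    calc _ ≤ (1:ℝ) * 1 := by gcongr
      _ ≤ _ := by
        rw [mul_one]
        apply Real.one_le_exp
        rw [hab] at h2
        linarith
  · have h2 : 1 ≤ |x / b| := by rw [hab, one_le_div hb]; exact h
    have h3 := aux_T_bound n (x / b) h2
    have h4 := hQ x h
    rw [hab] at h2 h3
    set z := |x| / b
    calc _ ≤ Real.exp (4 * n * z) * Real.exp ((2:ℕ) * -Q x) := by gcongr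
      _ = Real.exp (4 * n * z + (2:ℕ) * -Q x) := by rw [Real.exp_add]
      _ ≤ _ := by
        apply Real.exp_le_exp.2
        push_cast
        nlinarith

theorem aux_upper2 {W Q : ℝ → ℝ} (hWm : Continuous W) (hW : ∀ x, W x = Real.exp (-Q x))
    {p : ℕ → Polynomial ℝ} (hp : OrthonormalPolys W p) (n : ℕ) (a : ℝ) (ha : 0 < a)
    (hQ : ∀ x, |x| ≤ a → Q x ≤ Q a) :
    (p n).leadingCoeff ^ 2 * a ^ (2 * n + 1) ≤ 2 * ((n + 1) * 2 ^ n) ^ 2 * Real.exp (2 * Q a) := by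
  have h1 := aux_upper (p n) n (hp.1 n) (hp.2.1 n) a ha
  refine h1.trans (mul_le_mul_of_nonneg_left ?_ (by positivity))
  have h2 := hp.2.2 n n
  rw [if_pos rfl] at h2
  have h3 : ∫ x in (-a)..a, (p n).eval x * (p n).eval x * W x ^ 2 ≤ 1 := by
    rw [← h2, intervalIntegral.integral_of_le (by linarith)]
    exact setIntegral_le_integral (aux_pint hp n)
      (Eventually.of_forall fun x => mul_nonneg (mul_self_nonneg _) (sq_nonneg _))
  have hc : Continuous fun x => (p n).eval x := (p n).continuous
  have h4 : ∫ x in (-a)..a, Real.exp (-(2 * Q a)) * ((p n).eval x) ^ 2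
      ≤ ∫ x in (-a)..a, (p n).eval x * (p n).eval x * W x ^ 2 := by
    apply intervalIntegral.integral_mono_on (by linarith)
    · exact Continuous.intervalIntegrable (by fun_prop) _ _
    · exact Continuous.intervalIntegrable (by fun_prop) _ _
    · intro x hx
      have := hQ x (abs_le.2 hx)
      rw [hW, ← Real.exp_nat_mul, ← sq, mul_comm]
      apply mul_le_mul_of_nonneg_left _ (sq_nonneg _)
      apply Real.exp_le_exp.2
      push_cast
      linarith
  rw [intervalIntegral.integral_const_mul] at h4
  have h5 := h4.trans h3
  rw [Real.exp_neg, inv_mul_le_iff₀ (Real.exp_pos _), mul_one] at h5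
  exact h5

theorem aux_pos {Q Q' Q'' : ℝ → ℝ} (h : IsFC2 Q Q' Q'') (t : ℝ) (ht : 0 < t) :
    0 < Q t ∧ 0 < Q' t ∧ Q t ≤ t * Q' t := by
  obtain ⟨Λ, hΛ, hT⟩ := h.lambdaBound
  have h1 := hT t ht.ne'
  have h2 : 0 < Q t := by
    refine lt_of_le_of_ne (h.nonneg t) ?_
    intro h3
    rw [← h3, div_zero] at h1
    linarith
  rw [le_div_iff₀ h2] at h1
  have h3 : Q t < t * Q' t := by nlinarith
  refine ⟨h2, ?_, h3.le⟩
  by_contra h4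
  push Not at h4
  nlinarith

theorem aux_tangent {Q Q' Q'' : ℝ → ℝ} (h : IsFC2 Q Q' Q'') (x y : ℝ) (hxy : x ≤ y) :
    Q x + Q' x * (y - x) ≤ Q y := by
  rcases hxy.eq_or_lt with rfl | hlt
  · simp
  · obtain ⟨c, hc, he⟩ := exists_hasDerivAt_eq_slope Q Q' hlt
      (fun z _ => (h.hasDeriv z).continuousAt.continuousWithinAt) (fun z _ => h.hasDeriv z)
    have h1 := h.monoDeriv hc.1.le
    rw [he, le_div_iff₀ (by linarith)] at h1
    linarith

theorem aux_nonneg' {Q Q' Q'' : ℝ → ℝ} (h : IsFC2 Q Q' Q'') (t : ℝ) (ht : 0 ≤ t) : 0 ≤ Q' t := by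
  have h1 : ∀ s, 0 < s → 0 ≤ Q' s := fun s hs => (aux_pos h s hs).2.1.le
  rcases ht.eq_or_lt with rfl | hlt
  · have : Tendsto Q' (𝓝[>] 0) (𝓝 (Q' 0)) := (h.contDeriv.tendsto 0).mono_left nhdsWithin_le_nhds
    exact ge_of_tendsto this (eventually_nhdsWithin_of_forall fun s hs => h1 s hs)
  · exact h1 t hlt

theorem aux_mono {Q Q' Q'' : ℝ → ℝ} (h : IsFC2 Q Q' Q'') (x y : ℝ) (hx : 0 ≤ x) (hxy : x ≤ y) :
    Q x ≤ Q y := by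
  have := aux_tangent h x y hxy
  nlinarith [aux_nonneg' h x hx]

theorem aux_arcsin : IntervalIntegrable (fun t : ℝ => 1 / Real.sqrt (1 - t ^ 2)) volume 0 1 ∧
    ∫ t in (0:ℝ)..1, 1 / Real.sqrt (1 - t ^ 2) = Real.pi / 2 := by
  have h0 : IntervalIntegrable (fun t : ℝ => 1 / Real.sqrt (1 - t ^ 2)) volume 0 1 := by
    have := Polynomial.Chebyshev.intervalIntegrable_sqrt_one_sub_sq_inv
    have h2 := this.mono_set (c := 0) (d := 1) (by
      rw [Set.uIcc_of_le (by norm_num), Set.uIcc_of_le (by norm_num)]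
      exact Set.Icc_subset_Icc (by norm_num) le_rfl)
    refine h2.congr ?_
    intro t _
    simp [Real.sqrt_inv]
  refine ⟨h0, ?_⟩
  rw [intervalIntegral.integral_eq_sub_of_hasDerivAt_of_le (f := Real.arcsin) (by norm_num)
    Real.continuous_arcsin.continuousOn _ h0]
  · simp
  · intro x hx
    exact Real.hasDerivAt_arcsin (by linarith [hx.1]) (by linarith [hx.2])

theorem aux_mrs_upper {Q Q' Q'' : ℝ → ℝ} (h : IsFC2 Q Q' Q'') (n : ℝ) (hn : 0 < n) (a : ℝ) (ha : 0 < a)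
    (he : (2 / Real.pi) * ∫ t in (0:ℝ)..1, a * t * Q' (a * t) / Real.sqrt (1 - t ^ 2) = n) :
    n ≤ a * Q' a := by
  have hint : IntervalIntegrable (fun t => a * t * Q' (a * t) / Real.sqrt (1 - t ^ 2)) volume 0 1 := by
    by_contra hne
    rw [intervalIntegral.integral_undef hne] at he
    simp at he
    linarith
  have h1 : ∫ t in (0:ℝ)..1, a * t * Q' (a * t) / Real.sqrt (1 - t ^ 2) ≤
      ∫ t in (0:ℝ)..1, a * Q' a * (1 / Real.sqrt (1 - t ^ 2)) := by
    apply intervalIntegral.integral_mono_on (by norm_num) hint (aux_arcsin.1.const_mul _)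
    intro t ht
    rw [← div_eq_mul_one_div]
    apply div_le_div_of_nonneg_right _ (Real.sqrt_nonneg _)
    have hat : a * t ≤ a := by nlinarith [ht.2]
    have hat0 : 0 ≤ a * t := mul_nonneg ha.le ht.1
    exact mul_le_mul hat (h.monoDeriv hat) (aux_nonneg' h _ hat0) ha.le
  rw [intervalIntegral.integral_const_mul, aux_arcsin.2] at h1
  rw [← he]
  have hpi := Real.pi_pos
  calc _ ≤ 2 / Real.pi * (a * Q' a * (Real.pi / 2)) := by gcongr
    _ = _ := by field_simp

theorem aux_mrs_lower {Q Q' Q'' : ℝ → ℝ} (h : IsFC2 Q Q' Q'') (n : ℝ) (hn : 0 < n) (a : ℝ) (ha : 0 < a)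
    (he : (2 / Real.pi) * ∫ t in (0:ℝ)..1, a * t * Q' (a * t) / Real.sqrt (1 - t ^ 2) = n)
    (s : ℝ) (hs : 0 < s) (hs1 : s < 1) :
    (2 / Real.pi) * ((1 - s) / Real.sqrt (2 * s) * (Q a - Q (a * (1 - s)))) ≤ n := by
  have hint : IntervalIntegrable (fun t => a * t * Q' (a * t) / Real.sqrt (1 - t ^ 2)) volume 0 1 := by
    by_contra hne
    rw [intervalIntegral.integral_undef hne] at he
    simp at he
    linarith
  have hcQ' := h.contDeriv
  have h1 : ∫ t in (1 - s)..1, (1 - s) / Real.sqrt (2 * s) * (Q' (a * t) * a) ≤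
      ∫ t in (1 - s)..1, a * t * Q' (a * t) / Real.sqrt (1 - t ^ 2) := by
    apply intervalIntegral.integral_mono_on_of_le_Ioo (by linarith)
    · exact Continuous.intervalIntegrable (by fun_prop) _ _
    · refine hint.mono_set ?_
      rw [Set.uIcc_of_le (by linarith), Set.uIcc_of_le (by norm_num)]
      exact Set.Icc_subset_Icc (by linarith) le_rfl
    · intro t ht
      have ht0 : 0 < t := by linarith [ht.1]
      have h2 : 0 < 1 - t ^ 2 := by nlinarith [ht.2]
      have h3 : 1 - t ^ 2 ≤ 2 * s := by nlinarith [ht.1, ht.2]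
      have h4 : 0 ≤ Q' (a * t) := aux_nonneg' h _ (by positivity)
      calc (1 - s) / Real.sqrt (2 * s) * (Q' (a * t) * a)
          ≤ t / Real.sqrt (1 - t ^ 2) * (Q' (a * t) * a) := by
            apply mul_le_mul_of_nonneg_right _ (by positivity)
            exact div_le_div₀ ht0.le ht.1.le (Real.sqrt_pos.2 h2) (Real.sqrt_le_sqrt h3)
        _ = _ := by ring
  have h2 : ∫ t in (1 - s)..1, a * t * Q' (a * t) / Real.sqrt (1 - t ^ 2) ≤
      ∫ t in (0:ℝ)..1, a * t * Q' (a * t) / Real.sqrt (1 - t ^ 2) := by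
    apply intervalIntegral.integral_mono_interval (by linarith) (by linarith) le_rfl _ hint
    refine (ae_restrict_iff' measurableSet_Ioc).2 (Eventually.of_forall fun t ht => ?_)
    have ht0 := ht.1
    have h4 : 0 ≤ Q' (a * t) := aux_nonneg' h _ (by positivity)
    simp only [Pi.zero_apply]
    positivity
  have h3 : ∫ t in (1 - s)..1, Q' (a * t) * a = Q a - Q (a * (1 - s)) := by
    rw [intervalIntegral.integral_eq_sub_of_hasDerivAt (f := fun t => Q (a * t))]
    · simp
    · intro t _
      have h5 : HasDerivAt (fun t : ℝ => a * t) a t := by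
        simpa using (hasDerivAt_id t).const_mul a
      exact (h.hasDeriv (a * t)).comp t h5
    · exact Continuous.intervalIntegrable (by fun_prop) _ _
  rw [intervalIntegral.integral_const_mul, h3] at h1
  rw [← he]
  have hpi := Real.pi_pos
  exact mul_le_mul_of_nonneg_left (h1.trans h2) (by positivity)

theorem aux_top {Q Q' Q'' : ℝ → ℝ} (h : IsFC2 Q Q' Q'') {an : ℕ → ℝ} (han : IsMRSeven Q' an) :
    Tendsto an atTop atTop := by
  rw [tendsto_atTop]
  intro R
  obtain ⟨N, hN⟩ := exists_nat_gt (max R 1 * Q' (max R 1))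
  filter_upwards [eventually_ge_atTop (max N 1)] with n hn
  have hn1 : 1 ≤ n := (le_max_right _ _).trans hn
  have hnN : (N:ℝ) ≤ n := by exact_mod_cast (le_max_left _ _).trans hn
  obtain ⟨ha, he⟩ := han n hn1
  have h1 := aux_mrs_upper h n (by exact_mod_cast hn1) (an n) ha he
  by_contra hlt
  push Not at hlt
  have h2 : an n ≤ max R 1 := hlt.le.trans (le_max_left _ _)
  have h3 : an n * Q' (an n) ≤ max R 1 * Q' (max R 1) :=
    mul_le_mul h2 (h.monoDeriv h2) (aux_nonneg' h _ ha.le) (ha.le.trans h2)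
  linarith

theorem aux_Qsmall {Q Q' Q'' : ℝ → ℝ} (h : IsFC2 Q Q' Q'')
    (hT : Tendsto (fun x : ℝ => x * Q' x / Q x) atTop atTop)
    {an : ℕ → ℝ} (han : IsMRSeven Q' an) (η : ℝ) (hη : 0 < η) :
    ∀ᶠ n : ℕ in atTop, Q (an n) ≤ η * n := by
  have hpi := Real.pi_pos
  obtain ⟨u, hu0, hu1, hu2⟩ : ∃ u : ℝ, 0 < u ∧ u ≤ 1 ∧ 2 * Real.pi * u ≤ η := by
    refine ⟨min 1 (η / (2 * Real.pi)), by positivity, min_le_left _ _, ?_⟩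
    calc _ ≤ 2 * Real.pi * (η / (2 * Real.pi)) := by gcongr; exact min_le_right _ _
      _ = η := by field_simp
  set s := u ^ 2 / 2 with hs
  have hs0 : 0 < s := by positivity
  have hs1 : s ≤ 1 / 2 := by nlinarith
  have hsq : Real.sqrt (2 * s) = u := by
    rw [hs, mul_div_cancel₀ _ (by norm_num), Real.sqrt_sq hu0.le]
  have hv : Tendsto (fun n => an n * (1 - s)) atTop atTop :=
    (aux_top h han).atTop_mul_const (by linarith)
  filter_upwards [(hT.comp hv).eventually_ge_atTop (1 / s), eventually_ge_atTop 1] with n hn hn1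
  obtain ⟨ha, he⟩ := han n hn1
  set a := an n
  have hn0 : (0:ℝ) < n := by exact_mod_cast hn1
  have h1 := aux_mrs_lower h n hn0 a ha he s hs0 (by linarith)
  rw [hsq] at h1
  simp only [Function.comp] at hn
  have hv0 : 0 < a * (1 - s) := mul_pos ha (by linarith)
  have h2 := aux_tangent h (a * (1 - s)) a (by nlinarith)
  set v := a * (1 - s) with hvdef
  obtain ⟨hQv, hQ'v, -⟩ := aux_pos h v hv0
  rw [div_le_div_iff₀ hs0 hQv, one_mul] at hn
  have h3 : v * s ≤ a - v := by
    have : a - v - v * s = a * s ^ 2 := by rw [hvdef]; ring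
    nlinarith [mul_pos ha (pow_pos hs0 2)]
  have h4 : 2 * Q v ≤ Q a := by nlinarith
  have hQa := (aux_pos h a ha).1
  have h5 : 1 / 2 / u * (Q a / 2) ≤ (1 - s) / u * (Q a - Q v) := by
    apply mul_le_mul
    · gcongr
      linarith
    · linarith
    · linarith
    · apply div_nonneg _ hu0.le
      linarith
  have h6 : 2 / Real.pi * (1 / 2 / u * (Q a / 2)) ≤ n :=
    (mul_le_mul_of_nonneg_left h5 (by positivity)).trans h1
  have h7 : 2 / Real.pi * (1 / 2 / u * (Q a / 2)) = Q a / (2 * Real.pi * u) := by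
    field_simp
  rw [h7, div_le_iff₀ (by positivity)] at h6
  nlinarith

theorem aux_big {Q Q' Q'' : ℝ → ℝ} (h : IsFC2 Q Q' Q'') (hQeven : ∀ x, Q (-x) = Q x)
    (hT : Tendsto (fun x : ℝ => x * Q' x / Q x) atTop atTop)
    {an : ℕ → ℝ} (han : IsMRSeven Q' an) (ε : ℝ) (hε : 0 < ε) :
    ∀ᶠ n : ℕ in atTop, ∀ x, (1 + 2 * ε) * an n ≤ |x| →
      3 * n * (|x| / ((1 + 2 * ε) * an n)) ≤ Q x := by
  have hv : Tendsto (fun n => an n * (1 + ε)) atTop atTop :=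
    (aux_top h han).atTop_mul_const (by linarith)
  filter_upwards [(hT.comp hv).eventually_ge_atTop (3 * (1 + ε) / ε ^ 2), eventually_ge_atTop 1]
    with n hn hn1 x hx
  obtain ⟨ha, he⟩ := han n hn1
  set a := an n
  have hn0 : (0:ℝ) < n := by exact_mod_cast hn1
  have h1 := aux_mrs_upper h n hn0 a ha he
  simp only [Function.comp] at hn
  set u := a * (1 + ε) with hu
  set b := (1 + 2 * ε) * a with hb
  have hu0 : 0 < u := by positivity
  have hb0 : 0 < b := by positivity
  obtain ⟨hQu, hQ'u, -⟩ := aux_pos h u hu0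
  obtain ⟨hQa, hQ'a, -⟩ := aux_pos h a ha
  obtain ⟨hQb, hQ'b, hb1⟩ := aux_pos h b hb0
  have h2 := aux_tangent h a u (by nlinarith)
  have h3 := aux_tangent h u b (by nlinarith)
  have h4 := aux_tangent h b |x| hx
  have e1 : u - a = ε * a := by rw [hu]; ring
  have e2 : b - u = ε * a := by rw [hu, hb]; ring
  rw [e1] at h2
  rw [e2] at h3
  have h5 : ε * n ≤ Q u := by nlinarith
  rw [div_le_div_iff₀ (by positivity) hQu] at hn
  have h6 : 3 * Q u ≤ a * Q' u * ε ^ 2 := by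
    have : (3 * Q u) * (1 + ε) ≤ (a * Q' u * ε ^ 2) * (1 + ε) := by
      rw [hu] at hn ⊢
      nlinarith
    exact le_of_mul_le_mul_right this (by positivity)
  have h7 : 3 * (n : ℝ) ≤ Q b := by
    have : ε * (3 * n) ≤ ε * Q b := by nlinarith
    exact le_of_mul_le_mul_left this hε
  have hQx : Q x = Q |x| := by
    rcases abs_choice x with hh | hh
    · rw [hh]
    · rw [hh, hQeven]
  rw [hQx, ← mul_div_assoc, div_le_iff₀ hb0]
  have h8 : Q b * |x| ≤ Q |x| * b := by
    nlinarith [mul_le_mul_of_nonneg_right hb1 (sub_nonneg.2 hx), mul_le_mul_of_nonneg_right h4 hb0.le]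
  nlinarith [abs_nonneg x, mul_le_mul_of_nonneg_right h7 (abs_nonneg x)]

theorem statement_12
    (Q Q' Q'' W : ℝ → ℝ) (hW : ∀ x, W x = Real.exp (-Q x))
    (hFC2 : IsFC2 Q Q' Q'')
    (hQeven : ∀ x, Q (-x) = Q x)
    (hT : Tendsto (fun x : ℝ => x * Q' x / Q x) atTop atTop)
    (p : ℕ → Polynomial ℝ) (hp : OrthonormalPolys W p)
    (an : ℕ → ℝ) (han : IsMRSeven Q' an) :
    Tendsto (fun n : ℕ => ((p n).leadingCoeff) ^ ((1 : ℝ) / n) * an n)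
      atTop (𝓝 2) := by
  have hQc : Continuous Q := continuous_iff_continuousAt.2 fun x => (hFC2.hasDeriv x).continuousAt
  have hWc : Continuous W := by
    have : W = fun x => Real.exp (-Q x) := funext hW
    rw [this]; fun_prop
  have htop := aux_top hFC2 han
  have hinv : Tendsto (fun n : ℕ => (1:ℝ) / n) atTop (𝓝 0) := tendsto_one_div_atTop_nhds_zero_nat
  have hlog : Tendsto (fun n : ℕ => Real.log n / n) atTop (𝓝 0) := by
    have := (Real.isLittleO_log_id_atTop.tendsto_div_nhds_zero).comp (tendsto_natCast_atTop_atTop (R := ℝ))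
    exact this
  obtain ⟨hQ1, -, hQ1'⟩ := aux_pos hFC2 1 one_pos
  -- log a_n / n → 0
  have hloga : Tendsto (fun n : ℕ => Real.log (an n) / n) atTop (𝓝 0) := by
    have hup : Tendsto (fun n : ℕ => Real.log n / n - Real.log (Q 1) * (1 / n)) atTop (𝓝 0) := by
      simpa using hlog.sub (hinv.const_mul (Real.log (Q 1)))
    refine tendsto_of_tendsto_of_tendsto_of_le_of_le' tendsto_const_nhds hup ?_ ?_
    · filter_upwards [htop.eventually_ge_atTop 1] with n hn
      exact div_nonneg (Real.log_nonneg hn) (Nat.cast_nonneg _)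
    · filter_upwards [htop.eventually_ge_atTop 1, aux_Qsmall hFC2 hT han 1 one_pos,
        eventually_ge_atTop 1] with n hn hq hn1
      have hn0 : (0:ℝ) < n := by exact_mod_cast hn1
      have h1 := aux_tangent hFC2 1 (an n) hn
      have h2 : Q 1 * an n ≤ n := by nlinarith
      have h3 : Real.log (Q 1 * an n) ≤ Real.log n := Real.log_le_log (by positivity) h2
      rw [Real.log_mul hQ1.ne' (by linarith)] at h3
      have : Real.log n / n - Real.log (Q 1) * (1 / n) = (Real.log n - Real.log (Q 1)) / n := by ring
      rw [this]
      gcongr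
      linarith
  set x : ℕ → ℝ := fun n => Real.log (p n).leadingCoeff / n + Real.log (an n) with hx
  have hmain : Tendsto x atTop (𝓝 (Real.log 2)) := by
    rw [tendsto_order]
    constructor
    · intro c hc
      -- choose ε
      set δ := Real.log 2 - c with hδ
      have hδ0 : 0 < δ := by simp only [hδ]; linarith
      obtain ⟨ε, hε, hεδ⟩ : ∃ ε : ℝ, 0 < ε ∧ Real.log (1 + 2 * ε) ≤ δ / 2 := by
        refine ⟨δ / 4, by positivity, ?_⟩
        have := Real.log_le_sub_one_of_pos (x := 1 + 2 * (δ / 4)) (by positivity)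
        linarith
      have hlim : Tendsto (fun n : ℕ => (Real.log 2 + 1 + Real.log (1 + 2 * ε) / 2) * ((1:ℝ) / n) +
          1 / 2 * (Real.log (an n) / n)) atTop (𝓝 0) := by
        simpa using (hinv.const_mul (Real.log 2 + 1 + Real.log (1 + 2 * ε) / 2)).add
          (hloga.const_mul (2⁻¹ : ℝ))
      filter_upwards [hlim.eventually_lt_const (half_pos hδ0), aux_big hFC2 hQeven hT han ε hε,
        eventually_ge_atTop 1] with n h1 h2 hn1
      have hn0 : (0:ℝ) < n := by exact_mod_cast hn1
      have ha := (han n hn1).1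
      have hγ := hp.2.1 n
      have hε1 : 0 < 1 + 2 * ε := by positivity
      have h3 := aux_lower hWc hW hFC2.nonneg hp n hn1 ((1 + 2 * ε) * an n) (by positivity) h2
      have h4 := Real.log_le_log (by positivity) h3
      have hb0 : 0 < (1 + 2 * ε) * an n := by positivity
      rw [Real.log_pow, Real.log_mul (by positivity) (by positivity), Real.log_pow, Real.log_pow,
        Real.log_inv, Real.log_mul (pow_pos hγ 2).ne' (by positivity), Real.log_pow,
        Real.log_mul (Real.exp_pos 2).ne' hb0.ne', Real.log_exp,
        Real.log_mul hε1.ne' ha.ne', Nat.cast_sub hn1] at h4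
      push_cast at h4
      have h5 : Real.log 2 - Real.log (1 + 2 * ε) -
        ((Real.log 2 + 1 + Real.log (1 + 2 * ε) / 2) * ((1:ℝ) / n) +
          1 / 2 * (Real.log (an n) / n)) ≤ x n := by
        simp only [hx]
        have h6 : n * (Real.log 2 - Real.log (1 + 2 * ε) - Real.log (an n)) -
          (Real.log 2 + 1 + Real.log (1 + 2 * ε) / 2 + Real.log (an n) / 2)
            ≤ Real.log (p n).leadingCoeff := by linarith
        have h7 := div_le_div_of_nonneg_right h6 hn0.le
        have h8 : (n * (Real.log 2 - Real.log (1 + 2 * ε) - Real.log (an n)) -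
          (Real.log 2 + 1 + Real.log (1 + 2 * ε) / 2 + Real.log (an n) / 2)) / n
          = Real.log 2 - Real.log (1 + 2 * ε) -
        ((Real.log 2 + 1 + Real.log (1 + 2 * ε) / 2) * ((1:ℝ) / n) +
          1 / 2 * (Real.log (an n) / n)) - Real.log (an n) := by field_simp; ring
        rw [h8] at h7
        linarith
      linarith
    · intro c hc
      set δ := c - Real.log 2 with hδ
      have hδ0 : 0 < δ := by simp only [hδ]; linarith
      have hlog1 : Tendsto (fun n : ℕ => Real.log 2 / 2 * ((1:ℝ) / n) +
          (Real.log 2 * ((1:ℝ) / n) + Real.log n / n) - 1 / 2 * (Real.log (an n) / n)) atTop (𝓝 0) := by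
        simpa using ((hinv.const_mul (Real.log 2 / 2)).add ((hinv.const_mul (Real.log 2)).add hlog)).sub
          (hloga.const_mul (2⁻¹ : ℝ))
      filter_upwards [hlog1.eventually_lt_const (half_pos hδ0),
        aux_Qsmall hFC2 hT han (δ / 2) (half_pos hδ0), eventually_ge_atTop 1] with n h1 h2 hn1
      have hn0 : (0:ℝ) < n := by exact_mod_cast hn1
      have hn1' : (1:ℝ) ≤ n := by exact_mod_cast hn1
      have ha := (han n hn1).1
      have hγ := hp.2.1 n
      have h3 := aux_upper2 hWc hW hp n (an n) ha (fun y hy => by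
        have hQx : Q y = Q |y| := by
          rcases abs_choice y with hh | hh
          · rw [hh]
          · rw [hh, hQeven]
        rw [hQx]
        exact aux_mono hFC2 _ _ (abs_nonneg _) hy)
      have h4 := Real.log_le_log (by positivity) h3
      rw [Real.log_mul (by positivity) (by positivity), Real.log_pow, Real.log_pow,
        Real.log_mul (by positivity) (by positivity), Real.log_exp,
        Real.log_mul (by positivity) (by positivity), Real.log_pow,
        Real.log_mul (by positivity) (by positivity), Real.log_pow] at h4
      push_cast at h4
      have hl : Real.log (n + 1) ≤ Real.log 2 + Real.log n := by
        rw [← Real.log_mul (by norm_num) hn0.ne']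
        exact Real.log_le_log (by positivity) (by linarith)
      have h6 : Real.log (p n).leadingCoeff ≤ n * (Real.log 2 - Real.log (an n) + δ / 2)
          + (Real.log 2 / 2 + (Real.log 2 + Real.log n) - Real.log (an n) / 2) := by linarith
      have h7 := div_le_div_of_nonneg_right h6 hn0.le
      have h8 : (n * (Real.log 2 - Real.log (an n) + δ / 2)
          + (Real.log 2 / 2 + (Real.log 2 + Real.log n) - Real.log (an n) / 2)) / n
          = Real.log 2 - Real.log (an n) + δ / 2 + (Real.log 2 / 2 * ((1:ℝ) / n) +
          (Real.log 2 * ((1:ℝ) / n) + Real.log n / n) - 1 / 2 * (Real.log (an n) / n)) := by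
        field_simp
      rw [h8] at h7
      simp only [hx]
      linarith
  have hexp := (Real.continuous_exp.tendsto _).comp hmain
  rw [Real.exp_log (by norm_num)] at hexp
  refine hexp.congr' ?_
  filter_upwards [eventually_ge_atTop 1] with n hn1
  have ha := (han n hn1).1
  simp only [Function.comp, hx]
  rw [Real.exp_add, Real.exp_log ha, Real.rpow_def_of_pos (hp.2.1 n)]
  congr 2
  ring
end
end

section
/- Let W = e^{−Q} ∈ F(C²) with Q even, and suppose the function T(t) = tQ'(t)/Q(t) satisfies lim_{x→∞} T(x) = α for some α ∈ (1, ∞). Then lim_{n→∞} γ_n^{1/n} a_n = 2 e^{1/α}, where γ_n is the (positive) leading coefficient of the n-th orthonormal polynomial p_n associated with the weight W², and a_n is the Mhaskar–Rakhmanov–Saff number. -/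
open MeasureTheory ProbabilityTheory Filter Set Topology
open scoped ENNReal NNReal Classical

noncomputable section

def LL (f : ℝ → ℝ) : ℝ :=
  ∫ φ in (0:ℝ)..Real.pi, ∫ θ in (0:ℝ)..Real.pi, Real.sin θ * f (Real.sin φ * Real.sin θ)

lemma LL_inner_cont {f : ℝ → ℝ} (hf : Continuous f) :
    Continuous (fun φ : ℝ => ∫ θ in (0:ℝ)..Real.pi, Real.sin θ * f (Real.sin φ * Real.sin θ)) := by
  apply intervalIntegral.continuous_parametric_intervalIntegral_of_continuous'
  simp only [Function.uncurry_def]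
  fun_prop

lemma LL_add {f g : ℝ → ℝ} (hf : Continuous f) (hg : Continuous g) :
    LL (fun x => f x + g x) = LL f + LL g := by
  unfold LL
  rw [← intervalIntegral.integral_add ((LL_inner_cont hf).intervalIntegrable _ _)
    ((LL_inner_cont hg).intervalIntegrable _ _)]
  congr 1
  ext φ
  rw [← intervalIntegral.integral_add]
  · congr 1; ext θ; ring
  · exact Continuous.intervalIntegrable (by fun_prop) _ _
  · exact Continuous.intervalIntegrable (by fun_prop) _ _

lemma LL_bound {f : ℝ → ℝ} {ε : ℝ} (h : ∀ y ∈ Icc (0:ℝ) 1, |f y| ≤ ε) :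
    |LL f| ≤ ε * Real.pi * Real.pi := by
  unfold LL
  have hpi := Real.pi_pos
  have := intervalIntegral.norm_integral_le_of_norm_le_const (a := 0) (b := Real.pi) (C := ε * Real.pi)
    (f := fun φ => ∫ θ in (0:ℝ)..Real.pi, Real.sin θ * f (Real.sin φ * Real.sin θ)) ?_
  · simpa [abs_of_pos hpi] using this
  intro φ hφ
  have := intervalIntegral.norm_integral_le_of_norm_le_const (a := 0) (b := Real.pi) (C := ε)
    (f := fun θ => Real.sin θ * f (Real.sin φ * Real.sin θ)) ?_
  · simpa [abs_of_pos hpi] using this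
  intro θ hθ
  rw [uIoc_of_le hpi.le] at hφ hθ
  have h1 : 0 ≤ Real.sin θ := Real.sin_nonneg_of_nonneg_of_le_pi hθ.1.le hθ.2
  have h2 : 0 ≤ Real.sin φ := Real.sin_nonneg_of_nonneg_of_le_pi hφ.1.le hφ.2
  have h3 := Real.sin_le_one θ
  have h4 := Real.sin_le_one φ
  have h5 := h (Real.sin φ * Real.sin θ) ⟨by positivity, by nlinarith⟩
  rw [norm_mul, Real.norm_eq_abs, Real.norm_eq_abs, abs_of_nonneg h1]
  nlinarith [abs_nonneg (f (Real.sin φ * Real.sin θ))]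

lemma wallis_prod (k : ℕ) : ((k:ℝ) + 1) * ((∫ x in (0:ℝ)..Real.pi, Real.sin x ^ (k+1)) *
    ∫ x in (0:ℝ)..Real.pi, Real.sin x ^ k) = 2 * Real.pi := by
  induction k with
  | zero => simp; ring
  | succ k ih =>
    rw [integral_sin_pow]
    simp only [Real.sin_zero, Real.sin_pi]
    push_cast
    have : (k:ℝ) + 2 ≠ 0 := by positivity
    rw [← ih]
    field_simp
    ring

lemma LL_poly (q : Polynomial ℝ) :
    LL (fun x => q.eval x) = 2 * Real.pi * ∫ y in (0:ℝ)..1, q.eval y := by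
  induction q using Polynomial.induction_on' with
  | add p q hp hq =>
    simp only [Polynomial.eval_add]
    rw [LL_add (by fun_prop) (by fun_prop), hp, hq, intervalIntegral.integral_add]
    · ring
    · exact Continuous.intervalIntegrable (by fun_prop) _ _
    · exact Continuous.intervalIntegrable (by fun_prop) _ _
  | monomial k a =>
    simp only [Polynomial.eval_monomial]
    rw [intervalIntegral.integral_const_mul, integral_pow, ← wallis_prod k]
    unfold LL
    have : ∀ φ θ : ℝ, Real.sin θ * (a * (Real.sin φ * Real.sin θ) ^ k)
      = (a * Real.sin φ ^ k) * Real.sin θ ^ (k+1) := by intros; rw [mul_pow]; ring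
    simp only [this, intervalIntegral.integral_const_mul, intervalIntegral.integral_mul_const]
    have : (k:ℝ) + 1 ≠ 0 := by positivity
    simp
    field_simp

lemma LL_eq {f : ℝ → ℝ} (hf : Continuous f) : LL f = 2 * Real.pi * ∫ y in (0:ℝ)..1, f y := by
  have hpi := Real.pi_pos
  have key : ∀ ε > 0, |LL f - 2 * Real.pi * ∫ y in (0:ℝ)..1, f y| ≤ ε * (Real.pi * Real.pi + 2 * Real.pi) := by
    intro ε hε
    obtain ⟨q, hq⟩ := exists_polynomial_near_of_continuousOn 0 1 f hf.continuousOn ε hε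
    have h1 : LL f = LL (fun x => q.eval x) + LL (fun x => f x - q.eval x) := by
      rw [← LL_add (by fun_prop) (by fun_prop)]; congr 1; ext x; ring
    have h2 : |LL (fun x => f x - q.eval x)| ≤ ε * Real.pi * Real.pi := by
      apply LL_bound
      intro y hy
      rw [abs_sub_comm]; exact (hq y hy).le
    have h3 : |(∫ y in (0:ℝ)..1, q.eval y) - ∫ y in (0:ℝ)..1, f y| ≤ ε := by
      rw [← intervalIntegral.integral_sub
        (Continuous.intervalIntegrable (by fun_prop) _ _)
        (Continuous.intervalIntegrable (by fun_prop) _ _)]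
      have := intervalIntegral.norm_integral_le_of_norm_le_const (a := 0) (b := 1) (C := ε)
        (f := fun y => q.eval y - f y) ?_
      · simpa using this
      intro y hy
      rw [uIoc_of_le zero_le_one] at hy
      exact (hq y ⟨hy.1.le, hy.2⟩).le
    rw [h1, LL_poly]
    have h4 : 2 * Real.pi * (∫ y in (0:ℝ)..1, q.eval y) + LL (fun x => f x - q.eval x)
      - 2 * Real.pi * (∫ y in (0:ℝ)..1, f y)
      = LL (fun x => f x - q.eval x)
      + 2 * Real.pi * ((∫ y in (0:ℝ)..1, q.eval y) - ∫ y in (0:ℝ)..1, f y) := by ring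
    rw [h4]
    refine (abs_add_le _ _).trans ?_
    rw [abs_mul, abs_of_pos (by positivity : 0 < 2 * Real.pi)]
    nlinarith
  by_contra hne
  have hpos : 0 < |LL f - 2 * Real.pi * ∫ y in (0:ℝ)..1, f y| := abs_pos.2 (sub_ne_zero.2 hne)
  have hD : 0 < Real.pi * Real.pi + 2 * Real.pi := by positivity
  have := key (|LL f - 2 * Real.pi * ∫ y in (0:ℝ)..1, f y| / (2 * (Real.pi * Real.pi + 2 * Real.pi))) (by positivity)
  rw [div_mul_eq_mul_div, le_div_iff₀ (by positivity)] at this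
  nlinarith

/-- Green-type function. -/
def GG (x a : ℝ) : ℝ := if a < x then Real.log ((x + Real.sqrt (x^2 - a^2)) / a) else 0

def ind (x a φ : ℝ) : ℝ := if a < x * Real.sin φ then (Real.sin φ)⁻¹ else 0

lemma ind_integrable (x a : ℝ) (ha : 0 < a) (hx : 0 < x) :
    IntervalIntegrable (ind x a) volume 0 Real.pi := by
  have hm : Measurable (ind x a) := by
    unfold ind
    apply Measurable.ite
    · exact measurableSet_lt measurable_const (by fun_prop)
    · exact (Real.measurable_sin).inv
    · fun_prop
  refine (intervalIntegrable_const (c := x / a)).mono_fun hm.aestronglyMeasurable ?_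
  refine Eventually.of_forall fun φ => ?_
  unfold ind
  beta_reduce
  split_ifs with h
  · have hs : 0 < Real.sin φ := by
      by_contra hc; push Not at hc; nlinarith
    rw [Real.norm_of_nonneg (by positivity), Real.norm_of_nonneg (by positivity),
      inv_le_comm₀ hs (by positivity), inv_div, div_le_iff₀ hx]
    linarith
  · simp; positivity

lemma ind_nonneg (x a φ : ℝ) (ha : 0 < a) (hx : 0 < x) : 0 ≤ ind x a φ := by
  unfold ind
  split_ifs with h
  · have hs : 0 < Real.sin φ := by
      by_contra hc; push Not at hc; nlinarith
    positivity
  · exact le_rfl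

lemma GG_le (x a : ℝ) (ha : 0 < a) (hx : 0 < x) :
    2 * GG x a ≤ ∫ φ in (0:ℝ)..Real.pi, ind x a φ := by
  have hpi := Real.pi_pos
  unfold GG
  split_ifs with h
  swap
  · rw [mul_zero]
    exact intervalIntegral.integral_nonneg hpi.le (fun φ _ => ind_nonneg x a φ ha hx)
  set b := Real.arcsin (a / x) with hb
  have hy0 : 0 < a / x := by positivity
  have hy1 : a / x < 1 := by rw [div_lt_one hx]; exact h
  have hb0 : 0 < b := Real.arcsin_pos.2 hy0
  have hb1 : b < Real.pi / 2 := Real.arcsin_lt_pi_div_two.2 hy1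
  have hsb : Real.sin b = a / x := Real.sin_arcsin (by linarith) hy1.le
  have hcb : Real.cos b = Real.sqrt (1 - (a/x)^2) := Real.cos_arcsin _
  have hsub : ∫ φ in b..(Real.pi - b), ind x a φ ≤ ∫ φ in (0:ℝ)..Real.pi, ind x a φ := by
    apply intervalIntegral.integral_mono_interval hb0.le (by linarith) (by linarith)
    · exact Eventually.of_forall fun φ => ind_nonneg x a φ ha hx
    · exact ind_integrable x a ha hx
  refine le_trans (le_of_eq ?_) hsub
  have hspos : ∀ φ ∈ Icc b (Real.pi - b), 0 < Real.sin φ := fun φ hφ =>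
    Real.sin_pos_of_pos_of_lt_pi (by linarith [hφ.1]) (by linarith [hφ.2])
  have h1 : ∫ φ in b..(Real.pi - b), ind x a φ = ∫ φ in b..(Real.pi - b), (Real.sin φ)⁻¹ := by
    rw [intervalIntegral.integral_of_le (by linarith), intervalIntegral.integral_of_le (by linarith),
      integral_Ioc_eq_integral_Ioo, integral_Ioc_eq_integral_Ioo]
    apply setIntegral_congr_fun measurableSet_Ioo
    intro φ hφ
    have : a / x < Real.sin φ := by
      rw [← hsb]
      rcases le_or_gt φ (Real.pi / 2) with hc | hc
      · exact Real.sin_lt_sin_of_lt_of_le_pi_div_two (by linarith) hc hφ.1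
      · rw [← Real.sin_pi_sub φ]
        exact Real.sin_lt_sin_of_lt_of_le_pi_div_two (by linarith) (by linarith) (by linarith [hφ.2])
    rw [div_lt_iff₀ hx, mul_comm] at this
    simp [ind, this]
  have h2 : ∫ φ in b..(Real.pi - b), (Real.sin φ)⁻¹ =
      (Real.log (Real.sin (Real.pi - b)) - Real.log (1 + Real.cos (Real.pi - b)))
      - (Real.log (Real.sin b) - Real.log (1 + Real.cos b)) := by
    have hII : uIcc b (Real.pi - b) = Icc b (Real.pi - b) := uIcc_of_le (by linarith)
    apply intervalIntegral.integral_eq_sub_of_hasDerivAt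
      (f := fun φ => Real.log (Real.sin φ) - Real.log (1 + Real.cos φ))
    · intro φ hφ
      rw [hII] at hφ
      have hs := hspos φ hφ
      have hc : 0 < 1 + Real.cos φ := by
        have := Real.sin_sq_add_cos_sq φ
        nlinarith [Real.neg_one_le_cos φ, Real.cos_le_one φ]
      have := ((Real.hasDerivAt_sin φ).log hs.ne').sub
        (((Real.hasDerivAt_cos φ).const_add 1).log hc.ne')
      convert! this using 1
      have := Real.sin_sq_add_cos_sq φ
      field_simp
      linear_combination -this
    · apply ContinuousOn.intervalIntegrable
      rw [hII]
      exact Real.continuous_sin.continuousOn.inv₀ (fun φ hφ => (hspos φ hφ).ne')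
  rw [h1, h2, Real.sin_pi_sub, Real.cos_pi_sub, hsb, hcb]
  have hr0 : 0 < 1 - (a/x)^2 := by nlinarith
  have hr1 : Real.sqrt (1 - (a/x)^2) < 1 := by
    rw [Real.sqrt_lt' one_pos]; nlinarith [sq_pos_of_pos hy0]
  have hsq := Real.sq_sqrt hr0.le
  have hs0 : 0 < Real.sqrt (1 - (a/x)^2) := Real.sqrt_pos.2 hr0
  have e1 : Real.sqrt (x^2 - a^2) = x * Real.sqrt (1 - (a/x)^2) := by
    rw [show x^2 - a^2 = x^2 * (1 - (a/x)^2) by field_simp, Real.sqrt_mul (by positivity),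
      Real.sqrt_sq hx.le]
  rw [e1]
  set c := Real.sqrt (1 - (a/x)^2) with hc
  have e2 : (x + x * c) / a = (1 + c) / (a / x) := by field_simp
  rw [e2, Real.log_div (by positivity) hy0.ne']
  have e3 : Real.log (1 + -c) + Real.log (1 + c) = 2 * Real.log (a/x) := by
    rw [← Real.log_mul (by linarith) (by linarith)]
    rw [show (1 + -c) * (1 + c) = (a/x)^2 by linear_combination -hsq, Real.log_pow]
    norm_num
  linarith

def nn (Q' : ℝ → ℝ) (r : ℝ) : ℝ :=
  (1 / Real.pi) * ∫ θ in (0:ℝ)..Real.pi, (r * Real.sin θ) * Q' (r * Real.sin θ)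

def AA (Q : ℝ → ℝ) (r : ℝ) : ℝ :=
  (1 / Real.pi) * ∫ θ in (0:ℝ)..Real.pi, Q (r * Real.sin θ)

lemma int_sin_half {f : ℝ → ℝ} (hf : Continuous f) :
    ∫ θ in (0:ℝ)..Real.pi, f (Real.sin θ) = 2 * ∫ θ in (0:ℝ)..(Real.pi/2), f (Real.sin θ) := by
  rw [← intervalIntegral.integral_add_adjacent_intervals (b := Real.pi/2)
    (Continuous.intervalIntegrable (by fun_prop) _ _)
    (Continuous.intervalIntegrable (by fun_prop) _ _)]
  have := intervalIntegral.integral_comp_sub_left (fun θ => f (Real.sin θ)) (a := 0) (b := Real.pi/2) Real.pi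
  simp only [Real.sin_pi_sub, sub_zero] at this
  rw [show Real.pi - Real.pi/2 = Real.pi/2 by ring] at this
  rw [← this]; ring

lemma int_subst (g : ℝ → ℝ) :
    ∫ t in (0:ℝ)..1, g t / Real.sqrt (1 - t^2) = ∫ θ in (0:ℝ)..(Real.pi/2), g (Real.sin θ) := by
  have hpi := Real.pi_pos
  rw [intervalIntegral.integral_of_le zero_le_one, intervalIntegral.integral_of_le (by positivity),
    integral_Ioc_eq_integral_Ioo, integral_Ioc_eq_integral_Ioo]
  have himg : Ioo (0:ℝ) 1 = Real.sin '' Ioo 0 (Real.pi/2) := by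
    ext y; constructor
    · intro hy
      exact ⟨Real.arcsin y, ⟨Real.arcsin_pos.2 hy.1, Real.arcsin_lt_pi_div_two.2 hy.2⟩,
        Real.sin_arcsin (by linarith [hy.1]) hy.2.le⟩
    · rintro ⟨θ, hθ, rfl⟩
      refine ⟨Real.sin_pos_of_pos_of_lt_pi hθ.1 (by linarith [hθ.2]), ?_⟩
      rw [← Real.sin_pi_div_two]
      exact Real.sin_lt_sin_of_lt_of_le_pi_div_two (by linarith [hθ.1]) le_rfl hθ.2
  rw [himg, integral_image_eq_integral_abs_deriv_smul measurableSet_Ioo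
    (fun x _ => (Real.hasDerivAt_sin x).hasDerivWithinAt)]
  · apply setIntegral_congr_fun measurableSet_Ioo
    intro θ hθ
    have hc : 0 < Real.cos θ := Real.cos_pos_of_mem_Ioo ⟨by linarith [hθ.1], hθ.2⟩
    have : Real.sqrt (1 - Real.sin θ ^2) = Real.cos θ := by
      rw [← Real.cos_sq', Real.sqrt_sq hc.le]
    simp only [this, smul_eq_mul, abs_of_pos hc]
    field_simp
  · intro x hx y hy hxy
    exact Real.injOn_sin ⟨by linarith [hx.1], hx.2.le⟩ ⟨by linarith [hy.1], hy.2.le⟩ hxy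

lemma nn_eq {Q' : ℝ → ℝ} (hc : Continuous Q') (a : ℝ) :
    (2 / Real.pi) * ∫ t in (0:ℝ)..1, a * t * Q' (a * t) / Real.sqrt (1 - t ^ 2) = nn Q' a := by
  rw [int_subst (fun t => a * t * Q' (a * t)), nn,
    int_sin_half (f := fun t => a * t * Q' (a * t)) (by fun_prop)]
  ring

lemma h_mono {Q' : ℝ → ℝ} (hm : Monotone Q') (h0 : Q' 0 = 0) {u v : ℝ} (hu : 0 ≤ u) (huv : u ≤ v) :
    u * Q' u ≤ v * Q' v := by
  have h1 : 0 ≤ Q' u := h0 ▸ hm hu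
  exact mul_le_mul huv (hm huv) h1 (hu.trans huv)

lemma nn_mono {Q' : ℝ → ℝ} (hc : Continuous Q') (hm : Monotone Q') (h0 : Q' 0 = 0) {r s : ℝ}
    (hr : 0 ≤ r) (hrs : r ≤ s) : nn Q' r ≤ nn Q' s := by
  have hpi := Real.pi_pos
  unfold nn
  apply mul_le_mul_of_nonneg_left _ (by positivity)
  apply intervalIntegral.integral_mono_on hpi.le
    (Continuous.intervalIntegrable (by fun_prop) _ _)
    (Continuous.intervalIntegrable (by fun_prop) _ _)
  intro θ hθ
  have h1 : 0 ≤ Real.sin θ := Real.sin_nonneg_of_nonneg_of_le_pi hθ.1 hθ.2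
  exact h_mono hm h0 (by positivity) (by gcongr)

lemma nn_nonneg {Q' : ℝ → ℝ} (hc : Continuous Q') (hm : Monotone Q') (h0 : Q' 0 = 0) {r : ℝ}
    (hr : 0 ≤ r) : 0 ≤ nn Q' r := by
  have := nn_mono hc hm h0 le_rfl hr
  simpa [nn] using this

lemma a_mono {Q' : ℝ → ℝ} (hc : Continuous Q') (hm : Monotone Q') (h0 : Q' 0 = 0) {a : ℕ → ℝ}
    (ha : ∀ n, 1 ≤ n → 0 < a n ∧ nn Q' (a n) = n) {i j : ℕ} (hi : 1 ≤ i) (hij : i ≤ j) :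
    a i ≤ a j := by
  rcases hij.eq_or_lt with rfl | hlt
  · exact le_rfl
  by_contra hcon
  push Not at hcon
  have := nn_mono hc hm h0 (ha j (by omega)).1.le hcon.le
  rw [(ha i hi).2, (ha j (by omega)).2] at this
  have : j ≤ i := by exact_mod_cast this
  omega

lemma sum_GG_le {Q Q' : ℝ → ℝ} (hd : ∀ x, HasDerivAt Q (Q' x) x) (hQ0 : Q 0 = 0)
    (hc : Continuous Q') (hm : Monotone Q') (h0 : Q' 0 = 0) {a : ℕ → ℝ}
    (ha : ∀ n, 1 ≤ n → 0 < a n ∧ nn Q' (a n) = n) (N : ℕ) {x : ℝ} (hx : 0 < x) :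
    ∑ i ∈ Finset.Icc 1 N, GG x (a i) ≤ Q x := by
  have hpi := Real.pi_pos
  have hG : ∑ i ∈ Finset.Icc 1 N, 2 * GG x (a i)
      ≤ ∑ i ∈ Finset.Icc 1 N, ∫ φ in (0:ℝ)..Real.pi, ind x (a i) φ :=
    Finset.sum_le_sum fun i hi => GG_le x (a i) (ha i (Finset.mem_Icc.1 hi).1).1 hx
  have hint : ∀ i ∈ Finset.Icc 1 N, IntervalIntegrable (ind x (a i)) volume 0 Real.pi :=
    fun i hi => ind_integrable x (a i) (ha i (Finset.mem_Icc.1 hi).1).1 hx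
  rw [← Finset.mul_sum, ← intervalIntegral.integral_finsetSum hint] at hG
  have hf : Continuous (fun y => x * Q' (x * y)) := by fun_prop
  have hle : ∫ φ in (0:ℝ)..Real.pi, ∑ i ∈ Finset.Icc 1 N, ind x (a i) φ
      ≤ ∫ φ in (0:ℝ)..Real.pi, (1/Real.pi) * ∫ θ in (0:ℝ)..Real.pi,
          Real.sin θ * (x * Q' (x * (Real.sin φ * Real.sin θ))) := by
    apply intervalIntegral.integral_mono_on_of_le_Ioo hpi.le
    · have := IntervalIntegrable.sum _ hint
      rwa [Finset.sum_fn] at this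
    · exact (continuous_const.mul (LL_inner_cont hf)).intervalIntegrable _ _
    intro φ hφ
    have hs : 0 < Real.sin φ := Real.sin_pos_of_pos_of_lt_pi hφ.1 hφ.2
    have e1 : (1/Real.pi) * ∫ θ in (0:ℝ)..Real.pi,
          Real.sin θ * (x * Q' (x * (Real.sin φ * Real.sin θ))) = nn Q' (x * Real.sin φ) * (Real.sin φ)⁻¹ := by
      unfold nn
      rw [mul_assoc, ← intervalIntegral.integral_mul_const]
      congr 2
      ext θ
      rw [mul_assoc x]
      field_simp
    rw [e1]
    have e2 : ∑ i ∈ Finset.Icc 1 N, ind x (a i) φ =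
        (((Finset.Icc 1 N).filter (fun i => a i < x * Real.sin φ)).card : ℝ) * (Real.sin φ)⁻¹ := by
      unfold ind
      rw [← Finset.sum_filter, Finset.sum_const, nsmul_eq_mul]
    rw [e2]
    apply mul_le_mul_of_nonneg_right _ (by positivity)
    set S := (Finset.Icc 1 N).filter (fun i => a i < x * Real.sin φ) with hS
    rcases S.eq_empty_or_nonempty with he | hne
    · rw [he]; simp; exact nn_nonneg hc hm h0 (by positivity)
    · obtain ⟨hM1, hM2⟩ := Finset.mem_filter.1 (S.max'_mem hne)
      have hM1' := (Finset.mem_Icc.1 hM1).1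
      have hcard : S.card ≤ S.max' hne := by
        have : S ⊆ Finset.Icc 1 (S.max' hne) := fun i hi =>
          Finset.mem_Icc.2 ⟨(Finset.mem_Icc.1 (Finset.mem_filter.1 hi).1).1, S.le_max' i hi⟩
        simpa using Finset.card_le_card this
      have := nn_mono hc hm h0 (ha _ hM1').1.le hM2.le
      rw [(ha _ hM1').2] at this
      exact le_trans (by exact_mod_cast hcard) this
  rw [intervalIntegral.integral_const_mul] at hle
  have hLL := LL_eq hf
  unfold LL at hLL
  rw [hLL] at hle
  have hFTC : ∫ y in (0:ℝ)..1, x * Q' (x * y) = Q x := by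
    have := intervalIntegral.integral_eq_sub_of_hasDerivAt (f := fun y => Q (x * y))
      (f' := fun y => x * Q' (x * y)) (a := 0) (b := 1) ?_ (hf.intervalIntegrable _ _)
    · simpa [hQ0] using this
    intro y _
    have := (hd (x * y)).comp y ((hasDerivAt_id y).const_mul x)
    simpa [Function.comp_def, mul_comm] using this
  rw [hFTC] at hle
  have : 1 / Real.pi * (2 * Real.pi * Q x) = 2 * Q x := by field_simp
  linarith

lemma AA_sub_le {Q Q' : ℝ → ℝ} (hd : ∀ x, HasDerivAt Q (Q' x) x)
    (hc : Continuous Q') (hm : Monotone Q') (h0 : Q' 0 = 0) {a b : ℝ} (ha : 0 < a) (hab : a ≤ b) :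
    AA Q b - AA Q a ≤ nn Q' b * Real.log (b / a) := by
  have hpi := Real.pi_pos
  have hQc : Continuous Q := continuous_iff_continuousAt.2 fun x => (hd x).continuousAt
  have hb : 0 < b := ha.trans_le hab
  unfold AA nn
  rw [← mul_sub, ← intervalIntegral.integral_sub
    (Continuous.intervalIntegrable (by fun_prop) _ _)
    (Continuous.intervalIntegrable (by fun_prop) _ _), mul_assoc, ← intervalIntegral.integral_mul_const]
  apply mul_le_mul_of_nonneg_left _ (by positivity)
  apply intervalIntegral.integral_mono_on hpi.le
    (Continuous.intervalIntegrable (by fun_prop) _ _)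
    (Continuous.intervalIntegrable (by fun_prop) _ _)
  intro θ hθ
  have h1 : 0 ≤ Real.sin θ := Real.sin_nonneg_of_nonneg_of_le_pi hθ.1 hθ.2
  set s := Real.sin θ
  have hder : ∀ u, HasDerivAt (fun u => Q (Real.exp u * s)) (Real.exp u * s * Q' (Real.exp u * s)) u := by
    intro u
    have := (hd (Real.exp u * s)).comp u ((Real.hasDerivAt_exp u).mul_const s)
    simpa [Function.comp_def, mul_comm] using this
  have hl : Real.log a ≤ Real.log b := Real.log_le_log ha hab
  have := Convex.image_sub_le_mul_sub_of_deriv_le (convex_Icc (Real.log a) (Real.log b))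
    (f := fun u => Q (Real.exp u * s)) (C := b * s * Q' (b * s))
    (fun u _ => (hder u).continuousAt.continuousWithinAt)
    (fun u _ => (hder u).differentiableAt.differentiableWithinAt) ?_
    (Real.log a) ⟨le_rfl, hl⟩ (Real.log b) ⟨hl, le_rfl⟩ hl
  · rw [Real.log_div hb.ne' ha.ne']
    simpa [Real.exp_log ha, Real.exp_log hb] using this
  · intro u hu
    rw [interior_Icc] at hu
    rw [(hder u).deriv]
    have : Real.exp u ≤ b := by
      rw [← Real.exp_log hb]; exact Real.exp_le_exp.2 hu.2.le
    exact h_mono hm h0 (by positivity) (by gcongr)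

lemma AA_sum {Q Q' : ℝ → ℝ} (hd : ∀ x, HasDerivAt Q (Q' x) x)
    (hc : Continuous Q') (hm : Monotone Q') (h0 : Q' 0 = 0) {a : ℕ → ℝ}
    (ha : ∀ n, 1 ≤ n → 0 < a n ∧ nn Q' (a n) = n) (n : ℕ) (hn : 1 ≤ n) :
    AA Q (a n) + ∑ i ∈ Finset.Icc 1 n, Real.log (a i) ≤
      (AA Q (a 1) - Real.log (a 1)) + (n + 1) * Real.log (a n) := by
  induction n, hn using Nat.le_induction with
  | base => simp; linarith
  | succ n hn ih =>
    rw [Finset.sum_Icc_succ_top (by omega)]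
    have h1 := AA_sub_le hd hc hm h0 (ha n hn).1 (a_mono hc hm h0 ha hn (Nat.le_succ n))
    rw [(ha (n+1) (by omega)).2, Real.log_div (ha (n+1) (by omega)).1.ne' (ha n hn).1.ne'] at h1
    push_cast at h1 ⊢
    nlinarith

lemma exp_GG {x a : ℝ} (ha : 0 < a) (h : a < x) :
    Real.exp (GG x a) = (x + Real.sqrt (x^2 - a^2)) / a := by
  have hx : 0 < x := ha.trans h
  rw [GG, if_pos h, Real.exp_log]
  have := Real.sqrt_nonneg (x^2 - a^2)
  positivity

lemma GG_nonneg {x a : ℝ} (ha : 0 < a) : 0 ≤ GG x a := by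
  unfold GG
  split_ifs with h
  · apply Real.log_nonneg
    rw [le_div_iff₀ ha]
    have := Real.sqrt_nonneg (x^2 - a^2)
    linarith
  · exact le_rfl

lemma GG_anti {x a b : ℝ} (ha : 0 < a) (hab : a ≤ b) : GG x b ≤ GG x a := by
  by_cases h : b < x
  · have h' : a < x := hab.trans_lt h
    have hx : 0 < x := ha.trans h'
    rw [← Real.exp_le_exp, exp_GG (ha.trans_le hab) h, exp_GG ha h']
    gcongr
  · rw [GG, if_neg h]
    exact GG_nonneg ha

lemma cheb_bound (d : ℕ) {r : ℝ} (hr : 0 < r) (x : ℝ) :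
    |(Polynomial.Chebyshev.T ℝ d).eval (r⁻¹ * x)| ≤ Real.exp (d * GG |x| r) := by
  by_cases h : r < |x|
  · have hx : 0 < |x| := hr.trans h
    have hE := exp_GG hr h
    have e1 : |(Polynomial.Chebyshev.T ℝ d).eval (r⁻¹ * x)| =
        |(Polynomial.Chebyshev.T ℝ d).eval (r⁻¹ * |x|)| := by
      rcases abs_cases x with ⟨h1, _⟩ | ⟨h1, _⟩
      · rw [h1]
      · rw [h1, mul_neg, Polynomial.Chebyshev.T_eval_neg, abs_mul]
        rcases Int.even_or_odd (d:ℤ) with h | h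
        · rw [Int.negOnePow_even _ h]; simp
        · rw [Int.negOnePow_odd _ h]; simp
    have e2 : r⁻¹ * |x| = Real.cosh (GG |x| r) := by
      rw [Real.cosh_eq, Real.exp_neg, hE]
      have h2 : 0 ≤ |x|^2 - r^2 := by nlinarith
      have h3 := Real.sq_sqrt h2
      have h4 := Real.sqrt_nonneg (|x|^2 - r^2)
      have h5 : 0 < |x| + Real.sqrt (|x|^2 - r^2) := by positivity
      set c := Real.sqrt (|x|^2 - r^2)
      field_simp
      linear_combination -h3
    rw [e1, e2, Polynomial.Chebyshev.T_real_cosh, abs_of_pos (Real.cosh_pos _), Real.cosh_eq]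
    have h0 : 0 ≤ (d:ℝ) * GG |x| r := mul_nonneg (by positivity) (GG_nonneg hr)
    have : Real.exp (-((d:ℝ) * GG |x| r)) ≤ Real.exp ((d:ℝ) * GG |x| r) := Real.exp_le_exp.2 (by linarith)
    push_cast
    linarith
  · have : |r⁻¹ * x| ≤ 1 := by
      rw [abs_mul, abs_of_pos (inv_pos.2 hr), inv_mul_le_iff₀ hr]
      linarith
    refine (Polynomial.Chebyshev.abs_eval_T_real_le_one d this).trans ?_
    rw [GG, if_neg h]; simp

lemma cheb_exists (d : ℕ) {r : ℝ} (hr : 0 < r) : ∃ P : Polynomial ℝ, P.Monic ∧ P.natDegree = d ∧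
    ∀ x, |P.eval x| ≤ 2 * ((1/2)^d * r^d) * Real.exp (d * GG |x| r) := by
  rcases Nat.eq_zero_or_pos d with rfl | hd
  · exact ⟨1, Polynomial.monic_one, by simp, fun x => by simp⟩
  have hq : (Polynomial.C r⁻¹ * Polynomial.X : Polynomial ℝ).natDegree = 1 :=
    Polynomial.natDegree_C_mul_X _ (inv_ne_zero hr.ne')
  have hk : 2 * ((1/2:ℝ)^d * r^d) ≠ 0 := by positivity
  refine ⟨Polynomial.C (2 * ((1/2)^d * r^d)) *
    (Polynomial.Chebyshev.T ℝ d).comp (Polynomial.C r⁻¹ * Polynomial.X), ?_, ?_, ?_⟩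
  · rw [Polynomial.Monic, Polynomial.leadingCoeff_mul, Polynomial.leadingCoeff_C,
      Polynomial.leadingCoeff_comp (by rw [hq]; exact one_ne_zero), Polynomial.Chebyshev.leadingCoeff_T,
      Polynomial.Chebyshev.natDegree_T, Polynomial.leadingCoeff_C_mul_X]
    obtain ⟨e, rfl⟩ := Nat.exists_eq_add_of_le' hd
    simp only [Int.natAbs_natCast, Nat.add_sub_cancel]
    rw [inv_pow]
    field_simp
    have h12 : (1/2:ℝ)^e * 2^e = 1 := by rw [← mul_pow]; norm_num
    rw [pow_succ]
    linear_combination h12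
  · rw [Polynomial.natDegree_C_mul hk, Polynomial.natDegree_comp, hq, Polynomial.Chebyshev.natDegree_T]
    simp
  · intro x
    rw [Polynomial.eval_mul, Polynomial.eval_C, Polynomial.eval_comp, abs_mul, abs_of_pos (by positivity)]
    apply mul_le_mul_of_nonneg_left _ (by positivity)
    simpa using cheb_bound d hr x

lemma block_exists {a : ℕ → ℝ} (hpos : ∀ n, 1 ≤ n → 0 < a n)
    (hmono : ∀ i j, 1 ≤ i → i ≤ j → a i ≤ a j) (k : ℕ) (hk : 1 ≤ k) (n : ℕ) :
    ∃ P : Polynomial ℝ, P.Monic ∧ P.natDegree = n ∧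
    ∀ x, |P.eval x| ≤ 2^(n/k+1) * ((1/2)^n * ∏ i ∈ Finset.range n, a (i+1+k)) *
      Real.exp (∑ i ∈ Finset.range n, GG |x| (a (i+1))) := by
  induction n using Nat.strong_induction_on with
  | _ n ih =>
  rcases lt_or_ge n k with hnk | hnk
  · obtain ⟨P, h1, h2, h3⟩ := cheb_exists n (hpos k hk)
    refine ⟨P, h1, h2, fun x => (h3 x).trans ?_⟩
    rw [Nat.div_eq_of_lt hnk]
    have e1 : a k ^ n ≤ ∏ i ∈ Finset.range n, a (i+1+k) := by
      rw [← Finset.card_range n, ← Finset.prod_const, Finset.card_range]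
      exact Finset.prod_le_prod (fun i _ => (hpos k hk).le) (fun i _ => hmono _ _ hk (by omega))
    have e2 : (n:ℝ) * GG |x| (a k) ≤ ∑ i ∈ Finset.range n, GG |x| (a (i+1)) := by
      have := Finset.card_nsmul_le_sum (Finset.range n) (fun i => GG |x| (a (i+1))) (GG |x| (a k))
        (fun i hi => GG_anti (hpos _ (by omega)) (hmono _ _ (by omega) (by have := Finset.mem_range.1 hi; omega)))
      simpa using this
    have := pow_pos (hpos k hk) n
    have h00 := this.le.trans e1
    simp only [zero_add, pow_one]
    gcongr
  · obtain ⟨m, rfl⟩ := Nat.exists_eq_add_of_le' hnk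
    obtain ⟨P, h1, h2, h3⟩ := ih m (by omega)
    have hr := hpos (m+k) (by omega)
    obtain ⟨R, g1, g2, g3⟩ := cheb_exists k hr
    refine ⟨P * R, h1.mul g1, by rw [h1.natDegree_mul g1, h2, g2], fun x => ?_⟩
    rw [Polynomial.eval_mul, abs_mul]
    have hP0 : 0 ≤ 2^(m/k+1) * ((1/2:ℝ)^m * ∏ i ∈ Finset.range m, a (i+1+k)) := by
      have : 0 ≤ ∏ i ∈ Finset.range m, a (i+1+k) := Finset.prod_nonneg fun i _ => (hpos _ (by omega)).le
      positivity
    refine (mul_le_mul (h3 x) (g3 x) (abs_nonneg _) (by positivity)).trans ?_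
    rw [Nat.add_div_right _ (by omega), Finset.prod_range_add, Finset.sum_range_add, Real.exp_add]
    have e1 : a (m+k) ^ k ≤ ∏ i ∈ Finset.range k, a (m+i+1+k) := by
      have : a (m+k) ^ k = ∏ i ∈ Finset.range k, a (m+k) := by simp
      rw [this]
      exact Finset.prod_le_prod (fun i _ => hr.le) (fun i _ => hmono _ _ (by omega) (by omega))
    have e2 : (k:ℝ) * GG |x| (a (m+k)) ≤ ∑ i ∈ Finset.range k, GG |x| (a (m+i+1)) := by
      have := Finset.card_nsmul_le_sum (Finset.range k) (fun i => GG |x| (a (m+i+1))) (GG |x| (a (m+k)))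
        (fun i hi => GG_anti (hpos _ (by omega)) (hmono _ _ (by omega) (by have := Finset.mem_range.1 hi; omega)))
      simpa using this
    calc _ = (2^(m/k+1) * ((1/2)^m * ∏ i ∈ Finset.range m, a (i+1+k))) *
          Real.exp (∑ i ∈ Finset.range m, GG |x| (a (i+1))) * (2 * (1/2)^k) *
          (a (m+k)^k * Real.exp (k * GG |x| (a (m+k)))) := by ring
      _ ≤ (2^(m/k+1) * ((1/2)^m * ∏ i ∈ Finset.range m, a (i+1+k))) *
          Real.exp (∑ i ∈ Finset.range m, GG |x| (a (i+1))) * (2 * (1/2)^k) *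
          ((∏ i ∈ Finset.range k, a (m+i+1+k)) * Real.exp (∑ i ∈ Finset.range k, GG |x| (a (m+i+1)))) := by
        have := pow_pos hr k
        have h00 := this.le.trans e1
        gcongr
      _ = _ := by rw [pow_succ 2 (m/k).succ, pow_add]; ring

lemma sum_Icc_range (f : ℕ → ℝ) (n : ℕ) : ∑ i ∈ Finset.Icc 1 n, f i = ∑ i ∈ Finset.range n, f (i+1) := by
  induction n with
  | zero => simp
  | succ n ih => rw [Finset.sum_Icc_succ_top (by omega), Finset.sum_range_succ, ih]

lemma exp_neg_GG {x b : ℝ} (hb : 0 < b) : Real.exp (-GG |x| b)^2 ≤ 2 * (1 + (x/b)^2)⁻¹ := by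
  rw [← div_eq_mul_inv, le_div_iff₀ (by positivity)]
  by_cases h : b < |x|
  · have hx : 0 < |x| := hb.trans h
    have h2 := Real.sqrt_nonneg (|x|^2 - b^2)
    have h1 : Real.exp (-GG |x| b) ≤ b / |x| := by
      rw [Real.exp_neg, exp_GG hb h, inv_div]
      gcongr
      linarith
    have h3 : Real.exp (-GG |x| b)^2 ≤ (b/|x|)^2 := by gcongr
    have h4 : (b/|x|)^2 * (1 + (x/b)^2) = (b/|x|)^2 + 1 := by
      rw [← sq_abs (x/b), abs_div, abs_of_pos hb]; field_simp
    have h5 : (b/|x|)^2 ≤ 1 := by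
      apply pow_le_one₀ (by positivity)
      rw [div_le_one hx]; exact h.le
    calc _ ≤ (b/|x|)^2 * (1 + (x/b)^2) := by gcongr
      _ ≤ 2 := by linarith
  · rw [GG, if_neg h]
    have : (x/b)^2 ≤ 1 := by
      rw [← sq_abs, abs_div, abs_of_pos hb]
      apply pow_le_one₀ (by positivity)
      rw [div_le_one hb]; linarith
    simp; linarith

lemma span_p {p : ℕ → Polynomial ℝ} (h1 : ∀ j, (p j).natDegree = j)
    (h2 : ∀ j, 0 < (p j).leadingCoeff) (n : ℕ) (R : Polynomial ℝ) (hR : R.degree < n) :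
    ∃ c : ℕ → ℝ, R = ∑ j ∈ Finset.range n, Polynomial.C (c j) * p j := by
  induction n generalizing R with
  | zero =>
    refine ⟨0, ?_⟩
    have : R = 0 := by
      rw [← Polynomial.degree_eq_bot]
      by_contra h
      rw [Polynomial.degree_eq_bot] at h
      rw [Polynomial.degree_eq_natDegree h] at hR
      simp at hR
    simp [this]
  | succ n ih =>
    have hdeg : (R - Polynomial.C (R.coeff n / (p n).leadingCoeff) * p n).degree < n := by
      rw [Polynomial.degree_lt_iff_coeff_zero]
      intro m hm
      rw [Polynomial.coeff_sub, Polynomial.coeff_C_mul]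
      rcases hm.eq_or_lt with rfl | hlt
      · have : (p n).coeff n = (p n).leadingCoeff := by rw [Polynomial.leadingCoeff, h1]
        rw [this, div_mul_cancel₀ _ (h2 n).ne', sub_self]
      · have hz : (p n).coeff m = 0 :=
          Polynomial.coeff_eq_zero_of_natDegree_lt (by rw [h1]; exact hlt)
        rw [hz, (Polynomial.degree_lt_iff_coeff_zero _ _).1 hR m (by omega)]
        simp
    obtain ⟨c, hc⟩ := ih _ hdeg
    refine ⟨fun j => if j = n then R.coeff n / (p n).leadingCoeff else c j, ?_⟩
    rw [Finset.sum_range_succ]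
    simp only [if_true]
    rw [Finset.sum_congr rfl (g := fun j => Polynomial.C (c j) * p j)
      (fun j hj => by rw [if_neg (Finset.mem_range.1 hj).ne]), ← hc]
    ring

lemma extremal {W : ℝ → ℝ} (hWc : Continuous W) {p : ℕ → Polynomial ℝ}
    (h1 : ∀ j, (p j).natDegree = j) (h2 : ∀ j, 0 < (p j).leadingCoeff)
    (h3 : ∀ j k, (∫ x : ℝ, (p j).eval x * (p k).eval x * (W x) ^ 2) = if j = k then 1 else 0)
    (n : ℕ) (P : Polynomial ℝ) (hP : P.Monic) (hPn : P.natDegree = n) :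
    1 ≤ (p n).leadingCoeff^2 * ∫ x, (P.eval x)^2 * (W x)^2 := by
  have hdiag : ∀ j, Integrable (fun x => (p j).eval x * (p j).eval x * (W x)^2) := by
    intro j
    by_contra hcon
    have := h3 j j
    rw [integral_undef hcon] at this
    simp at this
  have hint : ∀ j k, Integrable (fun x => (p j).eval x * (p k).eval x * (W x)^2) := by
    intro j k
    refine ((hdiag j).add (hdiag k)).mono' (Continuous.aestronglyMeasurable (by fun_prop)) ?_
    refine Eventually.of_forall fun x => ?_
    simp only [Pi.add_apply, norm_mul, norm_pow, Real.norm_eq_abs, sq_abs]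
    rw [← add_mul]
    apply mul_le_mul_of_nonneg_right _ (sq_nonneg _)
    rw [← abs_mul_abs_self ((p j).eval x), ← abs_mul_abs_self ((p k).eval x)]
    nlinarith [sq_nonneg (|(p j).eval x| - |(p k).eval x|), abs_nonneg ((p j).eval x), abs_nonneg ((p k).eval x)]
  obtain ⟨c, hc⟩ := span_p h1 h2 (n+1) P (by
    rw [Polynomial.degree_eq_natDegree hP.ne_zero, hPn]; exact_mod_cast Nat.lt_succ_self n)
  have hcn : c n * (p n).leadingCoeff = 1 := by
    have hcoeff : P.coeff n = 1 := by rw [← hPn]; exact hP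
    rw [hc, Finset.sum_range_succ, Polynomial.coeff_add, Polynomial.finsetSum_coeff,
      Finset.sum_eq_zero, zero_add, Polynomial.coeff_C_mul] at hcoeff
    · rw [Polynomial.leadingCoeff, h1]; exact hcoeff
    · intro j hj
      rw [Polynomial.coeff_C_mul, Polynomial.coeff_eq_zero_of_natDegree_lt (by rw [h1]; exact Finset.mem_range.1 hj), mul_zero]
  have hsum : ∫ x, (P.eval x)^2 * (W x)^2 = ∑ j ∈ Finset.range (n+1), (c j)^2 := by
    have : ∀ x, (P.eval x)^2 * (W x)^2 = ∑ j ∈ Finset.range (n+1), ∑ k ∈ Finset.range (n+1),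
        c j * c k * ((p j).eval x * (p k).eval x * (W x)^2) := by
      intro x
      conv_lhs => rw [hc]
      rw [Polynomial.eval_finsetSum, sq, Finset.sum_mul_sum, Finset.sum_mul]
      refine Finset.sum_congr rfl fun j _ => ?_
      rw [Finset.sum_mul]
      refine Finset.sum_congr rfl fun k _ => ?_
      simp only [Polynomial.eval_mul, Polynomial.eval_C]; ring
    simp_rw [this]
    rw [integral_finsetSum _ (fun j _ => integrable_finsetSum _ fun k _ => (hint j k).const_mul _)]
    refine Finset.sum_congr rfl fun j hj => ?_
    rw [integral_finsetSum _ (fun k _ => (hint j k).const_mul _)]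
    simp_rw [integral_const_mul, h3]
    simp [Finset.mem_range.1 hj]
    ring
  rw [hsum]
  have : (c n)^2 ≤ ∑ j ∈ Finset.range (n+1), (c j)^2 :=
    Finset.single_le_sum (f := fun j => (c j)^2) (fun j _ => sq_nonneg _) (Finset.self_mem_range_succ n)
  calc 1 = (p n).leadingCoeff^2 * (c n)^2 := by rw [← mul_pow, mul_comm, hcn, one_pow]
    _ ≤ _ := by gcongr

lemma mahler_bound (p : Polynomial ℝ) (n : ℕ) (hn : p.natDegree = n) (hγ : 0 < p.leadingCoeff)
    {a : ℝ} (ha : 0 < a) :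
    IntervalIntegrable (fun θ => Real.log |p.eval (a * Real.cos θ)|) volume 0 Real.pi ∧
    Real.pi * (Real.log p.leadingCoeff + n * Real.log (a/2)) ≤
      ∫ θ in (0:ℝ)..Real.pi, Real.log |p.eval (a * Real.cos θ)| := by
  have hpi := Real.pi_pos
  set B : Polynomial ℂ := Polynomial.C ((a/2 : ℝ) : ℂ) * (Polynomial.X^2 + 1) with hB
  have ha2 : ((a/2:ℝ):ℂ) ≠ 0 := by exact_mod_cast (by positivity : a/2 ≠ 0)
  have hBdeg : B.natDegree = 2 := by
    rw [hB, Polynomial.natDegree_C_mul ha2]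
    exact Polynomial.natDegree_X_pow_add_C (n := 2) (r := (1:ℂ))
  have hBlead : B.leadingCoeff = ((a/2 : ℝ) : ℂ) := by
    rw [hB, Polynomial.leadingCoeff_mul, Polynomial.leadingCoeff_C]
    have : (Polynomial.X^2 + 1 : Polynomial ℂ).leadingCoeff = 1 :=
      Polynomial.leadingCoeff_X_pow_add_C (n := 2) (by norm_num) (r := (1:ℂ))
    rw [this, mul_one]
  set H : Polynomial ℂ := ∑ j ∈ Finset.range (n+1), Polynomial.C ((p.coeff j : ℝ) : ℂ) * B^j * Polynomial.X^(n-j) with hH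
  have htdeg : ∀ j, j ≤ n → (Polynomial.C ((p.coeff j : ℝ) : ℂ) * B^j * Polynomial.X^(n-j)).natDegree ≤ n + j := by
    intro j hj
    refine Polynomial.natDegree_mul_le.trans ?_
    rw [Polynomial.natDegree_X_pow]
    have : (Polynomial.C ((p.coeff j : ℝ) : ℂ) * B^j).natDegree ≤ 2 * j := by
      refine (Polynomial.natDegree_C_mul_le _ _).trans ?_
      rw [Polynomial.natDegree_pow, hBdeg]; omega
    omega
  have hcoef : H.coeff (2*n) = ((p.leadingCoeff * (a/2)^n : ℝ) : ℂ) := by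
    rw [hH, Finset.sum_range_succ, Polynomial.coeff_add, Polynomial.finsetSum_coeff, Finset.sum_eq_zero, zero_add]
    · rw [Nat.sub_self, pow_zero, mul_one, Polynomial.coeff_C_mul]
      have : (B^n).coeff (2*n) = ((a/2:ℝ):ℂ)^n := by
        rw [← hBlead, ← Polynomial.leadingCoeff_pow, Polynomial.leadingCoeff, Polynomial.natDegree_pow, hBdeg, mul_comm]
      rw [this, Polynomial.leadingCoeff, hn]; push_cast; ring
    · intro j hj
      have hj := Finset.mem_range.1 hj
      exact Polynomial.coeff_eq_zero_of_natDegree_lt (by have := htdeg j hj.le; omega)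
  have hval : 0 < p.leadingCoeff * (a/2)^n := by positivity
  have hle : H.natDegree ≤ 2*n := by
    apply Polynomial.natDegree_sum_le_of_forall_le
    intro j hj
    have hj := Finset.mem_range.1 hj
    exact (htdeg j (by omega)).trans (by omega)
  have hdeg : H.natDegree = 2*n := by
    apply Polynomial.natDegree_eq_of_le_of_coeff_ne_zero hle
    rw [hcoef]; exact_mod_cast hval.ne'
  have hlead : H.leadingCoeff = ((p.leadingCoeff * (a/2)^n : ℝ) : ℂ) := by
    rw [Polynomial.leadingCoeff, hdeg, hcoef]
  have heval : ∀ θ : ℝ, ‖H.eval (circleMap 0 1 θ)‖ = |p.eval (a * Real.cos θ)| := by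
    intro θ
    set z := circleMap 0 1 θ with hz
    have hz1 : ‖z‖ = 1 := by simp [hz]
    have hBz : B.eval z = z * ((a * Real.cos θ : ℝ) : ℂ) := by
      have hzz : z = Complex.exp (θ * Complex.I) := by simp [hz, circleMap]
      rw [hB]
      simp only [Polynomial.eval_mul, Polynomial.eval_C, Polynomial.eval_add, Polynomial.eval_pow,
        Polynomial.eval_X, Polynomial.eval_one]
      push_cast
      rw [Complex.cos, hzz, neg_mul, Complex.exp_neg]
      have := Complex.exp_ne_zero (θ * Complex.I)
      field_simp
    have : H.eval z = z^n * ((p.eval (a * Real.cos θ) : ℝ) : ℂ) := by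
      rw [hH, Polynomial.eval_finsetSum, Polynomial.eval_eq_sum_range, hn, Complex.ofReal_sum, Finset.mul_sum]
      refine Finset.sum_congr rfl fun j hj => ?_
      have hj := Finset.mem_range.1 hj
      simp only [Polynomial.eval_mul, Polynomial.eval_C, Polynomial.eval_pow, Polynomial.eval_X]
      rw [hBz, mul_pow]
      obtain ⟨m, rfl⟩ := Nat.exists_eq_add_of_le (Nat.lt_succ_iff.1 hj)
      rw [Nat.add_sub_cancel_left, pow_add]
      push_cast; ring
    rw [this, norm_mul, norm_pow, hz1, one_pow, one_mul, Complex.norm_real, Real.norm_eq_abs]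
  have hii := Polynomial.intervalIntegrable_mahlerMeasure (p := H)
  simp only [heval] at hii
  have hi1 : IntervalIntegrable (fun θ => Real.log |p.eval (a * Real.cos θ)|) volume 0 Real.pi := by
    apply hii.mono_set
    rw [uIcc_of_le hpi.le, uIcc_of_le (by positivity)]
    exact Icc_subset_Icc le_rfl (by linarith)
  have hi2 : IntervalIntegrable (fun θ => Real.log |p.eval (a * Real.cos θ)|) volume Real.pi (2*Real.pi) := by
    apply hii.mono_set
    rw [uIcc_of_le (by linarith), uIcc_of_le (by positivity)]
    exact Icc_subset_Icc hpi.le le_rfl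
  refine ⟨hi1, ?_⟩
  have hsplit := intervalIntegral.integral_add_adjacent_intervals hi1 hi2
  have hrefl := intervalIntegral.integral_comp_sub_left (fun θ => Real.log |p.eval (a * Real.cos θ)|)
    (a := 0) (b := Real.pi) (2 * Real.pi)
  simp only [Real.cos_two_pi_sub, sub_zero] at hrefl
  rw [show 2 * Real.pi - Real.pi = Real.pi by ring] at hrefl
  have hM := H.leadingCoeff_le_mahlerMeasure
  have hH0 : H ≠ 0 := by
    intro h0
    rw [h0, Polynomial.leadingCoeff_zero] at hlead
    exact hval.ne (by exact_mod_cast hlead)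
  rw [hlead, Complex.norm_real, Real.norm_of_nonneg hval.le] at hM
  have hlog := Real.log_le_log hval hM
  rw [← Polynomial.logMahlerMeasure_eq_log_MahlerMeasure, Polynomial.logMahlerMeasure_def,
    Real.circleAverage_def] at hlog
  simp only [heval, smul_eq_mul] at hlog
  rw [← hsplit, ← hrefl, Real.log_mul hγ.ne' (by positivity), Real.log_pow] at hlog
  have e : (2 * Real.pi)⁻¹ * ((∫ θ in (0:ℝ)..Real.pi, Real.log |p.eval (a * Real.cos θ)|) +
    ∫ θ in (0:ℝ)..Real.pi, Real.log |p.eval (a * Real.cos θ)|) =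
    (∫ θ in (0:ℝ)..Real.pi, Real.log |p.eval (a * Real.cos θ)|) / Real.pi := by field_simp; ring
  rw [e, le_div_iff₀ hpi] at hlog
  linarith

lemma AA_cos {Q : ℝ → ℝ} (heven : ∀ x, Q (-x) = Q x) (a : ℝ) :
    ∫ θ in (0:ℝ)..Real.pi, Q (a * Real.cos θ) = Real.pi * AA Q a := by
  have hpi := Real.pi_pos
  have hper : Function.Periodic (fun θ => Q (a * Real.sin θ)) Real.pi := by
    intro θ
    simp only [Real.sin_add_pi, mul_neg, heven]
  have h1 := hper.intervalIntegral_add_eq 0 (Real.pi/2)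
  have h2 := intervalIntegral.integral_comp_add_right (fun θ => Q (a * Real.sin θ)) (a := 0) (b := Real.pi) (Real.pi/2)
  simp only [Real.sin_add_pi_div_two] at h2
  rw [h2, AA, show (0:ℝ) + Real.pi/2 = Real.pi/2 by ring, add_comm Real.pi, ← h1, zero_add]
  field_simp

lemma upper_bound {Q W : ℝ → ℝ} (hW : ∀ x, W x = Real.exp (-Q x)) (hQc : Continuous Q)
    (hQ : ∀ x, 0 ≤ Q x) (heven : ∀ x, Q (-x) = Q x)
    (p : Polynomial ℝ) (n : ℕ) (hn : p.natDegree = n) (hγ : 0 < p.leadingCoeff)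
    (h1 : ∫ x, p.eval x * p.eval x * (W x)^2 = 1) {a : ℝ} (ha : 0 < a) :
    Real.log p.leadingCoeff ≤ n * Real.log 2 - n * Real.log a + AA Q a + 1 + |Real.log a| := by
  have hpi := Real.pi_pos
  have hWc : Continuous W := by
    have : W = fun x => Real.exp (-Q x) := funext hW
    rw [this]; fun_prop
  obtain ⟨hi, hm⟩ := mahler_bound p n hn hγ ha
  set f : ℝ → ℝ := fun x => p.eval x * p.eval x * (W x)^2 with hf
  have hfc : Continuous f := by fun_prop
  have hf0 : ∀ x, 0 ≤ f x := fun x => mul_nonneg (mul_self_nonneg _) (sq_nonneg _)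
  have hint : Integrable f := by
    by_contra hcon
    rw [integral_undef hcon] at h1; simp at h1
  have hsub : ∫ θ in (0:ℝ)..Real.pi, f (a * Real.cos θ) * (a * Real.sin θ) ≤ 1 := by
    have h := intervalIntegral.integral_comp_mul_deriv (a := 0) (b := Real.pi)
      (f := fun θ => a * Real.cos θ) (f' := fun θ => a * (-Real.sin θ)) (g := f)
      (fun θ _ => (Real.hasDerivAt_cos θ).const_mul a) (Continuous.continuousOn (by fun_prop)) hfc
    have e : ∫ θ in (0:ℝ)..Real.pi, f (a * Real.cos θ) * (a * Real.sin θ) =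
        - ∫ θ in (0:ℝ)..Real.pi, (f ∘ fun θ => a * Real.cos θ) θ * (a * (-Real.sin θ)) := by
      rw [← intervalIntegral.integral_neg]; congr 1; ext θ; simp
    rw [e, h, ← intervalIntegral.integral_symm, ← h1]
    simp only [Real.cos_zero, Real.cos_pi]
    rw [intervalIntegral.integral_of_le (by linarith)]
    exact setIntegral_le_integral hint (Eventually.of_forall hf0)
  have hlogsin : IntervalIntegrable (fun θ => Real.log (Real.sin θ)) volume 0 Real.pi := intervalIntegrable_log_sin
  have hQi : IntervalIntegrable (fun θ => Q (a * Real.cos θ)) volume 0 Real.pi :=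
    Continuous.intervalIntegrable (by fun_prop) _ _
  have hmain : ∫ θ in (0:ℝ)..Real.pi, (2 * Real.log |p.eval (a * Real.cos θ)| - 2 * Q (a * Real.cos θ)
      + (Real.log a + Real.log (Real.sin θ))) ≤ ∫ θ in (0:ℝ)..Real.pi, (f (a * Real.cos θ) * (a * Real.sin θ) + |Real.log a|) := by
    apply intervalIntegral.integral_mono_on_of_le_Ioo hpi.le
    · exact ((hi.const_mul 2).sub (hQi.const_mul 2)).add (intervalIntegrable_const.add hlogsin)
    · exact Continuous.intervalIntegrable (by fun_prop) _ _
    intro θ hθ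
    have hs : 0 < Real.sin θ := Real.sin_pos_of_pos_of_lt_pi hθ.1 hθ.2
    have hls : Real.log (Real.sin θ) ≤ 0 := Real.log_nonpos hs.le (Real.sin_le_one θ)
    have hab := le_abs_self (Real.log a)
    have hab0 := abs_nonneg (Real.log a)
    have hpos : 0 ≤ f (a * Real.cos θ) * (a * Real.sin θ) := mul_nonneg (hf0 _) (by positivity)
    have hQp := hQ (a * Real.cos θ)
    by_cases hz : p.eval (a * Real.cos θ) = 0
    · rw [hz]; simp only [abs_zero, Real.log_zero]; linarith
    · have hz' : 0 < |p.eval (a * Real.cos θ)| := abs_pos.2 hz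
      have e : Real.log (f (a * Real.cos θ) * (a * Real.sin θ)) =
          2 * Real.log |p.eval (a * Real.cos θ)| - 2 * Q (a * Real.cos θ) + (Real.log a + Real.log (Real.sin θ)) := by
        rw [hf]
        simp only
        rw [← abs_mul_abs_self, ← pow_two, hW, Real.log_mul (by positivity) (by positivity),
          Real.log_mul (by positivity) (by positivity), Real.log_mul (by positivity) (by positivity),
          Real.log_pow, Real.log_pow, Real.log_exp]
        push_cast; ring
      rw [← e]
      have := Real.log_le_self hpos
      linarith
  rw [intervalIntegral.integral_add (Continuous.intervalIntegrable (by fun_prop) _ _) intervalIntegrable_const,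
    intervalIntegral.integral_add ((hi.const_mul 2).sub (hQi.const_mul 2)) (intervalIntegrable_const.add hlogsin),
    intervalIntegral.integral_sub (hi.const_mul 2) (hQi.const_mul 2),
    intervalIntegral.integral_add intervalIntegrable_const hlogsin,
    intervalIntegral.integral_const_mul, intervalIntegral.integral_const_mul, AA_cos heven,
    integral_log_sin_zero_pi] at hmain
  simp only [intervalIntegral.integral_const, sub_zero, smul_eq_mul] at hmain
  rw [Real.log_div ha.ne' (by norm_num)] at hm
  have hab := neg_abs_le (Real.log a)
  have hl2 : Real.log 2 < 1 := by
    have := Real.log_two_lt_d9; linarith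
  have h3 := Real.pi_gt_three
  have : Real.pi * Real.log p.leadingCoeff ≤ Real.pi * (n * Real.log 2 - n * Real.log a + AA Q a + 1 + |Real.log a|) := by
    nlinarith [mul_le_mul_of_nonneg_left hab hpi.le, mul_lt_mul_of_pos_left hl2 hpi]
  exact le_of_mul_le_mul_left this hpi

lemma lower_raw {Q Q' W : ℝ → ℝ} (hW : ∀ x, W x = Real.exp (-Q x)) (heven : ∀ x, Q (-x) = Q x)
    (hd : ∀ x, HasDerivAt Q (Q' x) x) (hQ0 : Q 0 = 0)
    (hc : Continuous Q') (hm : Monotone Q') (h0 : Q' 0 = 0) {a : ℕ → ℝ}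
    (ha : ∀ n, 1 ≤ n → 0 < a n ∧ nn Q' (a n) = n) {p : ℕ → Polynomial ℝ}
    (h1 : ∀ j, (p j).natDegree = j) (h2 : ∀ j, 0 < (p j).leadingCoeff)
    (h3 : ∀ j k, (∫ x : ℝ, (p j).eval x * (p k).eval x * (W x) ^ 2) = if j = k then 1 else 0)
    (k : ℕ) (hk : 1 ≤ k) (n : ℕ) :
    1 ≤ (p n).leadingCoeff^2 * (2 * Real.pi * a (n+1) *
      (2^(n/k+1) * ((1/2)^n * ∏ i ∈ Finset.range n, a (i+1+k)))^2) := by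
  have hQc : Continuous Q := continuous_iff_continuousAt.2 fun x => (hd x).continuousAt
  have hWc : Continuous W := by
    have : W = fun x => Real.exp (-Q x) := funext hW
    rw [this]; fun_prop
  obtain ⟨P, hP, hPn, hb⟩ := block_exists (fun n hn => (ha n hn).1)
    (fun i j hi hij => a_mono hc hm h0 ha hi hij) k hk n
  set M := (2:ℝ)^(n/k+1) * ((1/2)^n * ∏ i ∈ Finset.range n, a (i+1+k)) with hM
  have hM0 : 0 ≤ M := by
    have : 0 ≤ ∏ i ∈ Finset.range n, a (i+1+k) := Finset.prod_nonneg fun i _ => (ha _ (by omega)).1.le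
    positivity
  have hbp : 0 < a (n+1) := (ha _ (by omega)).1
  have hQge : ∀ x, ∑ i ∈ Finset.range n, GG |x| (a (i+1)) + GG |x| (a (n+1)) ≤ Q x := by
    intro x
    rw [← Finset.sum_range_succ (fun i => GG |x| (a (i+1))), ← sum_Icc_range (fun i => GG |x| (a i))]
    have hQa : Q x = Q |x| := by
      rcases abs_choice x with h | h <;> rw [h]
      rw [heven]
    rw [hQa]
    rcases (abs_nonneg x).eq_or_lt with h | h
    · rw [← h, hQ0]
      apply le_of_eq
      apply Finset.sum_eq_zero
      intro i hi
      rw [GG, if_neg]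
      exact not_lt.2 (ha i (Finset.mem_Icc.1 hi).1).1.le
    · exact sum_GG_le hd hQ0 hc hm h0 ha _ h
  have hpt : ∀ x, (P.eval x)^2 * (W x)^2 ≤ M^2 * (2 * (1 + (x/a (n+1))^2)⁻¹) := by
    intro x
    have e1 : |P.eval x| * W x ≤ M * Real.exp (-GG |x| (a (n+1))) := by
      calc _ ≤ M * Real.exp (∑ i ∈ Finset.range n, GG |x| (a (i+1))) * Real.exp (-Q x) := by
            rw [hW]; exact mul_le_mul_of_nonneg_right (hb x) (Real.exp_pos _).le
        _ = M * Real.exp (∑ i ∈ Finset.range n, GG |x| (a (i+1)) - Q x) := by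
            rw [mul_assoc, ← Real.exp_add, sub_eq_add_neg]
        _ ≤ _ := by
            apply mul_le_mul_of_nonneg_left _ hM0
            apply Real.exp_le_exp.2
            linarith [hQge x]
    have e0 : 0 ≤ |P.eval x| * W x := by rw [hW]; positivity
    calc _ = (|P.eval x| * W x)^2 := by rw [mul_pow, sq_abs]
      _ ≤ (M * Real.exp (-GG |x| (a (n+1))))^2 := by gcongr
      _ = M^2 * Real.exp (-GG |x| (a (n+1)))^2 := by rw [mul_pow]
      _ ≤ _ := by gcongr; exact exp_neg_GG hbp
  have hgi : Integrable (fun x : ℝ => M^2 * (2 * (1 + (x/a (n+1))^2)⁻¹)) :=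
    ((integrable_inv_one_add_sq.comp_div hbp.ne').const_mul 2).const_mul _
  have hle := integral_mono_of_nonneg (μ := volume) (Eventually.of_forall fun x => by positivity) hgi
    (Eventually.of_forall hpt)
  have hval : ∫ x : ℝ, M^2 * (2 * (1 + (x/a (n+1))^2)⁻¹) = 2 * Real.pi * a (n+1) * M^2 := by
    rw [integral_const_mul, integral_const_mul,
      Measure.integral_comp_div (fun x : ℝ => (1 + x^2)⁻¹), integral_univ_inv_one_add_sq,
      abs_of_pos hbp, smul_eq_mul]
    ring
  rw [hval] at hle
  refine (extremal hWc h1 h2 h3 n P hP hPn).trans ?_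
  gcongr

lemma lower_log {Q Q' W : ℝ → ℝ} (hW : ∀ x, W x = Real.exp (-Q x)) (heven : ∀ x, Q (-x) = Q x)
    (hd : ∀ x, HasDerivAt Q (Q' x) x) (hQ0 : Q 0 = 0)
    (hc : Continuous Q') (hm : Monotone Q') (h0 : Q' 0 = 0) {a : ℕ → ℝ}
    (ha : ∀ n, 1 ≤ n → 0 < a n ∧ nn Q' (a n) = n) {p : ℕ → Polynomial ℝ}
    (h1 : ∀ j, (p j).natDegree = j) (h2 : ∀ j, 0 < (p j).leadingCoeff)
    (h3 : ∀ j k, (∫ x : ℝ, (p j).eval x * (p k).eval x * (W x) ^ 2) = if j = k then 1 else 0)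
    (k : ℕ) (hk : 1 ≤ k) : ∃ C : ℝ, ∀ n : ℕ, 1 ≤ n →
    n * Real.log 2 - n * Real.log (a n) + AA Q (a n) - n * (Real.log 2 / k)
      - (C + Real.log (a n) + k * Real.log (a (n+k)) + Real.log (a (n+1)) / 2)
      ≤ Real.log (p n).leadingCoeff := by
  refine ⟨Real.log (2 * Real.pi) / 2 + Real.log 2 + (AA Q (a 1) - Real.log (a 1))
    - ∑ i ∈ Finset.range k, Real.log (a (i+1)), fun n hn => ?_⟩
  have hpi := Real.pi_pos
  have hraw := lower_raw hW heven hd hQ0 hc hm h0 ha h1 h2 h3 k hk n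
  have hA := AA_sum hd hc hm h0 ha n hn
  have hbp : 0 < a (n+1) := (ha _ (by omega)).1
  have hprod : 0 < ∏ i ∈ Finset.range n, a (i+1+k) := Finset.prod_pos fun i _ => (ha _ (by omega)).1
  have hγ := h2 n
  have hl := Real.log_nonneg hraw
  rw [Real.log_mul (by positivity) (by positivity), Real.log_mul (by positivity) (by positivity),
    Real.log_mul (by positivity) (by positivity), Real.log_pow, Real.log_pow,
    Real.log_mul (by positivity) (by positivity), Real.log_mul (by positivity) (by positivity),
    Real.log_mul (by positivity) (by positivity),
    Real.log_pow, Real.log_pow, Real.log_prod (fun i _ => (ha _ (by omega)).1.ne'),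
    one_div, Real.log_inv] at hl
  push_cast at hl
  have hS : ∑ i ∈ Finset.range k, Real.log (a (i+1)) + ∑ i ∈ Finset.range n, Real.log (a (i+1+k)) =
      ∑ i ∈ Finset.range n, Real.log (a (i+1)) + ∑ i ∈ Finset.range k, Real.log (a (n+i+1)) := by
    rw [← Finset.sum_range_add (fun i => Real.log (a (i+1))), add_comm n k, Finset.sum_range_add]
    congr 1
    refine Finset.sum_congr rfl fun i _ => ?_
    congr 2; omega
  have hS2 : ∑ i ∈ Finset.range k, Real.log (a (n+i+1)) ≤ k * Real.log (a (n+k)) := by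
    have := Finset.sum_le_card_nsmul (Finset.range k) (fun i => Real.log (a (n+i+1))) (Real.log (a (n+k)))
      (fun i hi => Real.log_le_log (ha _ (by omega)).1
        (a_mono hc hm h0 ha (by omega) (by have := Finset.mem_range.1 hi; omega)))
    simpa using this
  rw [sum_Icc_range] at hA
  have hdiv : ((n/k : ℕ) : ℝ) * Real.log 2 ≤ n * (Real.log 2 / k) := by
    have h := Nat.cast_div_le (α := ℝ) (m := n) (n := k)
    calc _ ≤ ((n:ℝ)/k) * Real.log 2 := by
          apply mul_le_mul_of_nonneg_right h (Real.log_nonneg (by norm_num))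
      _ = _ := by ring
  have h2pi : Real.log (2 * Real.pi) = Real.log 2 + Real.log Real.pi :=
    Real.log_mul (by norm_num) hpi.ne'
  linarith

lemma a_lin {Q' : ℝ → ℝ} (hc : Continuous Q') (hm : Monotone Q') (h0 : Q' 0 = 0)
    (h1 : 0 < Q' 1) {a : ℕ → ℝ}
    (ha : ∀ n, 1 ≤ n → 0 < a n ∧ nn Q' (a n) = n) : ∃ C > 0, ∀ n : ℕ, 1 ≤ n → a n ≤ C * n := by
  have hpi := Real.pi_pos
  refine ⟨(1 + Q' 1) * Real.pi / (2 * Q' 1), by positivity, fun n hn => ?_⟩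
  obtain ⟨hap, hnn⟩ := ha n hn
  have hlow : 2 * Q' 1 * a n - Q' 1 * Real.pi ≤ Real.pi * n := by
    have hi : ∫ θ in (0:ℝ)..Real.pi, (Q' 1 * a n * Real.sin θ - Q' 1) = 2 * Q' 1 * a n - Q' 1 * Real.pi := by
      rw [intervalIntegral.integral_sub (Continuous.intervalIntegrable (by fun_prop) _ _)
        (Continuous.intervalIntegrable (by fun_prop) _ _), intervalIntegral.integral_const_mul,
        integral_sin]
      simp; ring
    have hn2 : Real.pi * n = ∫ θ in (0:ℝ)..Real.pi, (a n * Real.sin θ) * Q' (a n * Real.sin θ) := by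
      rw [← hnn, nn]; field_simp
    rw [hn2, ← hi]
    apply intervalIntegral.integral_mono_on hpi.le
      (Continuous.intervalIntegrable (by fun_prop) _ _)
      (Continuous.intervalIntegrable (by fun_prop) _ _)
    intro θ hθ
    have hu : 0 ≤ a n * Real.sin θ := mul_nonneg hap.le (Real.sin_nonneg_of_mem_Icc hθ)
    set u := a n * Real.sin θ
    have e : Q' 1 * a n * Real.sin θ = Q' 1 * u := by simp only [u]; ring
    rw [e]
    have hq : 0 ≤ Q' u := h0 ▸ hm hu
    rcases le_total 1 u with h | h
    · nlinarith [hm h]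
    · nlinarith [mul_nonneg hu hq]
  have hn1 : (1:ℝ) ≤ n := by exact_mod_cast hn
  rw [div_mul_eq_mul_div, le_div_iff₀ (by positivity)]
  nlinarith [mul_le_mul_of_nonneg_left hn1 (mul_pos h1 hpi).le]

lemma log_small {Q' : ℝ → ℝ} (hc : Continuous Q') (hm : Monotone Q') (h0 : Q' 0 = 0)
    (h1 : 0 < Q' 1) {a : ℕ → ℝ}
    (ha : ∀ n, 1 ≤ n → 0 < a n ∧ nn Q' (a n) = n) (j : ℕ) :
    Tendsto (fun n : ℕ => Real.log (a (n+j)) / n) atTop (𝓝 0) := by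
  obtain ⟨C, hC, hlin⟩ := a_lin hc hm h0 h1 ha
  have hbase : Tendsto (fun n : ℕ => Real.log (a n) / n) atTop (𝓝 0) := by
    have hlog : Tendsto (fun n : ℕ => Real.log (n:ℝ) / n) atTop (𝓝 0) := by
      have := Real.isLittleO_log_id_atTop.tendsto_div_nhds_zero
      exact this.comp tendsto_natCast_atTop_atTop
    have hup : Tendsto (fun n : ℕ => Real.log C / n + Real.log (n:ℝ) / n) atTop (𝓝 0) := by
      simpa using (tendsto_const_div_atTop_nhds_zero_nat (Real.log C)).add hlog
    refine tendsto_of_tendsto_of_tendsto_of_le_of_le'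
      (tendsto_const_div_atTop_nhds_zero_nat (Real.log (a 1))) hup ?_ ?_
    · filter_upwards [eventually_ge_atTop 1] with n hn
      have := Real.log_le_log (ha 1 le_rfl).1 (a_mono hc hm h0 ha le_rfl hn)
      gcongr
    · filter_upwards [eventually_ge_atTop 1] with n hn
      have hn1 : (0:ℝ) < n := by exact_mod_cast hn
      have := Real.log_le_log (ha n hn).1 (hlin n hn)
      rw [Real.log_mul hC.ne' hn1.ne'] at this
      rw [← add_div]
      gcongr
  have hsh := (tendsto_add_atTop_iff_nat j).2 hbase
  have hr : Tendsto (fun n : ℕ => 1 + (j:ℝ) / n) atTop (𝓝 1) := by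
    simpa using (tendsto_const_div_atTop_nhds_zero_nat (j:ℝ)).const_add 1
  have := hsh.mul hr
  rw [zero_mul] at this
  refine this.congr' ?_
  filter_upwards [eventually_ge_atTop 1] with n hn
  have hn1 : (0:ℝ) < n := by exact_mod_cast hn
  push_cast
  have : (n:ℝ) + j ≠ 0 := by positivity
  field_simp

lemma Q_near {Q Q' : ℝ → ℝ} (hQc : Continuous Q) (hc : Continuous Q') (hm : Monotone Q')
    (h0 : Q' 0 = 0) {α : ℝ} (hα : 1 < α)
    (hT : Tendsto (fun x : ℝ => x * Q' x / Q x) atTop (𝓝 α)) {ε : ℝ} (hε : 0 < ε) :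
    ∃ K : ℝ, ∀ u, 0 ≤ u → |Q u - (u * Q' u) / α| ≤ ε * (u * Q' u) + K := by
  have hinv := hT.inv₀ (by positivity)
  obtain ⟨R, hR⟩ := eventually_atTop.1 (((Metric.tendsto_nhds.1 hinv ε hε).and
    (hT.eventually (lt_mem_nhds (zero_lt_one.trans hα)))).and (eventually_gt_atTop 0))
  obtain ⟨K, hK⟩ := isCompact_Icc.exists_bound_of_continuousOn (s := Icc 0 R)
    (f := fun u => Q u - (u * Q' u) / α) (Continuous.continuousOn (by fun_prop))
  refine ⟨|K|, fun u hu => ?_⟩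
  have hh : 0 ≤ u * Q' u := mul_nonneg hu (h0 ▸ hm hu)
  rcases le_total u R with h | h
  · have := hK u ⟨hu, h⟩
    rw [Real.norm_eq_abs] at this
    have := le_abs_self K
    nlinarith [mul_nonneg hε.le hh]
  · obtain ⟨⟨e1, e2⟩, e3⟩ := hR u h
    have hpos : 0 < u * Q' u := by
      rcases hh.eq_or_lt with h' | h'
      · rw [← h'] at e2; simp at e2
      · exact h'
    rw [inv_div, Real.dist_eq] at e1
    have : Q u - (u * Q' u) / α = (u * Q' u) * (Q u / (u * Q' u) - α⁻¹) := by
      have : Q u = (u * Q' u) * (Q u / (u * Q' u)) := by rw [mul_div_cancel₀]; exact hpos.ne'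
      rw [mul_sub, ← this]; ring
    rw [this, abs_mul, abs_of_pos hpos]
    nlinarith [abs_nonneg K]

lemma AA_lim {Q Q' : ℝ → ℝ} (hQc : Continuous Q) (hc : Continuous Q') (hm : Monotone Q')
    (h0 : Q' 0 = 0) {α : ℝ} (hα : 1 < α)
    (hT : Tendsto (fun x : ℝ => x * Q' x / Q x) atTop (𝓝 α)) {a : ℕ → ℝ}
    (ha : ∀ n, 1 ≤ n → 0 < a n ∧ nn Q' (a n) = n) :
    Tendsto (fun n : ℕ => AA Q (a n) / n) atTop (𝓝 (1/α)) := by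
  have hpi := Real.pi_pos
  rw [Metric.tendsto_nhds]
  intro ε hε
  obtain ⟨K, hK⟩ := Q_near hQc hc hm h0 hα hT (half_pos hε)
  have hKn := (tendsto_const_div_atTop_nhds_zero_nat K).eventually (gt_mem_nhds (half_pos hε))
  filter_upwards [eventually_ge_atTop 1, hKn] with n hn hKn
  obtain ⟨hap, hnn⟩ := ha n hn
  have hn1 : (0:ℝ) < n := by exact_mod_cast hn
  have key : |AA Q (a n) - n / α| ≤ ε/2 * n + K := by
    have hA : AA Q (a n) - n / α = (1/Real.pi) * ∫ θ in (0:ℝ)..Real.pi,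
        (Q (a n * Real.sin θ) - ((a n * Real.sin θ) * Q' (a n * Real.sin θ)) / α) := by
      rw [intervalIntegral.integral_sub (Continuous.intervalIntegrable (by fun_prop) _ _)
        (Continuous.intervalIntegrable (by fun_prop) _ _), intervalIntegral.integral_div, ← hnn, AA, nn]
      ring
    have hB : ε/2 * n + K = (1/Real.pi) * ∫ θ in (0:ℝ)..Real.pi,
        (ε/2 * ((a n * Real.sin θ) * Q' (a n * Real.sin θ)) + K) := by
      rw [intervalIntegral.integral_add (Continuous.intervalIntegrable (by fun_prop) _ _)
        (Continuous.intervalIntegrable (by fun_prop) _ _), intervalIntegral.integral_const_mul, ← hnn, nn,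
        intervalIntegral.integral_const, smul_eq_mul]
      field_simp
      ring
    rw [hA, hB, abs_mul, abs_of_pos (by positivity : 0 < 1/Real.pi)]
    apply mul_le_mul_of_nonneg_left _ (by positivity)
    refine (intervalIntegral.abs_integral_le_integral_abs hpi.le).trans ?_
    apply intervalIntegral.integral_mono_on hpi.le
      (Continuous.intervalIntegrable (by fun_prop) _ _)
      (Continuous.intervalIntegrable (by fun_prop) _ _)
    intro θ hθ
    exact hK _ (mul_nonneg hap.le (Real.sin_nonneg_of_mem_Icc hθ))
  rw [Real.dist_eq]
  have : AA Q (a n) / n - 1/α = (AA Q (a n) - n / α) / n := by field_simp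
  rw [this, abs_div, abs_of_pos hn1, div_lt_iff₀ hn1]
  rw [div_lt_iff₀ hn1] at hKn
  linarith

lemma log_lim {Q Q' W : ℝ → ℝ} (hW : ∀ x, W x = Real.exp (-Q x)) (heven : ∀ x, Q (-x) = Q x)
    (hQ : ∀ x, 0 ≤ Q x)
    (hd : ∀ x, HasDerivAt Q (Q' x) x) (hQ0 : Q 0 = 0)
    (hc : Continuous Q') (hm : Monotone Q') (h0 : Q' 0 = 0) (hQ1 : 0 < Q' 1) {a : ℕ → ℝ}
    (ha : ∀ n, 1 ≤ n → 0 < a n ∧ nn Q' (a n) = n) {p : ℕ → Polynomial ℝ}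
    (h1 : ∀ j, (p j).natDegree = j) (h2 : ∀ j, 0 < (p j).leadingCoeff)
    (h3 : ∀ j k, (∫ x : ℝ, (p j).eval x * (p k).eval x * (W x) ^ 2) = if j = k then 1 else 0)
    {α : ℝ} (hα : 1 < α) (hT : Tendsto (fun x : ℝ => x * Q' x / Q x) atTop (𝓝 α)) :
    Tendsto (fun n : ℕ => Real.log (p n).leadingCoeff / n + Real.log (a n)) atTop
      (𝓝 (Real.log 2 + 1/α)) := by
  have hQc : Continuous Q := continuous_iff_continuousAt.2 fun x => (hd x).continuousAt
  have hAA := AA_lim hQc hc hm h0 hα hT ha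
  have hls := log_small hc hm h0 hQ1 ha
  have hl0 : Tendsto (fun n : ℕ => Real.log (a n) / n) atTop (𝓝 0) := hls 0
  rw [tendsto_order]
  constructor
  · intro c hclt
    have hkl := (tendsto_const_div_atTop_nhds_zero_nat (Real.log 2)).eventually
      (gt_mem_nhds (sub_pos.2 hclt))
    obtain ⟨k, hkc, hk⟩ := (hkl.and (eventually_ge_atTop 1)).exists
    obtain ⟨C, hC⟩ := lower_log hW heven hd hQ0 hc hm h0 ha h1 h2 h3 k hk
    have hlim : Tendsto (fun n : ℕ => Real.log 2 + AA Q (a n) / n - Real.log 2 / k -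
        (C / n + Real.log (a n) / n + k * (Real.log (a (n+k)) / n) + (Real.log (a (n+1)) / n) / 2)) atTop
        (𝓝 (Real.log 2 + 1/α - Real.log 2 / k - (0 + 0 + k * 0 + 0 / 2))) :=
      ((hAA.const_add _).sub_const _).sub
        ((((tendsto_const_div_atTop_nhds_zero_nat C).add hl0).add ((hls k).const_mul _)).add
          ((hls 1).div_const 2))
    have hlt : c < Real.log 2 + 1/α - Real.log 2 / k - (0 + 0 + k * 0 + 0 / 2) := by linarith
    filter_upwards [hlim.eventually (lt_mem_nhds hlt), eventually_ge_atTop 1] with n hn hn1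
    refine hn.trans_le ?_
    have hn0 : (0:ℝ) < n := by exact_mod_cast hn1
    have := div_le_div_of_nonneg_right (hC n hn1) hn0.le
    refine le_trans (le_of_eq ?_) (add_le_add_left this (Real.log (a n)))
    field_simp
    ring
  · intro c hclt
    have hlim : Tendsto (fun n : ℕ => Real.log 2 + AA Q (a n) / n + 1 / n + |Real.log (a n) / n|) atTop
        (𝓝 (Real.log 2 + 1/α + 0 + |0|)) :=
      ((hAA.const_add _).add (tendsto_const_div_atTop_nhds_zero_nat 1)).add hl0.abs
    have hlt : Real.log 2 + 1/α + 0 + |0| < c := by simpa using hclt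
    filter_upwards [hlim.eventually (gt_mem_nhds hlt), eventually_ge_atTop 1] with n hn hn1
    refine lt_of_le_of_lt ?_ hn
    have hn0 : (0:ℝ) < n := by exact_mod_cast hn1
    have hub := upper_bound hW hQc hQ heven (p n) n (h1 n) (h2 n) (by rw [h3, if_pos rfl]) (ha n hn1).1
    have := div_le_div_of_nonneg_right hub hn0.le
    refine (add_le_add_left this (Real.log (a n))).trans (le_of_eq ?_)
    rw [abs_div, abs_of_pos hn0]
    field_simp
    ring

theorem statement_13
    (Q Q' Q'' W : ℝ → ℝ) (hW : ∀ x, W x = Real.exp (-Q x))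
    (hFC2 : IsFC2 Q Q' Q'')
    (hQeven : ∀ x, Q (-x) = Q x)
    (α : ℝ) (hα : 1 < α)
    (hT : Tendsto (fun x : ℝ => x * Q' x / Q x) atTop (𝓝 α))
    (p : ℕ → Polynomial ℝ) (hp : OrthonormalPolys W p)
    (an : ℕ → ℝ) (han : IsMRSeven Q' an) :
    Tendsto (fun n : ℕ => ((p n).leadingCoeff) ^ ((1 : ℝ) / n) * an n)
      atTop (𝓝 (2 * Real.exp (1 / α))) := by
  obtain ⟨h1, h2, h3⟩ := hp
  have h0 : Q' 0 = 0 := by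
    have hmin : IsLocalMin Q 0 := Eventually.of_forall fun x => by
      rw [hFC2.zeroAtZero]; exact hFC2.nonneg x
    exact hmin.hasDerivAt_eq_zero (hFC2.hasDeriv 0)
  have hQ1 : 0 < Q' 1 := by
    have hge : 0 ≤ Q' 1 := h0 ▸ hFC2.monoDeriv zero_le_one
    obtain ⟨Λ, hΛ, hb⟩ := hFC2.lambdaBound
    rcases hge.eq_or_lt with h | h
    · have := hb 1 one_ne_zero
      rw [← h] at this
      simp at this
      linarith
    · exact h
  have ha : ∀ n : ℕ, 1 ≤ n → 0 < an n ∧ nn Q' (an n) = n := fun n hn =>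
    ⟨(han n hn).1, by rw [← nn_eq hFC2.contDeriv]; exact (han n hn).2⟩
  have hlim := log_lim hW hQeven hFC2.nonneg hFC2.hasDeriv hFC2.zeroAtZero hFC2.contDeriv
    hFC2.monoDeriv h0 hQ1 ha h1 h2 h3 hα hT
  have hexp := (Real.continuous_exp.tendsto _).comp hlim
  rw [Real.exp_add, Real.exp_log two_pos] at hexp
  refine hexp.congr' ?_
  filter_upwards [eventually_ge_atTop 1] with n hn
  simp only [Function.comp]
  rw [Real.exp_add, Real.exp_log (ha n hn).1, Real.rpow_def_of_pos (h2 n)]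
  congr 2
  ring
end
end
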